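/- For every t > 0 and every M > 0 there exist smooth functions θ, ψ : ℝ² × [0,t] → ℝ, 2π-periodic in both space variables, with ∫_{[0,2π]²} θ(x,y,s) dx dy = 0 for all s, satisfying Δψ(·,s) = θ(·,s) and ∂_t θ = ∂_x θ · ∂_y ψ − ∂_y θ · ∂_x ψ on ℝ² × [0,t], such that 0 < ‖θ(·,0)‖_∞ ≤ 1, ‖∇θ(·,0)‖_∞ > 0, and ‖∇θ(·,t)‖_∞ > M · ‖∇θ(·,0)‖_∞. (That is, the Euler evolution operator is linearly unbounded in the Lipschitz norm at every positive time.) -/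

import Mathlib

open Real MeasureTheory Set

/-- Spatial partial derivative in `x` of a function of `(x, y, t)`. -/
noncomputable def pX (f : ℝ → ℝ → ℝ → ℝ) (x y t : ℝ) : ℝ := deriv (fun x' => f x' y t) x

/-- Spatial partial derivative in `y` of a function of `(x, y, t)`. -/
noncomputable def pY (f : ℝ → ℝ → ℝ → ℝ) (x y t : ℝ) : ℝ := deriv (fun y' => f x y' t) y

/-- Second spatial partial derivative in `x`. -/
noncomputable def pXX (f : ℝ → ℝ → ℝ → ℝ) (x y t : ℝ) : ℝ := deriv (fun x' => pX f x' y t) x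

/-- Second spatial partial derivative in `y`. -/
noncomputable def pYY (f : ℝ → ℝ → ℝ → ℝ) (x y t : ℝ) : ℝ := deriv (fun y' => pY f x y' t) y

/-- Sup norm over `ℝ²` of a function of two variables. -/
noncomputable def supNorm (f : ℝ → ℝ → ℝ) : ℝ := ⨆ p : ℝ × ℝ, |f p.1 p.2|

/-- Sup norm over `ℝ²` of the (Euclidean) spatial gradient of `f(·,·,t)`. -/
noncomputable def gradSupNorm (f : ℝ → ℝ → ℝ → ℝ) (t : ℝ) : ℝ :=
  ⨆ p : ℝ × ℝ, Real.sqrt ((pX f p.1 p.2 t) ^ 2 + (pY f p.1 p.2 t) ^ 2)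

/-- `θ, ψ` form a smooth, `2π`-periodic (in both space variables) solution of the
2D Euler equation in vorticity form on the torus, on the time interval `[0, T]`:
`Δψ(·,t) = θ(·,t)`, `θ(·,t)` has zero average and
`∂ₜθ = ∂ₓθ ∂_yψ − ∂_yθ ∂ₓψ`. -/
def IsEulerOnTorus (T : ℝ) (θ ψ : ℝ → ℝ → ℝ → ℝ) : Prop :=
  ContDiffOn ℝ (⊤ : ℕ∞) (fun p : ℝ × ℝ × ℝ => θ p.1 p.2.1 p.2.2) {p : ℝ × ℝ × ℝ | p.2.2 ∈ Icc 0 T} ∧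
  ContDiffOn ℝ (⊤ : ℕ∞) (fun p : ℝ × ℝ × ℝ => ψ p.1 p.2.1 p.2.2) {p : ℝ × ℝ × ℝ | p.2.2 ∈ Icc 0 T} ∧
  (∀ x y t, θ (x + 2 * π) y t = θ x y t ∧ θ x (y + 2 * π) t = θ x y t) ∧
  (∀ x y t, ψ (x + 2 * π) y t = ψ x y t ∧ ψ x (y + 2 * π) t = ψ x y t) ∧
  (∀ t ∈ Icc 0 T, ∫ x in (0:ℝ)..(2 * π), ∫ y in (0:ℝ)..(2 * π), θ x y t = 0) ∧
  (∀ x y : ℝ, ∀ t ∈ Icc 0 T, pXX ψ x y t + pYY ψ x y t = θ x y t) ∧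
  (∀ x y : ℝ, ∀ t ∈ Icc 0 T,
    derivWithin (fun s => θ x y s) (Icc 0 T) t
      = pX θ x y t * pY ψ x y t - pY θ x y t * pX ψ x y t)

/-! ### Weights on the frequency lattice -/

/-- size of a frequency -/
noncomputable def nn (k : ℤ × ℤ) : ℝ := |(k.1 : ℝ)| + |(k.2 : ℝ)|
/-- weight of a frequency -/
noncomputable def wt (k : ℤ × ℤ) : ℝ := 1 + nn k

lemma nn_nonneg (k : ℤ × ℤ) : 0 ≤ nn k := by unfold nn; positivity
lemma one_le_wt (k : ℤ × ℤ) : 1 ≤ wt k := by unfold wt; linarith [nn_nonneg k]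
lemma wt_pos (k : ℤ × ℤ) : 0 < wt k := lt_of_lt_of_le one_pos (one_le_wt k)
lemma nn_le_wt (k : ℤ × ℤ) : nn k ≤ wt k := by unfold wt; linarith
lemma nn_add_le (j m : ℤ × ℤ) : nn (j + m) ≤ nn j + nn m := by
  unfold nn; push_cast [Prod.fst_add, Prod.snd_add]
  linarith [abs_add_le (j.1 : ℝ) m.1, abs_add_le (j.2 : ℝ) m.2]
lemma nn_neg (k : ℤ × ℤ) : nn (-k) = nn k := by unfold nn; simp
lemma wt_neg (k : ℤ × ℤ) : wt (-k) = wt k := by unfold wt; rw [nn_neg]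
lemma wt_add_le (j m : ℤ × ℤ) : wt (j + m) ≤ wt j + wt m := by
  unfold wt; linarith [nn_add_le j m]
lemma wt_add_le_mul (j m : ℤ × ℤ) : wt (j + m) ≤ wt j * wt m := by
  unfold wt; nlinarith [nn_add_le j m, nn_nonneg j, nn_nonneg m]
lemma wt_le_mul_sub (k m : ℤ × ℤ) : wt k ≤ wt m * wt (k - m) := by
  have := wt_add_le_mul m (k - m); simpa using this
lemma one_le_nn {k : ℤ × ℤ} (hk : k ≠ 0) : 1 ≤ nn k := by
  unfold nn
  have : k.1 ≠ 0 ∨ k.2 ≠ 0 := by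
    by_contra h; push Not at h; exact hk (Prod.ext h.1 h.2)
  rcases this with h | h
  · have : (1 : ℝ) ≤ |(k.1 : ℝ)| := by exact_mod_cast Int.one_le_abs h
    linarith [abs_nonneg (k.2 : ℝ)]
  · have : (1 : ℝ) ≤ |(k.2 : ℝ)| := by exact_mod_cast Int.one_le_abs h
    linarith [abs_nonneg (k.1 : ℝ)]

/-- squared Euclidean size -/
noncomputable def sq2 (k : ℤ × ℤ) : ℝ := (k.1 : ℝ) ^ 2 + (k.2 : ℝ) ^ 2
lemma sq2_nonneg (k : ℤ × ℤ) : 0 ≤ sq2 k := by unfold sq2; positivity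
lemma nn_sq_le (k : ℤ × ℤ) : nn k ^ 2 ≤ 2 * sq2 k := by
  unfold nn sq2
  nlinarith [sq_nonneg (|(k.1 : ℝ)| - |(k.2 : ℝ)|), sq_abs (k.1 : ℝ), sq_abs (k.2 : ℝ)]
lemma sq2_pos {k : ℤ × ℤ} (hk : k ≠ 0) : 0 < sq2 k := by
  nlinarith [nn_sq_le k, one_le_nn hk]
lemma sq2_neg (k : ℤ × ℤ) : sq2 (-k) = sq2 k := by unfold sq2; simp

lemma summable_one_add_abs_rpow : Summable (fun n : ℤ => (1 + |(n : ℝ)|) ^ (-(5/4) : ℝ)) := by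
  have h : Summable (fun n : ℕ => (1 + (n : ℝ)) ^ (-(5/4) : ℝ)) := by
    have := (summable_nat_add_iff 1).2 (Real.summable_nat_rpow.2 (by norm_num : (-(5/4) : ℝ) < -1))
    refine this.congr (fun n => ?_)
    push_cast; rw [add_comm]
  refine Summable.of_nat_of_neg ?_ ?_ <;> simpa using h

lemma summable_wt_rpow : Summable (fun k : ℤ × ℤ => wt k ^ (-(5/2) : ℝ)) := by
  have h := summable_one_add_abs_rpow.mul_of_nonneg summable_one_add_abs_rpow
    (fun n => by positivity) (fun n => by positivity)
  refine h.of_nonneg_of_le (fun k => (rpow_pos_of_pos (wt_pos k) _).le) (fun k => ?_)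
  have e : (-(5/2) : ℝ) = -(5/4) + -(5/4) := by norm_num
  rw [e, rpow_add (wt_pos k)]
  have h1 : wt k ^ (-(5/4) : ℝ) ≤ (1 + |(k.1 : ℝ)|) ^ (-(5/4) : ℝ) :=
    rpow_le_rpow_of_nonpos (by positivity) (by unfold wt nn; linarith [abs_nonneg (k.2 : ℝ)])
      (by norm_num)
  have h2 : wt k ^ (-(5/4) : ℝ) ≤ (1 + |(k.2 : ℝ)|) ^ (-(5/4) : ℝ) :=
    rpow_le_rpow_of_nonpos (by positivity) (by unfold wt nn; linarith [abs_nonneg (k.1 : ℝ)])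
      (by norm_num)
  exact mul_le_mul h1 h2 (rpow_pos_of_pos (wt_pos k) _).le (by positivity)

lemma summable_wt_inv : Summable (fun k : ℤ × ℤ => 1 / wt k ^ 3) := by
  refine summable_wt_rpow.of_nonneg_of_le (fun k => by have := wt_pos k; positivity) (fun k => ?_)
  rw [one_div, ← rpow_natCast, ← rpow_neg (wt_pos k).le]
  exact rpow_le_rpow_of_exponent_le (one_le_wt k) (by norm_num)

/-! ### Rapidly decaying sequences -/

/-- rapidly decaying sequence of Fourier coefficients -/
def RDs (a : ℤ × ℤ → ℂ) : Prop := ∀ r : ℕ, ∃ C, ∀ k, ‖a k‖ * wt k ^ r ≤ C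

lemma bound_of_le {a C : ℝ} {k : ℤ × ℤ} {r : ℕ} (h : a * wt k ^ (r + 3) ≤ C) :
    a * wt k ^ r ≤ C * (1 / wt k ^ 3) := by
  have := pow_pos (wt_pos k) 3
  rw [mul_one_div, le_div_iff₀ this]
  calc a * wt k ^ r * wt k ^ 3 = a * wt k ^ (r + 3) := by ring
    _ ≤ C := h

lemma RDs.summable {a : ℤ × ℤ → ℂ} (h : RDs a) (r : ℕ) : Summable (fun k => ‖a k‖ * wt k ^ r) := by
  obtain ⟨C, hC⟩ := h (r + 3)
  exact (summable_wt_inv.mul_left C).of_nonneg_of_le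
    (fun k => by have := wt_pos k; positivity) (fun k => bound_of_le (hC k))

lemma RDs.summable0 {a : ℤ × ℤ → ℂ} (h : RDs a) : Summable (fun k => ‖a k‖) := by
  simpa using h.summable 0

lemma RDs.mult {a : ℤ × ℤ → ℂ} (h : RDs a) {μ : ℤ × ℤ → ℂ} {C : ℝ} {p : ℕ}
    (hμ : ∀ k, ‖μ k‖ ≤ C * wt k ^ p) : RDs (fun k => μ k * a k) := by
  intro r
  obtain ⟨D, hD⟩ := h (r + p)
  have hC : 0 ≤ C := by
    have := (norm_nonneg _).trans (hμ 0)
    exact nonneg_of_mul_nonneg_left this (pow_pos (wt_pos 0) p)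
  refine ⟨C * D, fun k => ?_⟩
  rw [norm_mul]
  have := wt_pos k
  calc ‖μ k‖ * ‖a k‖ * wt k ^ r ≤ (C * wt k ^ p) * ‖a k‖ * wt k ^ r := by gcongr; exact hμ k
    _ = C * (‖a k‖ * wt k ^ (r + p)) := by ring
    _ ≤ C * D := by gcongr; exact hD k

lemma RDs.add {a b : ℤ × ℤ → ℂ} (ha : RDs a) (hb : RDs b) : RDs (fun k => a k + b k) := by
  intro r
  obtain ⟨C, hC⟩ := ha r
  obtain ⟨D, hD⟩ := hb r
  refine ⟨C + D, fun k => ?_⟩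
  have := wt_pos k
  calc ‖a k + b k‖ * wt k ^ r ≤ (‖a k‖ + ‖b k‖) * wt k ^ r := by gcongr; exact norm_add_le _ _
    _ ≤ C + D := by linarith [hC k, hD k]

lemma RDs.sub {a b : ℤ × ℤ → ℂ} (ha : RDs a) (hb : RDs b) : RDs (fun k => a k - b k) := by
  have h := ha.add (hb.mult (μ := fun _ => -1) (C := 1) (p := 0) (by simp))
  refine (funext fun k => ?_ : (fun k => a k + -1 * b k) = fun k => a k - b k) ▸ h
  ring

lemma RDs.const_mul {a : ℤ × ℤ → ℂ} (ha : RDs a) (c : ℂ) : RDs (fun k => c * a k) :=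
  ha.mult (μ := fun _ => c) (C := ‖c‖) (p := 0) (by simp)

lemma RDs_of_support {a : ℤ × ℤ → ℂ} (S : Finset (ℤ × ℤ)) (h : ∀ k ∉ S, a k = 0) : RDs a := by
  intro r
  refine ⟨∑ k ∈ S, ‖a k‖ * wt k ^ r, fun k => ?_⟩
  have hp : ∀ k ∈ S, 0 ≤ ‖a k‖ * wt k ^ r := fun k _ => by have := wt_pos k; positivity
  by_cases hk : k ∈ S
  · exact Finset.single_le_sum hp hk
  · simp [h k hk]; exact Finset.sum_nonneg hp

/-! ### Exponentials and Fourier series -/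

/-- the character `e^{i k·x}` -/
noncomputable def ee (k : ℤ × ℤ) (x y : ℝ) : ℂ :=
  Complex.exp (((k.1 : ℂ) * x + (k.2 : ℂ) * y) * Complex.I)

lemma norm_ee (k : ℤ × ℤ) (x y : ℝ) : ‖ee k x y‖ = 1 := by
  have := Complex.norm_exp_ofReal_mul_I (k.1 * x + k.2 * y)
  unfold ee; push_cast at this; exact this
lemma ee_add (j m : ℤ × ℤ) (x y : ℝ) : ee (j + m) x y = ee j x y * ee m x y := by
  unfold ee; rw [← Complex.exp_add]; congr 1; push_cast [Prod.fst_add, Prod.snd_add]; ring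
lemma ee_zero (x y : ℝ) : ee 0 x y = 1 := by unfold ee; simp
lemma ee_conj (k : ℤ × ℤ) (x y : ℝ) : (starRingEnd ℂ) (ee k x y) = ee (-k) x y := by
  unfold ee; rw [← Complex.exp_conj]; congr 1; simp; ring
lemma ee_period_x (k : ℤ × ℤ) (x y : ℝ) : ee k (x + 2 * π) y = ee k x y := by
  unfold ee
  have : ((k.1 : ℂ) * ((x + 2 * π : ℝ) : ℂ) + (k.2 : ℂ) * y) * Complex.I
    = ((k.1 : ℂ) * x + (k.2 : ℂ) * y) * Complex.I + k.1 * (2 * π * Complex.I) := by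
    push_cast; ring
  rw [this, Complex.exp_add, Complex.exp_int_mul_two_pi_mul_I, mul_one]
lemma ee_period_y (k : ℤ × ℤ) (x y : ℝ) : ee k x (y + 2 * π) = ee k x y := by
  unfold ee
  have : ((k.1 : ℂ) * x + (k.2 : ℂ) * ((y + 2 * π : ℝ) : ℂ)) * Complex.I
    = ((k.1 : ℂ) * x + (k.2 : ℂ) * y) * Complex.I + k.2 * (2 * π * Complex.I) := by
    push_cast; ring
  rw [this, Complex.exp_add, Complex.exp_int_mul_two_pi_mul_I, mul_one]
lemma hasDerivAt_ee_x (k : ℤ × ℤ) (x y : ℝ) :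
    HasDerivAt (fun x' => ee k x' y) (Complex.I * k.1 * ee k x y) x := by
  unfold ee
  have h : HasDerivAt (fun x' : ℝ => ((k.1 : ℂ) * x' + (k.2 : ℂ) * y) * Complex.I)
      ((k.1 : ℂ) * 1 * Complex.I) x :=
    (((Complex.ofRealCLM.hasDerivAt (x := x)).const_mul (k.1 : ℂ)).add_const _).mul_const _
  convert h.cexp using 1; ring
lemma hasDerivAt_ee_y (k : ℤ × ℤ) (x y : ℝ) :
    HasDerivAt (fun y' => ee k x y') (Complex.I * k.2 * ee k x y) y := by
  unfold ee
  have h : HasDerivAt (fun y' : ℝ => ((k.1 : ℂ) * x + (k.2 : ℂ) * y') * Complex.I)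
      ((k.2 : ℂ) * 1 * Complex.I) y :=
    (((Complex.ofRealCLM.hasDerivAt (x := y)).const_mul (k.2 : ℂ)).const_add _).mul_const _
  convert h.cexp using 1; ring

/-- Fourier series with coefficients `a` -/
noncomputable def Fs (a : ℤ × ℤ → ℂ) (x y : ℝ) : ℂ := ∑' k, a k * ee k x y

lemma Fs_summable {a : ℤ × ℤ → ℂ} (h : Summable (fun k => ‖a k‖)) (x y : ℝ) :
    Summable (fun k => a k * ee k x y) := by
  refine Summable.of_norm ?_; simpa [norm_ee] using h

lemma Fs_norm_le {a : ℤ × ℤ → ℂ} (h : Summable (fun k => ‖a k‖)) (x y : ℝ) :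
    ‖Fs a x y‖ ≤ ∑' k, ‖a k‖ := by
  unfold Fs
  refine (norm_tsum_le_tsum_norm ?_).trans ?_ <;> simp [norm_ee, h]

lemma Fs_add {a b : ℤ × ℤ → ℂ} (ha : Summable (fun k => ‖a k‖)) (hb : Summable (fun k => ‖b k‖))
    (x y : ℝ) : Fs (fun k => a k + b k) x y = Fs a x y + Fs b x y := by
  unfold Fs; rw [← (Fs_summable ha x y).tsum_add (Fs_summable hb x y)]
  congr 1; ext k; ring

lemma Fs_sub {a b : ℤ × ℤ → ℂ} (ha : Summable (fun k => ‖a k‖)) (hb : Summable (fun k => ‖b k‖))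
    (x y : ℝ) : Fs (fun k => a k - b k) x y = Fs a x y - Fs b x y := by
  unfold Fs; rw [← (Fs_summable ha x y).tsum_sub (Fs_summable hb x y)]
  congr 1; ext k; ring

lemma Fs_const_mul (a : ℤ × ℤ → ℂ) (c : ℂ) (x y : ℝ) :
    Fs (fun k => c * a k) x y = c * Fs a x y := by
  unfold Fs; rw [← tsum_mul_left]; congr 1; ext k; ring

lemma Fs_period_x (a : ℤ × ℤ → ℂ) (x y : ℝ) : Fs a (x + 2 * π) y = Fs a x y := by
  simp [Fs, ee_period_x]
lemma Fs_period_y (a : ℤ × ℤ → ℂ) (x y : ℝ) : Fs a x (y + 2 * π) = Fs a x y := by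
  simp [Fs, ee_period_y]

/-- multiplier of `∂_x` -/
noncomputable def dX (a : ℤ × ℤ → ℂ) (k : ℤ × ℤ) : ℂ := Complex.I * k.1 * a k
/-- multiplier of `∂_y` -/
noncomputable def dY (a : ℤ × ℤ → ℂ) (k : ℤ × ℤ) : ℂ := Complex.I * k.2 * a k

lemma norm_I_fst (k : ℤ × ℤ) : ‖Complex.I * (k.1 : ℂ)‖ ≤ 1 * wt k ^ 1 := by
  simp [wt, nn]; linarith [abs_nonneg (k.2 : ℝ)]
lemma norm_I_snd (k : ℤ × ℤ) : ‖Complex.I * (k.2 : ℂ)‖ ≤ 1 * wt k ^ 1 := by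
  simp [wt, nn]; linarith [abs_nonneg (k.1 : ℝ)]
lemma RDs.dX {a : ℤ × ℤ → ℂ} (h : RDs a) : RDs (dX a) := h.mult norm_I_fst
lemma RDs.dY {a : ℤ × ℤ → ℂ} (h : RDs a) : RDs (dY a) := h.mult norm_I_snd

lemma Fs_hasDerivAt_x {a : ℤ × ℤ → ℂ} (h : RDs a) (x y : ℝ) :
    HasDerivAt (fun x' => Fs a x' y) (Fs (dX a) x y) x := by
  unfold Fs
  have := hasDerivAt_tsum (u := fun k => ‖dX a k‖) (g := fun k x' => a k * ee k x' y)
    (g' := fun k x' => dX a k * ee k x' y) (y₀ := 0) h.dX.summable0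
    (fun k x' => by
      exact ((hasDerivAt_ee_x k x' y).const_mul (a k)).congr_deriv (by unfold dX; ring))
    (fun k x' => by simp [norm_ee]) (Fs_summable h.summable0 0 y) x
  exact this

lemma Fs_hasDerivAt_y {a : ℤ × ℤ → ℂ} (h : RDs a) (x y : ℝ) :
    HasDerivAt (fun y' => Fs a x y') (Fs (dY a) x y) y := by
  unfold Fs
  have := hasDerivAt_tsum (u := fun k => ‖dY a k‖) (g := fun k y' => a k * ee k x y')
    (g' := fun k y' => dY a k * ee k x y') (y₀ := 0) h.dY.summable0
    (fun k y' => by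
      exact ((hasDerivAt_ee_y k x y').const_mul (a k)).congr_deriv (by unfold dY; ring))
    (fun k x' => by simp [norm_ee]) (Fs_summable h.summable0 x 0) y
  exact this

lemma Fs_continuous {a : ℤ × ℤ → ℂ} (h : Summable (fun k => ‖a k‖)) :
    Continuous (fun p : ℝ × ℝ => Fs a p.1 p.2) := by
  unfold Fs
  refine continuous_tsum (fun k => ?_) h (fun k p => by simp [norm_ee])
  unfold ee; fun_prop

/-! ### Convolution -/

/-- convolution of coefficient sequences -/
noncomputable def cv (a b : ℤ × ℤ → ℂ) (k : ℤ × ℤ) : ℂ := ∑' m, a m * b (k - m)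

/-- the shear change of variables `(m, j) ↦ (m + j, m)` -/
def shearE : (ℤ × ℤ) × (ℤ × ℤ) ≃ (ℤ × ℤ) × (ℤ × ℤ) where
  toFun p := (p.1 + p.2, p.1)
  invFun q := (q.2, q.1 - q.2)
  left_inv p := by simp
  right_inv q := by simp

lemma summable_cv_prod {f g : ℤ × ℤ → ℝ} (hf : Summable f) (hg : Summable g) (hf0 : ∀ k, 0 ≤ f k)
    (hg0 : ∀ k, 0 ≤ g k) :
    Summable (fun q : (ℤ × ℤ) × (ℤ × ℤ) => f q.2 * g (q.1 - q.2)) :=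
  shearE.symm.summable_iff (f := fun p : (ℤ × ℤ) × (ℤ × ℤ) => f p.1 * g p.2) |>.2
    (hf.mul_of_nonneg hg hf0 hg0)

lemma cv_norm_summable {a b : ℤ × ℤ → ℂ} (ha : Summable (fun k => ‖a k‖))
    (hb : Summable (fun k => ‖b k‖)) : Summable (fun k => ‖cv a b k‖) ∧
    ∑' k, ‖cv a b k‖ ≤ (∑' k, ‖a k‖) * ∑' k, ‖b k‖ := by
  have h := summable_cv_prod ha hb (fun _ => norm_nonneg _) (fun _ => norm_nonneg _)
  have h1 : ∀ k, ‖cv a b k‖ ≤ ∑' m, ‖a m‖ * ‖b (k - m)‖ := fun k => by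
    have := h.prod_factor k
    unfold cv
    refine (norm_tsum_le_tsum_norm ?_).trans ?_ <;> simp [this]
  have hs : Summable (fun k => ∑' m, ‖a m‖ * ‖b (k - m)‖) := h.prod
  have hs' := hs.of_nonneg_of_le (fun _ => norm_nonneg _) h1
  refine ⟨hs', (hs'.tsum_le_tsum h1 hs).trans ?_⟩
  have e1 : ∑' k, ∑' m, ‖a m‖ * ‖b (k - m)‖
      = ∑' q : (ℤ × ℤ) × (ℤ × ℤ), ‖a q.2‖ * ‖b (q.1 - q.2)‖ := (h.tsum_prod).symm
  have e2 : ∑' q : (ℤ × ℤ) × (ℤ × ℤ), ‖a q.2‖ * ‖b (q.1 - q.2)‖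
      = ∑' p : (ℤ × ℤ) × (ℤ × ℤ), ‖a p.1‖ * ‖b p.2‖ :=
    shearE.symm.tsum_eq (fun p : (ℤ × ℤ) × (ℤ × ℤ) => ‖a p.1‖ * ‖b p.2‖)
  rw [e1, e2]
  exact (tsum_mul_tsum_of_summable_norm (f := fun k => ‖a k‖) (g := fun k => ‖b k‖) (by simpa using ha) (by simpa using hb)).ge

lemma Fs_cv {a b : ℤ × ℤ → ℂ} (ha : Summable (fun k => ‖a k‖))
    (hb : Summable (fun k => ‖b k‖)) (x y : ℝ) : Fs (cv a b) x y = Fs a x y * Fs b x y := by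
  have h := summable_cv_prod ha hb (fun _ => norm_nonneg _) (fun _ => norm_nonneg _)
  have hA := Fs_summable ha x y
  have hB := Fs_summable hb x y
  have hA' : Summable (fun k => ‖a k * ee k x y‖) := by simpa [norm_ee] using ha
  have hB' : Summable (fun k => ‖b k * ee k x y‖) := by simpa [norm_ee] using hb
  unfold Fs
  rw [tsum_mul_tsum_of_summable_norm hA' hB']
  rw [← shearE.symm.tsum_eq (fun p : (ℤ × ℤ) × (ℤ × ℤ) => a p.1 * ee p.1 x y * (b p.2 * ee p.2 x y))]
  have hh : Summable (fun q : (ℤ × ℤ) × (ℤ × ℤ) => a q.2 * b (q.1 - q.2) * ee q.1 x y) := by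
    refine Summable.of_norm ?_; simpa [norm_ee] using h
  have : ∀ q : (ℤ × ℤ) × (ℤ × ℤ), (fun p : (ℤ × ℤ) × (ℤ × ℤ) =>
      a p.1 * ee p.1 x y * (b p.2 * ee p.2 x y)) (shearE.symm q)
      = a q.2 * b (q.1 - q.2) * ee q.1 x y := by
    intro q
    have : ee q.1 x y = ee q.2 x y * ee (q.1 - q.2) x y := by rw [← ee_add]; simp
    simp only [shearE, Equiv.coe_fn_symm_mk]; rw [this]; ring
  simp_rw [this]
  rw [hh.tsum_prod]
  congr 1; ext k
  unfold cv; rw [← tsum_mul_right]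

/-! ### Mean value and uniqueness of Fourier coefficients -/

lemma integral_exp_int (n : ℤ) (hn : n ≠ 0) (c : ℂ) :
    ∫ x in (0:ℝ)..(2 * π), Complex.exp (((n : ℂ) * x + c) * Complex.I) = 0 := by
  have hne : (n : ℂ) * Complex.I ≠ 0 := by simp [hn]
  have h : ∀ x : ℝ, Complex.exp (((n : ℂ) * x + c) * Complex.I)
      = Complex.exp (c * Complex.I) * Complex.exp ((n : ℂ) * Complex.I * x) := by
    intro x; rw [← Complex.exp_add]; congr 1; ring
  simp_rw [h]
  rw [intervalIntegral.integral_const_mul, integral_exp_mul_complex hne]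
  have : (n : ℂ) * Complex.I * ((2 * π : ℝ) : ℂ) = n * (2 * π * Complex.I) := by push_cast; ring
  rw [this, Complex.exp_int_mul_two_pi_mul_I]
  simp

lemma integral_ee (k : ℤ × ℤ) :
    ∫ x in (0:ℝ)..(2 * π), ∫ y in (0:ℝ)..(2 * π), ee k x y = if k = 0 then (2 * π : ℂ) ^ 2 else 0 := by
  by_cases h2 : k.2 = 0
  · have : ∀ x y : ℝ, ee k x y = Complex.exp (((k.1 : ℂ) * x + 0) * Complex.I) := by
      intro x y; simp [ee, h2]
    simp_rw [this]
    simp only [intervalIntegral.integral_const, sub_zero]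
    rw [intervalIntegral.integral_smul]
    by_cases h1 : k.1 = 0
    · have : k = 0 := Prod.ext h1 h2
      rw [if_pos this]; simp [h1]; ring
    · have : k ≠ 0 := fun h => h1 (by rw [h]; rfl)
      rw [if_neg this, integral_exp_int _ h1, smul_zero]
  · have hk : k ≠ 0 := fun h => h2 (by rw [h]; rfl)
    rw [if_neg hk]
    have : ∀ x : ℝ, ∫ y in (0:ℝ)..(2 * π), ee k x y = 0 := by
      intro x
      rw [← integral_exp_int k.2 h2 ((k.1 : ℂ) * x)]
      refine intervalIntegral.integral_congr (fun y _ => ?_)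
      simp only [ee]; congr 1; ring
    simp [this]

lemma continuous_ee (k : ℤ × ℤ) : Continuous (fun p : ℝ × ℝ => ee k p.1 p.2) := by
  unfold ee; fun_prop

lemma integral_Fs {a : ℤ × ℤ → ℂ} (ha : Summable (fun k => ‖a k‖)) :
    ∫ x in (0:ℝ)..(2 * π), ∫ y in (0:ℝ)..(2 * π), Fs a x y = (2 * π : ℂ) ^ 2 * a 0 := by
  have hin : ∀ x : ℝ, HasSum (fun k => ∫ y in (0:ℝ)..(2 * π), a k * ee k x y)
      (∫ y in (0:ℝ)..(2 * π), Fs a x y) := by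
    intro x
    refine intervalIntegral.hasSum_integral_of_dominated_convergence (fun k _ => ‖a k‖)
      (fun k => ?_) (fun k => ?_) ?_ ?_ ?_
    · have : Continuous fun y => a k * ee k x y :=
        continuous_const.mul ((continuous_ee k).comp (by fun_prop : Continuous fun y : ℝ => (x, y)))
      exact this.aestronglyMeasurable
    · exact Filter.Eventually.of_forall fun y _ => by simp [norm_ee]
    · exact Filter.Eventually.of_forall fun y _ => ha
    · exact intervalIntegrable_const
    · exact Filter.Eventually.of_forall fun y _ => (Fs_summable ha x y).hasSum
  have hout : HasSum (fun k => ∫ x in (0:ℝ)..(2 * π), ∫ y in (0:ℝ)..(2 * π), a k * ee k x y)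
      (∫ x in (0:ℝ)..(2 * π), ∫ y in (0:ℝ)..(2 * π), Fs a x y) := by
    refine intervalIntegral.hasSum_integral_of_dominated_convergence
      (fun k _ => ‖a k‖ * (2 * π)) (fun k => ?_) (fun k => ?_) ?_ ?_ ?_
    · have : Continuous fun x => ∫ y in (0:ℝ)..(2 * π), a k * ee k x y :=
        intervalIntegral.continuous_parametric_intervalIntegral_of_continuous' 
          (by
            have h : Continuous (fun p : ℝ × ℝ => a k * ee k p.1 p.2) := continuous_const.mul (continuous_ee k)
            simpa [Function.uncurry_def] using h) _ _
      exact this.aestronglyMeasurable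
    · refine Filter.Eventually.of_forall fun x _ => ?_
      have := intervalIntegral.norm_integral_le_of_norm_le_const (a := 0) (b := 2 * π)
        (f := fun y => a k * ee k x y) (C := ‖a k‖) (fun y _ => by simp [norm_ee])
      simpa [abs_of_pos Real.pi_pos] using this
    · exact Filter.Eventually.of_forall fun y _ => ha.mul_right _
    · exact intervalIntegrable_const
    · exact Filter.Eventually.of_forall fun x _ => hin x
  rw [← hout.tsum_eq, tsum_eq_single 0]
  · simp_rw [intervalIntegral.integral_const_mul]
    rw [integral_ee, if_pos rfl]; ring
  · intro k hk
    simp_rw [intervalIntegral.integral_const_mul]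
    rw [integral_ee, if_neg hk, mul_zero]

lemma Fs_shift {a : ℤ × ℤ → ℂ} (l : ℤ × ℤ) (x y : ℝ) :
    Fs (fun k => a (k + l)) x y = Fs a x y * ee (-l) x y := by
  unfold Fs
  rw [← tsum_mul_right, ← (Equiv.addRight l).tsum_eq (fun k => a k * ee k x y * ee (-l) x y)]
  congr 1; ext k
  simp only [Equiv.coe_addRight]
  rw [mul_assoc, ← ee_add]; simp

lemma Fs_eq_zero {a : ℤ × ℤ → ℂ} (ha : Summable (fun k => ‖a k‖)) (h : ∀ x y, Fs a x y = 0)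
    (l : ℤ × ℤ) : a l = 0 := by
  have hs : Summable (fun k => ‖a (k + l)‖) := (Equiv.addRight l).summable_iff.2 ha
  have := integral_Fs hs
  simp_rw [Fs_shift, h] at this
  have hpi : (2 * π : ℂ) ^ 2 ≠ 0 := by simp [Real.pi_ne_zero]
  simp at this
  exact this

/-! ### Reality and parity -/

lemma Fs_real {a : ℤ × ℤ → ℂ} (h : ∀ k, (starRingEnd ℂ) (a k) = a (-k)) (x y : ℝ) :
    ((Fs a x y).re : ℂ) = Fs a x y := by
  rw [← Complex.conj_eq_iff_re]
  unfold Fs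
  rw [Complex.conj_tsum, ← (Equiv.neg (ℤ × ℤ)).tsum_eq (fun k => a k * ee k x y)]
  congr 1; ext k
  rw [map_mul, h, ee_conj]; rfl

/-- reflection in the first coordinate -/
def sx : ℤ × ℤ ≃ ℤ × ℤ := (Equiv.neg ℤ).prodCongr (Equiv.refl ℤ)
/-- reflection in the second coordinate -/
def sy : ℤ × ℤ ≃ ℤ × ℤ := (Equiv.refl ℤ).prodCongr (Equiv.neg ℤ)
lemma sx_apply (k : ℤ × ℤ) : sx k = (-k.1, k.2) := rfl
lemma sy_apply (k : ℤ × ℤ) : sy k = (k.1, -k.2) := rfl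
lemma ee_sx (k : ℤ × ℤ) (x y : ℝ) : ee (sx k) x y = ee k (-x) y := by
  simp [ee, sx_apply]
lemma ee_sy (k : ℤ × ℤ) (x y : ℝ) : ee (sy k) x y = ee k x (-y) := by
  simp [ee, sy_apply]

lemma Fs_odd_x {a : ℤ × ℤ → ℂ} (h : ∀ k, a (sx k) = -a k) (x y : ℝ) :
    Fs a (-x) y = - Fs a x y := by
  unfold Fs
  rw [← sx.tsum_eq (fun k => a k * ee k x y), ← tsum_neg]
  congr 1; ext k
  rw [h, ee_sx]; ring
lemma Fs_odd_y {a : ℤ × ℤ → ℂ} (h : ∀ k, a (sy k) = -a k) (x y : ℝ) :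
    Fs a x (-y) = - Fs a x y := by
  unfold Fs
  rw [← sy.tsum_eq (fun k => a k * ee k x y), ← tsum_neg]
  congr 1; ext k
  rw [h, ee_sy]; ring

/-! ### The bilinear Euler operator on coefficients -/

/-- the interaction kernel -/
noncomputable def bt (m j : ℤ × ℤ) : ℝ := ((j.1 : ℝ) * m.2 - j.2 * m.1) / sq2 m

lemma abs_bt_mul (m j : ℤ × ℤ) : |bt m j| * nn m ≤ 2 * nn j := by
  by_cases hm : m = 0
  · subst hm; simp [bt, sq2]; exact nn_nonneg j
  have h1 := sq2_pos hm
  have h2 : |(j.1 : ℝ) * m.2 - j.2 * m.1| ≤ nn j * nn m := by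
    refine (abs_sub _ _).trans ?_
    rw [abs_mul, abs_mul]; unfold nn
    nlinarith [mul_nonneg (abs_nonneg (j.1 : ℝ)) (abs_nonneg (m.1 : ℝ)),
      mul_nonneg (abs_nonneg (j.2 : ℝ)) (abs_nonneg (m.2 : ℝ))]
  unfold bt
  rw [abs_div, abs_of_pos h1, div_mul_eq_mul_div, div_le_iff₀ h1]
  nlinarith [nn_sq_le m, nn_nonneg j, nn_nonneg m,
    mul_le_mul_of_nonneg_right h2 (nn_nonneg m), mul_le_mul_of_nonneg_left (nn_sq_le m) (nn_nonneg j)]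

lemma abs_bt_le (m j : ℤ × ℤ) : |bt m j| ≤ 2 * nn j := by
  by_cases hm : m = 0
  · subst hm; simp [bt, sq2]; exact nn_nonneg j
  nlinarith [abs_bt_mul m j, one_le_nn hm, abs_nonneg (bt m j)]

lemma bt_skew (k j : ℤ × ℤ) : bt (j - k) k = - bt (k - j) j := by
  unfold bt
  have : sq2 (j - k) = sq2 (k - j) := by rw [← sq2_neg]; congr 1; abel
  rw [this, ← neg_div]; congr 1
  push_cast [Prod.fst_sub, Prod.snd_sub]; ring

/-- the Euler bilinear form: `a` the advecting vorticity, `b` the advected one -/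
noncomputable def BB (a b : ℤ × ℤ → ℂ) (k : ℤ × ℤ) : ℂ := ∑' m, (bt m (k - m) : ℂ) * (a m * b (k - m))

lemma BB_term_bound {a b : ℤ × ℤ → ℂ} {A B : ℝ} {r : ℕ} (ha : ∀ k, ‖a k‖ * wt k ^ (r + 3) ≤ A)
    (hb : ∀ k, ‖b k‖ * wt k ^ (r + 1) ≤ B) (k m : ℤ × ℤ) :
    ‖(bt m (k - m) : ℂ) * (a m * b (k - m))‖ * wt k ^ r ≤ 2 * A * B * (1 / wt m ^ 3) := by
  rw [norm_mul, norm_mul, Complex.norm_real, Real.norm_eq_abs]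
  have h1 := (abs_bt_le m (k - m)).trans (mul_le_mul_of_nonneg_left (nn_le_wt (k - m)) two_pos.le)
  have h2 : wt k ^ r ≤ wt m ^ r * wt (k - m) ^ r := by
    rw [← mul_pow]; exact pow_le_pow_left₀ (wt_pos k).le (wt_le_mul_sub k m) r
  have h3 := bound_of_le (ha m)
  have hw := wt_pos (k - m)
  have hwm := wt_pos m
  have hwk := wt_pos k
  have hA : 0 ≤ A := le_trans (by have := wt_pos 0; positivity) (ha 0)
  calc |bt m (k - m)| * (‖a m‖ * ‖b (k - m)‖) * wt k ^ r
      ≤ (2 * wt (k - m)) * (‖a m‖ * ‖b (k - m)‖) * (wt m ^ r * wt (k - m) ^ r) := by gcongr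
    _ = 2 * (‖a m‖ * wt m ^ r) * (‖b (k - m)‖ * wt (k - m) ^ (r + 1)) := by ring
    _ ≤ 2 * (A * (1 / wt m ^ 3)) * B := by gcongr; exact hb _
    _ = _ := by ring

lemma BB_summable {a b : ℤ × ℤ → ℂ} (ha : RDs a) (hb : RDs b) (k : ℤ × ℤ) :
    Summable (fun m => (bt m (k - m) : ℂ) * (a m * b (k - m))) := by
  obtain ⟨A, hA⟩ := ha 3
  obtain ⟨B, hB⟩ := hb 1
  refine Summable.of_norm_bounded (summable_wt_inv.mul_left (2 * A * B)) (fun m => ?_)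
  simpa using BB_term_bound (r := 0) (by simpa using hA) (by simpa using hB) k m

/-- the constant in the bound of `BB` -/
noncomputable def cB : ℝ := ∑' k : ℤ × ℤ, 1 / wt k ^ 3

lemma BB_bound {a b : ℤ × ℤ → ℂ} {A B : ℝ} {r : ℕ} (ha : ∀ k, ‖a k‖ * wt k ^ (r + 3) ≤ A)
    (hb : ∀ k, ‖b k‖ * wt k ^ (r + 1) ≤ B) (k : ℤ × ℤ) :
    ‖BB a b k‖ * wt k ^ r ≤ 2 * A * B * cB := by
  have hw := pow_pos (wt_pos k) r
  rw [← le_div_iff₀ hw]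
  unfold BB cB
  rw [← tsum_mul_left, ← tsum_div_const]
  refine tsum_of_norm_bounded ((summable_wt_inv.mul_left _).div_const _).hasSum (fun m => ?_)
  rw [le_div_iff₀ hw]
  exact BB_term_bound ha hb k m

lemma RDs.BB {a b : ℤ × ℤ → ℂ} (ha : RDs a) (hb : RDs b) : RDs (BB a b) := by
  intro r
  obtain ⟨A, hA⟩ := ha (r + 3)
  obtain ⟨B, hB⟩ := hb (r + 1)
  exact ⟨_, BB_bound hA hB⟩

/-- inverse Laplacian on coefficients -/
noncomputable def iL (a : ℤ × ℤ → ℂ) (k : ℤ × ℤ) : ℂ := (-(1 / sq2 k) : ℝ) * a k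

lemma inv_sq2_le (k : ℤ × ℤ) : 1 / sq2 k ≤ 1 := by
  by_cases hk : k = 0
  · subst hk; simp [sq2]
  · rw [div_le_one (sq2_pos hk)]
    have h : (1 : ℤ) ≤ k.1 ^ 2 + k.2 ^ 2 := by
      have h := sq2_pos hk; unfold sq2 at h; 
      have : (0 : ℤ) < k.1 ^ 2 + k.2 ^ 2 := by exact_mod_cast h
      omega
    unfold sq2; exact_mod_cast h

lemma norm_iL_le (a : ℤ × ℤ → ℂ) (k : ℤ × ℤ) : ‖iL a k‖ ≤ ‖a k‖ := by
  unfold iL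
  rw [norm_mul, Complex.norm_real, norm_neg, Real.norm_eq_abs,
    abs_of_nonneg (by have := sq2_nonneg k; positivity)]
  exact mul_le_of_le_one_left (norm_nonneg _) (inv_sq2_le k)

lemma RDs.iL {a : ℤ × ℤ → ℂ} (h : RDs a) : RDs (iL a) := by
  intro r
  obtain ⟨C, hC⟩ := h r
  refine ⟨C, fun k => le_trans ?_ (hC k)⟩
  have := wt_pos k
  gcongr; exact norm_iL_le a k

lemma iL_laplace (a : ℤ × ℤ → ℂ) (h0 : a 0 = 0) (k : ℤ × ℤ) :
    dX (dX (iL a)) k + dY (dY (iL a)) k = a k := by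
  by_cases hk : k = 0
  · subst hk; simp [dX, dY, h0]
  have h := sq2_pos hk
  have h' : (sq2 k : ℂ) ≠ 0 := by exact_mod_cast h.ne'
  have e : (sq2 k : ℂ) = (k.1 : ℂ) ^ 2 + (k.2 : ℂ) ^ 2 := by simp [sq2]
  unfold dX dY iL
  push_cast
  field_simp
  rw [e]
  linear_combination (-(a k * ((k.1 : ℂ) ^ 2 + (k.2 : ℂ) ^ 2))) * Complex.I_sq

lemma Fs_BB {a b : ℤ × ℤ → ℂ} (ha : RDs a) (hb : RDs b) (x y : ℝ) :
    Fs (BB a b) x y = Fs (dX b) x y * Fs (dY (iL a)) x y - Fs (dY b) x y * Fs (dX (iL a)) x y := by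
  have s1 := ha.iL.dY.summable0
  have s2 := hb.dX.summable0
  have s3 := ha.iL.dX.summable0
  have s4 := hb.dY.summable0
  have e : BB a b = fun k => cv (dY (iL a)) (dX b) k - cv (dX (iL a)) (dY b) k := by
    ext k
    have h1 := (summable_cv_prod s1 s2 (fun _ => norm_nonneg _) (fun _ => norm_nonneg _)).prod_factor k
    have h2 := (summable_cv_prod s3 s4 (fun _ => norm_nonneg _) (fun _ => norm_nonneg _)).prod_factor k
    have h1' : Summable (fun m => dY (iL a) m * dX b (k - m)) := Summable.of_norm (by simpa using h1)
    have h2' : Summable (fun m => dX (iL a) m * dY b (k - m)) := Summable.of_norm (by simpa using h2)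
    unfold BB cv
    rw [← h1'.tsum_sub h2']
    congr 1; ext m
    unfold bt dX dY iL
    push_cast
    linear_combination (a m * b (k - m) * (m.2 * (k - m).1 - m.1 * (k - m).2) / sq2 m)
      * Complex.I_sq
  rw [e, Fs_sub (cv_norm_summable s1 s2).1 (cv_norm_summable s3 s4).1, Fs_cv s1 s2, Fs_cv s3 s4]
  ring

/-! ### Time dependent families -/

/-- uniformly rapidly decaying family on a time set -/
def URD (J : Set ℝ) (c : ℤ × ℤ → ℝ → ℂ) : Prop :=
  ∀ r : ℕ, ∃ C, ∀ k, ∀ s ∈ J, ‖c k s‖ * wt k ^ r ≤ C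

lemma URD.rds {J : Set ℝ} {c : ℤ × ℤ → ℝ → ℂ} (h : URD J c) {s : ℝ} (hs : s ∈ J) :
    RDs (fun k => c k s) := fun r => by
  obtain ⟨C, hC⟩ := h r
  exact ⟨C, fun k => hC k s hs⟩

lemma URD.bound {J : Set ℝ} {c : ℤ × ℤ → ℝ → ℂ} (h : URD J c) (r : ℕ) :
    ∃ u : ℤ × ℤ → ℝ, Summable u ∧ ∀ k, ∀ s ∈ J, ‖c k s‖ * wt k ^ r ≤ u k := by
  obtain ⟨C, hC⟩ := h (r + 3)
  exact ⟨_, summable_wt_inv.mul_left C, fun k s hs => bound_of_le (hC k s hs)⟩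

/-- `n` times differentiable in time, all derivatives rapidly decaying -/
def SM (J : Set ℝ) : ℕ → (ℤ × ℤ → ℝ → ℂ) → Prop
  | 0, c => URD J c ∧ ∀ k, ContinuousOn (c k) J
  | n + 1, c => URD J c ∧ ∃ c' : ℤ × ℤ → ℝ → ℂ,
      (∀ k, ∀ s ∈ J, HasDerivAt (c k) (c' k s) s) ∧ SM J n c'

lemma SM.urd {J : Set ℝ} {n : ℕ} {c : ℤ × ℤ → ℝ → ℂ} (h : SM J n c) : URD J c := by
  cases n <;> exact h.1

lemma SM.pred {J : Set ℝ} {n : ℕ} {c : ℤ × ℤ → ℝ → ℂ} (h : SM J (n + 1) c) : SM J n c := by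
  induction n generalizing c with
  | zero =>
    obtain ⟨h1, c', hc, _⟩ := h
    exact ⟨h1, fun k s hs => (hc k s hs).continuousAt.continuousWithinAt⟩
  | succ n ih =>
    obtain ⟨h1, c', hc, h2⟩ := h
    exact ⟨h1, c', hc, ih h2⟩

lemma URD.mult {J : Set ℝ} {c : ℤ × ℤ → ℝ → ℂ} (h : URD J c) {μ : ℤ × ℤ → ℂ} {C : ℝ} {p : ℕ}
    (hμ : ∀ k, ‖μ k‖ ≤ C * wt k ^ p) : URD J (fun k s => μ k * c k s) := by
  intro r
  obtain ⟨D, hD⟩ := h (r + p)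
  have hC : 0 ≤ C := by
    have := (norm_nonneg _).trans (hμ 0)
    exact nonneg_of_mul_nonneg_left this (pow_pos (wt_pos 0) p)
  refine ⟨C * D, fun k s hs => ?_⟩
  have := wt_pos k
  calc ‖μ k * c k s‖ * wt k ^ r ≤ (C * wt k ^ p) * ‖c k s‖ * wt k ^ r := by
        rw [norm_mul]; gcongr; exact hμ k
    _ = C * (‖c k s‖ * wt k ^ (r + p)) := by ring
    _ ≤ C * D := by gcongr; exact hD k s hs

lemma URD.add {J : Set ℝ} {a b : ℤ × ℤ → ℝ → ℂ} (ha : URD J a) (hb : URD J b) :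
    URD J (fun k s => a k s + b k s) := by
  intro r
  obtain ⟨C, hC⟩ := ha r
  obtain ⟨D, hD⟩ := hb r
  refine ⟨C + D, fun k s hs => ?_⟩
  have := wt_pos k
  calc ‖a k s + b k s‖ * wt k ^ r ≤ (‖a k s‖ + ‖b k s‖) * wt k ^ r := by
        gcongr; exact norm_add_le _ _
    _ ≤ C + D := by linarith [hC k s hs, hD k s hs]

lemma URD.BB {J : Set ℝ} {a b : ℤ × ℤ → ℝ → ℂ} (ha : URD J a) (hb : URD J b) :
    URD J (fun k s => BB (fun m => a m s) (fun m => b m s) k) := by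
  intro r
  obtain ⟨A, hA⟩ := ha (r + 3)
  obtain ⟨B, hB⟩ := hb (r + 1)
  exact ⟨_, fun k s hs => BB_bound (fun k => hA k s hs) (fun k => hB k s hs) k⟩

lemma SM.mult {J : Set ℝ} {n : ℕ} {c : ℤ × ℤ → ℝ → ℂ} (h : SM J n c) {μ : ℤ × ℤ → ℂ} {C : ℝ} {p : ℕ}
    (hμ : ∀ k, ‖μ k‖ ≤ C * wt k ^ p) : SM J n (fun k s => μ k * c k s) := by
  induction n generalizing c with
  | zero => exact ⟨h.1.mult hμ, fun k => continuousOn_const.mul (h.2 k)⟩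
  | succ n ih =>
    obtain ⟨h1, c', hc, h2⟩ := h
    exact ⟨h1.mult hμ, _, fun k s hs => (hc k s hs).const_mul (μ k), ih h2⟩

lemma SM.add {J : Set ℝ} {n : ℕ} {a b : ℤ × ℤ → ℝ → ℂ} (ha : SM J n a) (hb : SM J n b) :
    SM J n (fun k s => a k s + b k s) := by
  induction n generalizing a b with
  | zero => exact ⟨ha.1.add hb.1, fun k => (ha.2 k).add (hb.2 k)⟩
  | succ n ih =>
    obtain ⟨h1, c', hc, h2⟩ := ha
    obtain ⟨h1', d', hd, h2'⟩ := hb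
    exact ⟨h1.add h1', _, fun k s hs => (hc k s hs).add (hd k s hs), ih h2 h2'⟩

lemma SM_const {J : Set ℝ} (n : ℕ) {a : ℤ × ℤ → ℂ} (ha : RDs a) : SM J n (fun k _ => a k) := by
  have hu : ∀ {a : ℤ × ℤ → ℂ}, RDs a → URD J (fun k _ => a k) := fun h r => by
    obtain ⟨C, hC⟩ := h r
    exact ⟨C, fun k _ _ => hC k⟩
  induction n generalizing a with
  | zero => exact ⟨hu ha, fun k => continuousOn_const⟩
  | succ n ih =>
    exact ⟨hu ha, fun _ _ => 0, fun k s _ => hasDerivAt_const s (a k),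
      ih (a := fun _ => 0) (RDs_of_support ∅ (by simp))⟩

lemma BB_cont {J : Set ℝ} {a b : ℤ × ℤ → ℝ → ℂ} (ha : SM J 0 a) (hb : SM J 0 b) (k : ℤ × ℤ) :
    ContinuousOn (fun s => BB (fun m => a m s) (fun m => b m s) k) J := by
  obtain ⟨A, hA⟩ := ha.1 3
  obtain ⟨B, hB⟩ := hb.1 1
  refine continuousOn_tsum (u := fun m => 2 * A * B * (1 / wt m ^ 3)) (fun m => ?_)
    (summable_wt_inv.mul_left _) (fun m s hs => ?_)
  · exact continuousOn_const.mul ((ha.2 m).mul (hb.2 (k - m)))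
  · simpa using BB_term_bound (r := 0) (a := fun m => a m s) (b := fun m => b m s)
      (fun k => by simpa using hA k s hs) (fun k => by simpa using hB k s hs) k m

lemma BB_deriv {J : Set ℝ} (hJ : IsOpen J) (hJ' : IsPreconnected J) {a b a' b' : ℤ × ℤ → ℝ → ℂ}
    (ha : URD J a) (hb : URD J b) (ha' : URD J a') (hb' : URD J b')
    (hda : ∀ k, ∀ s ∈ J, HasDerivAt (a k) (a' k s) s) (hdb : ∀ k, ∀ s ∈ J, HasDerivAt (b k) (b' k s) s)
    (k : ℤ × ℤ) (s : ℝ) (hs : s ∈ J) :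
    HasDerivAt (fun s => BB (fun m => a m s) (fun m => b m s) k)
      (BB (fun m => a' m s) (fun m => b m s) k + BB (fun m => a m s) (fun m => b' m s) k) s := by
  have key : ∀ {a b : ℤ × ℤ → ℝ → ℂ}, URD J a → URD J b → ∃ C : ℝ, ∀ m, ∀ s ∈ J,
      ‖(bt m (k - m) : ℂ) * (a m s * b (k - m) s)‖ ≤ C * (1 / wt m ^ 3) := by
    intro a b ha hb
    obtain ⟨A, hA⟩ := ha 3
    obtain ⟨B, hB⟩ := hb 1
    refine ⟨2 * A * B, fun m s hs => ?_⟩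
    simpa using BB_term_bound (r := 0) (a := fun m => a m s) (b := fun m => b m s)
      (fun k => by simpa using hA k s hs) (fun k => by simpa using hB k s hs) k m
  obtain ⟨C, hC⟩ := key ha' hb
  obtain ⟨D, hD⟩ := key ha hb'
  have e : BB (fun m => a' m s) (fun m => b m s) k + BB (fun m => a m s) (fun m => b' m s) k
    = ∑' m, ((bt m (k - m) : ℂ) * (a' m s * b (k - m) s) + (bt m (k - m) : ℂ) * (a m s * b' (k - m) s)) :=
    ((BB_summable (ha'.rds hs) (hb.rds hs) k).tsum_add (BB_summable (ha.rds hs) (hb'.rds hs) k)).symm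
  rw [e]
  refine hasDerivAt_tsum_of_isPreconnected
    (g := fun m s => (bt m (k - m) : ℂ) * (a m s * b (k - m) s))
    (g' := fun m s => (bt m (k - m) : ℂ) * (a' m s * b (k - m) s) + (bt m (k - m) : ℂ) * (a m s * b' (k - m) s))
    (u := fun m => C * (1 / wt m ^ 3) + D * (1 / wt m ^ 3))
    ((summable_wt_inv.mul_left C).add (summable_wt_inv.mul_left D)) hJ hJ' (fun m s hs => ?_)
    (fun m s hs => (norm_add_le _ _).trans (add_le_add (hC m s hs) (hD m s hs))) hs
    (BB_summable (ha.rds hs) (hb.rds hs) k) hs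
  exact (((hda m s hs).mul (hdb (k - m) s hs)).const_mul (bt m (k - m) : ℂ)).congr_deriv (by ring)

lemma SM.BB {J : Set ℝ} (hJ : IsOpen J) (hJ' : IsPreconnected J) {n : ℕ} {a b : ℤ × ℤ → ℝ → ℂ}
    (ha : SM J n a) (hb : SM J n b) :
    SM J n (fun k s => BB (fun m => a m s) (fun m => b m s) k) := by
  induction n generalizing a b with
  | zero => exact ⟨ha.1.BB hb.1, BB_cont ha hb⟩
  | succ n ih =>
    have ha0 := ha.pred
    have hb0 := hb.pred
    obtain ⟨h1, a', hda, h2⟩ := ha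
    obtain ⟨h1', b', hdb, h2'⟩ := hb
    exact ⟨h1.BB h1', _, BB_deriv hJ hJ' h1 h1' h2.urd h2'.urd hda hdb,
      (ih h2 hb0).add (ih ha0 h2')⟩

lemma SM_of_euler {J : Set ℝ} (hJ : IsOpen J) (hJ' : IsPreconnected J) {c : ℤ × ℤ → ℝ → ℂ}
    (hc : URD J c) (hd : ∀ k, ∀ s ∈ J,
      HasDerivAt (c k) (_root_.BB (fun m => c m s) (fun m => c m s) k) s) (n : ℕ) :
    SM J n c := by
  induction n with
  | zero => exact ⟨hc, fun k s hs => (hd k s hs).continuousAt.continuousWithinAt⟩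
  | succ n ih => exact ⟨hc, _, hd, ih.BB hJ hJ' ih⟩

/-- space-time function -/
noncomputable def Ph (c : ℤ × ℤ → ℝ → ℂ) (p : ℝ × ℝ × ℝ) : ℂ := Fs (fun k => c k p.2.2) p.1 p.2.1

/-- first coordinate -/
noncomputable def L1 : ℝ × ℝ × ℝ →L[ℝ] ℝ := ContinuousLinearMap.fst ℝ ℝ (ℝ × ℝ)
/-- second coordinate -/
noncomputable def L2 : ℝ × ℝ × ℝ →L[ℝ] ℝ :=
  (ContinuousLinearMap.fst ℝ ℝ ℝ).comp (ContinuousLinearMap.snd ℝ ℝ (ℝ × ℝ))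
/-- third coordinate -/
noncomputable def L3 : ℝ × ℝ × ℝ →L[ℝ] ℝ :=
  (ContinuousLinearMap.snd ℝ ℝ ℝ).comp (ContinuousLinearMap.snd ℝ ℝ (ℝ × ℝ))

lemma ee_fderiv (k : ℤ × ℤ) (p : ℝ × ℝ × ℝ) : HasFDerivAt (fun p : ℝ × ℝ × ℝ => ee k p.1 p.2.1)
    (L1.smulRight (Complex.I * k.1 * ee k p.1 p.2.1) + L2.smulRight (Complex.I * k.2 * ee k p.1 p.2.1)) p := by
  have h : HasFDerivAt (fun p : ℝ × ℝ × ℝ => ((k.1 : ℂ) * (p.1 : ℝ) + (k.2 : ℂ) * (p.2.1 : ℝ)) * Complex.I)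
      (L1.smulRight (Complex.I * k.1) + L2.smulRight (Complex.I * k.2)) p := by
    have := (L1.smulRight (Complex.I * k.1) + L2.smulRight (Complex.I * k.2)).hasFDerivAt (x := p)
    refine this.congr_of_eventuallyEq (Filter.Eventually.of_forall fun q => ?_)
    simp [L1, L2]; ring
  have h2 := h.cexp
  unfold ee
  refine h2.congr_fderiv ?_
  ext <;> simp [L1, L2] <;> ring

lemma norm_L1 : ‖L1‖ ≤ 1 := ContinuousLinearMap.norm_fst_le ..
lemma norm_L2 : ‖L2‖ ≤ 1 := by
  refine (ContinuousLinearMap.opNorm_comp_le _ _).trans ?_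
  exact mul_le_one₀ (ContinuousLinearMap.norm_fst_le ..) (norm_nonneg _) (ContinuousLinearMap.norm_snd_le ..)
lemma norm_L3 : ‖L3‖ ≤ 1 := by
  refine (ContinuousLinearMap.opNorm_comp_le _ _).trans ?_
  exact mul_le_one₀ (ContinuousLinearMap.norm_snd_le ..) (norm_nonneg _) (ContinuousLinearMap.norm_snd_le ..)

lemma norm_smulRight_le {L : ℝ × ℝ × ℝ →L[ℝ] ℝ} (hL : ‖L‖ ≤ 1) (z : ℂ) : ‖L.smulRight z‖ ≤ ‖z‖ := by
  rw [ContinuousLinearMap.norm_smulRight_apply]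
  exact mul_le_of_le_one_left (norm_nonneg _) hL

/-- space-time slab -/
def slab (J : Set ℝ) : Set (ℝ × ℝ × ℝ) := univ ×ˢ (univ ×ˢ J)

lemma Ph_fderiv {J : Set ℝ} (hJ : IsOpen J) (hJ' : IsPreconnected J) {c c' : ℤ × ℤ → ℝ → ℂ}
    (hc : URD J c) (hc' : URD J c') (hd : ∀ k, ∀ s ∈ J, HasDerivAt (c k) (c' k s) s)
    (p : ℝ × ℝ × ℝ) (hp : p ∈ slab J) :
    HasFDerivAt (Ph c) (L1.smulRight (Ph (fun k s => Complex.I * k.1 * c k s) p)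
      + L2.smulRight (Ph (fun k s => Complex.I * k.2 * c k s) p) + L3.smulRight (Ph c' p)) p := by
  have hcx := hc.mult norm_I_fst
  have hcy := hc.mult norm_I_snd
  have hs : p.2.2 ∈ J := hp.2.2
  obtain ⟨u, hu, hu'⟩ := hcx.bound 0
  obtain ⟨v, hv, hv'⟩ := hcy.bound 0
  obtain ⟨w, hw, hw'⟩ := hc'.bound 0
  have s1 := Fs_summable (hcx.rds hs).summable0 p.1 p.2.1
  have s2 := Fs_summable (hcy.rds hs).summable0 p.1 p.2.1
  have s3 := Fs_summable (hc'.rds hs).summable0 p.1 p.2.1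
  have e : L1.smulRight (Ph (fun k s => Complex.I * k.1 * c k s) p)
      + L2.smulRight (Ph (fun k s => Complex.I * k.2 * c k s) p) + L3.smulRight (Ph c' p)
      = ∑' k, (L1.smulRight (Complex.I * k.1 * c k p.2.2 * ee k p.1 p.2.1)
        + L2.smulRight (Complex.I * k.2 * c k p.2.2 * ee k p.1 p.2.1)
        + L3.smulRight (c' k p.2.2 * ee k p.1 p.2.1)) := by
    have t : ∀ (L : ℝ × ℝ × ℝ →L[ℝ] ℝ) (f : ℤ × ℤ → ℂ), Summable f →
        HasSum (fun k => L.smulRight (f k)) (L.smulRight (∑' k, f k)) := fun L f hf =>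
      (ContinuousLinearMap.smulRightL ℝ (ℝ × ℝ × ℝ) ℂ L).hasSum hf.hasSum
    exact (((t L1 _ s1).add (t L2 _ s2)).add (t L3 _ s3)).tsum_eq.symm
  rw [e]
  refine hasFDerivAt_tsum_of_isPreconnected (𝕜 := ℝ)
    (f := fun k (p : ℝ × ℝ × ℝ) => c k p.2.2 * ee k p.1 p.2.1)
    (f' := fun k p => L1.smulRight (Complex.I * k.1 * c k p.2.2 * ee k p.1 p.2.1)
        + L2.smulRight (Complex.I * k.2 * c k p.2.2 * ee k p.1 p.2.1)
        + L3.smulRight (c' k p.2.2 * ee k p.1 p.2.1)) (u := fun k => u k + v k + w k)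
    ((hu.add hv).add hw) (s := slab J) (isOpen_univ.prod (isOpen_univ.prod hJ))
    (isPreconnected_univ.prod (isPreconnected_univ.prod hJ')) (fun k q hq => ?_) (fun k q hq => ?_) hp
    (Fs_summable (hc.rds hs).summable0 p.1 p.2.1) hp
  · have h3 : HasFDerivAt (fun q : ℝ × ℝ × ℝ => c k q.2.2) (L3.smulRight (c' k q.2.2)) q := by
      have := (hd k q.2.2 hq.2.2).hasFDerivAt.comp q (L3.hasFDerivAt (x := q))
      refine this.congr_fderiv ?_
      ext <;> simp [L3]
    refine (h3.mul (ee_fderiv k q)).congr_fderiv ?_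
    ext <;> simp [L1, L2, L3] <;> ring
  · have hqs : q.2.2 ∈ J := hq.2.2
    have b1 := hu' k _ hqs
    have b2 := hv' k _ hqs
    have b3 := hw' k _ hqs
    refine (norm_add_le _ _).trans (add_le_add ((norm_add_le _ _).trans (add_le_add ?_ ?_)) ?_)
    · refine (norm_smulRight_le norm_L1 _).trans ?_
      rw [norm_mul, norm_ee]; simpa using b1
    · refine (norm_smulRight_le norm_L2 _).trans ?_
      rw [norm_mul, norm_ee]; simpa using b2
    · refine (norm_smulRight_le norm_L3 _).trans ?_
      rw [norm_mul, norm_ee]; simpa using b3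

lemma isOpen_slab {J : Set ℝ} (hJ : IsOpen J) : IsOpen (slab J) :=
  isOpen_univ.prod (isOpen_univ.prod hJ)

lemma Ph_contDiffOn {J : Set ℝ} (hJ : IsOpen J) (hJ' : IsPreconnected J) {n : ℕ} {c : ℤ × ℤ → ℝ → ℂ}
    (hc : SM J n c) : ContDiffOn ℝ n (Ph c) (slab J) := by
  induction n generalizing c with
  | zero =>
    rw [Nat.cast_zero, contDiffOn_zero]
    obtain ⟨u, hu, hu'⟩ := hc.1.bound 0
    refine continuousOn_tsum (u := u) (fun k => ?_) hu (fun k p hp => ?_)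
    · refine ContinuousOn.mul ?_ (Continuous.continuousOn ?_)
      · exact (hc.2 k).comp (by fun_prop) (fun p hp => hp.2.2)
      · unfold ee; fun_prop
    · rw [norm_mul, norm_ee]; simpa using hu' k _ hp.2.2
  | succ n ih =>
    have hc0 := hc.pred
    obtain ⟨h1, c', hd, h2⟩ := hc
    rw [Nat.cast_succ]
    have hF := Ph_fderiv hJ hJ' h1 h2.urd hd
    refine (contDiffOn_succ_iff_hasFDerivWithinAt (by simp)).2 fun p hp => ?_
    refine ⟨slab J, ?_, ?_, _, fun q hq => (hF q hq).hasFDerivWithinAt, ?_⟩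
    · rw [insert_eq_of_mem hp]; exact self_mem_nhdsWithin
    · simp
    · have t : ∀ (L : ℝ × ℝ × ℝ →L[ℝ] ℝ) (f : ℝ × ℝ × ℝ → ℂ), ContDiffOn ℝ n f (slab J) →
          ContDiffOn ℝ n (fun p => L.smulRight (f p)) (slab J) := fun L f hf =>
        (ContinuousLinearMap.smulRightL ℝ (ℝ × ℝ × ℝ) ℂ L).contDiff.comp_contDiffOn hf
      exact ((t L1 _ (ih (hc0.mult norm_I_fst))).add (t L2 _ (ih (hc0.mult norm_I_snd)))).add
        (t L3 _ (ih h2))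

lemma Ph_smooth {J : Set ℝ} (hJ : IsOpen J) (hJ' : IsPreconnected J) {c : ℤ × ℤ → ℝ → ℂ}
    (hc : ∀ n, SM J n c) : ContDiffOn ℝ (⊤ : ℕ∞) (Ph c) (slab J) :=
  contDiffOn_infty.2 fun n => Ph_contDiffOn hJ hJ' (hc n)

lemma Ph_time {J : Set ℝ} (hJ : IsOpen J) (hJ' : IsPreconnected J) {c c' : ℤ × ℤ → ℝ → ℂ}
    (hc : URD J c) (hc' : URD J c') (hd : ∀ k, ∀ s ∈ J, HasDerivAt (c k) (c' k s) s)
    (x y s : ℝ) (hs : s ∈ J) :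
    HasDerivAt (fun s => Fs (fun k => c k s) x y) (Fs (fun k => c' k s) x y) s := by
  have h := Ph_fderiv hJ hJ' hc hc' hd (x, y, s) ⟨mem_univ _, mem_univ _, hs⟩
  have h2 : HasDerivAt (fun s : ℝ => ((x, y, s) : ℝ × ℝ × ℝ)) ((0, 0, 1) : ℝ × ℝ × ℝ) s :=
    (hasDerivAt_const s x).prodMk ((hasDerivAt_const s y).prodMk (hasDerivAt_id s))
  have := h.comp_hasDerivAt s h2
  refine this.congr_deriv ?_
  simp [L1, L2, L3, Ph]

/-! ### Energy estimate for the truncated system -/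

lemma rpow_diff_le {r a b M : ℝ} (hr : 1 ≤ r) (ha : 1 ≤ a) (hb : 1 ≤ b) (haM : a ≤ M) (hbM : b ≤ M) :
    |a ^ r - b ^ r| ≤ r * M ^ (r - 1) * |a - b| := by
  have := (convex_Icc (1:ℝ) M).norm_image_sub_le_of_norm_hasDerivWithin_le (f := fun x => x ^ r)
    (f' := fun x => r * x ^ (r - 1)) (C := r * M ^ (r - 1)) (x := b) (y := a)
    (fun x hx => (Real.hasDerivAt_rpow_const (Or.inl (by linarith [hx.1]))).hasDerivWithinAt)
    (fun x hx => by
      have hx0 : 0 < x := by linarith [hx.1]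
      rw [Real.norm_eq_abs, abs_of_nonneg (by positivity)]
      have := Real.rpow_le_rpow hx0.le hx.2 (by linarith : 0 ≤ r - 1)
      gcongr) ⟨hb, hbM⟩ ⟨ha, haM⟩
  simpa [Real.norm_eq_abs] using this

lemma add_rpow_le {r a b : ℝ} (hr : 0 ≤ r) (ha : 0 ≤ a) (hb : 0 ≤ b) :
    (a + b) ^ r ≤ 2 ^ r * (a ^ r + b ^ r) := by
  rcases le_total a b with h | h
  · calc (a + b) ^ r ≤ (2 * b) ^ r := Real.rpow_le_rpow (by positivity) (by linarith) hr
      _ = 2 ^ r * b ^ r := Real.mul_rpow (by norm_num) hb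
      _ ≤ _ := by have := Real.rpow_nonneg ha r; gcongr; linarith
  · calc (a + b) ^ r ≤ (2 * a) ^ r := Real.rpow_le_rpow (by positivity) (by linarith) hr
      _ = 2 ^ r * a ^ r := Real.mul_rpow (by norm_num) ha
      _ ≤ _ := by have := Real.rpow_nonneg hb r; gcongr; linarith

/-- the commutator constant -/
noncomputable def cR (r : ℝ) : ℝ := 2 * r * 2 ^ r

lemma commut_est {r : ℝ} (hr : 1 ≤ r) (k j : ℤ × ℤ) :
    |bt (k - j) j| * |wt k ^ r - wt j ^ r| ≤ cR r * (wt j ^ r + wt (k - j) ^ r) := by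
  set m := k - j with hm
  have hk : k = j + m := by rw [hm]; abel
  have hwj := one_le_wt j
  have hwm := one_le_wt m
  have h1 : wt k ≤ wt j + wt m := by rw [hk]; exact wt_add_le j m
  have h2 : |wt k - wt j| ≤ nn m := by
    have h3 : nn k ≤ nn j + nn m := by rw [hk]; exact nn_add_le j m
    have h4 : nn j ≤ nn k + nn m := by
      have := nn_add_le k (-m); rw [nn_neg] at this
      have e : k + -m = j := by rw [hk]; abel
      rwa [e] at this
    rw [abs_le]; unfold wt; constructor <;> linarith
  have h3 := rpow_diff_le hr (one_le_wt k) hwj h1 (by linarith : wt j ≤ wt j + wt m)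
  set M := wt j + wt m
  have hM : 0 < M := by positivity
  have hM1 : 0 ≤ M ^ (r - 1) := Real.rpow_nonneg hM.le _
  have hMr : M ^ (r - 1) * M = M ^ r := by
    rw [← Real.rpow_add_one hM.ne']; congr 1; ring
  calc |bt m j| * |wt k ^ r - wt j ^ r| ≤ |bt m j| * (r * M ^ (r - 1) * nn m) := by
        exact mul_le_mul_of_nonneg_left (h3.trans (mul_le_mul_of_nonneg_left h2 (by positivity))) (abs_nonneg _)
    _ = r * M ^ (r - 1) * (|bt m j| * nn m) := by ring
    _ ≤ r * M ^ (r - 1) * (2 * M) := by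
        have hj : nn j ≤ M := (nn_le_wt j).trans (by linarith)
        exact mul_le_mul_of_nonneg_left ((abs_bt_mul m j).trans (by linarith)) (by positivity)
    _ = 2 * r * M ^ r := by rw [← hMr]; ring
    _ ≤ 2 * r * (2 ^ r * (wt j ^ r + wt m ^ r)) := by
        gcongr; exact add_rpow_le (by linarith) (by linarith) (by linarith)
    _ = _ := by unfold cR; ring

lemma sum_inj_le {H : ℤ × ℤ → ℝ} (hH : Summable H) (h0 : ∀ k, 0 ≤ H k) (S : Finset (ℤ × ℤ))
    {e : ℤ × ℤ → ℤ × ℤ} (he : Function.Injective e) : ∑ j ∈ S, H (e j) ≤ ∑' k, H k :=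
  ((hH.comp_injective he).sum_le_tsum S (fun _ _ => h0 _)).trans
    (tsum_comp_le_tsum_of_inj hH h0 he)

/-- Young type inequality -/
lemma young {H : ℤ × ℤ → ℝ} (hH : Summable H) (h0 : ∀ k, 0 ≤ H k) (S : Finset (ℤ × ℤ))
    (g : ℤ × ℤ → ℝ) :
    ∑ k ∈ S, ∑ j ∈ S, g k * g j * H (k - j) ≤ (∑' k, H k) * ∑ k ∈ S, g k ^ 2 := by
  have h1 : ∀ k ∈ S, ∀ j ∈ S, g k * g j * H (k - j) ≤
      (g k ^ 2 * H (k - j) + g j ^ 2 * H (k - j)) / 2 := fun k _ j _ => by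
    nlinarith [mul_nonneg (sq_nonneg (g k - g j)) (h0 (k - j))]
  have h2 : ∑ k ∈ S, ∑ j ∈ S, g k ^ 2 * H (k - j) ≤ (∑' k, H k) * ∑ k ∈ S, g k ^ 2 := by
    rw [Finset.mul_sum]
    refine Finset.sum_le_sum fun k _ => ?_
    rw [← Finset.mul_sum, mul_comm]
    exact mul_le_mul_of_nonneg_right (sum_inj_le hH h0 S (sub_right_injective)) (sq_nonneg _)
  have h3 : ∑ k ∈ S, ∑ j ∈ S, g j ^ 2 * H (k - j) ≤ (∑' k, H k) * ∑ k ∈ S, g k ^ 2 := by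
    rw [Finset.sum_comm, Finset.mul_sum]
    refine Finset.sum_le_sum fun k _ => ?_
    rw [← Finset.mul_sum, mul_comm]
    exact mul_le_mul_of_nonneg_right (sum_inj_le hH h0 S (sub_left_injective)) (sq_nonneg _)
  calc _ ≤ ∑ k ∈ S, ∑ j ∈ S, (g k ^ 2 * H (k - j) + g j ^ 2 * H (k - j)) / 2 :=
        Finset.sum_le_sum fun k hk => Finset.sum_le_sum fun j hj => h1 k hk j hj
    _ = (∑ k ∈ S, ∑ j ∈ S, g k ^ 2 * H (k - j) + ∑ k ∈ S, ∑ j ∈ S, g j ^ 2 * H (k - j)) / 2 := by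
        simp_rw [← Finset.sum_div, Finset.sum_add_distrib]
    _ ≤ _ := by linarith

lemma summable_supp {S : Finset (ℤ × ℤ)} {g : ℤ × ℤ → ℝ} (hg : ∀ k ∉ S, g k = 0) : Summable g :=
  summable_of_ne_finset_zero (s := S) hg

lemma young2 (S : Finset (ℤ × ℤ)) (g f : ℤ × ℤ → ℝ) (hg : ∀ k ∉ S, g k = 0) (hf : ∀ k, 0 ≤ f k) :
    ∑ k ∈ S, ∑ j ∈ S, g k * f j * g (k - j) ≤ (∑ k ∈ S, f k) * ∑ k ∈ S, g k ^ 2 := by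
  have hg2 : ∀ k ∉ S, g k ^ 2 = 0 := fun k hk => by simp [hg k hk]
  rw [Finset.sum_comm, Finset.sum_mul]
  refine Finset.sum_le_sum fun j _ => ?_
  have h1 : ∑ k ∈ S, g (k - j) ^ 2 ≤ ∑ k ∈ S, g k ^ 2 := by
    rw [← tsum_eq_sum (L := .unconditional _) hg2]
    exact sum_inj_le (summable_supp hg2) (fun _ => sq_nonneg _) S sub_left_injective
  calc ∑ k ∈ S, g k * f j * g (k - j) ≤ ∑ k ∈ S, f j * ((g k ^ 2 + g (k - j) ^ 2) / 2) :=
        Finset.sum_le_sum fun k _ => by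
          have := mul_nonneg (hf j) (sq_nonneg (g k - g (k - j))); nlinarith
    _ = f j * ((∑ k ∈ S, g k ^ 2 + ∑ k ∈ S, g (k - j) ^ 2) / 2) := by
        rw [← Finset.mul_sum, ← Finset.sum_div, Finset.sum_add_distrib]
    _ ≤ _ := by have := hf j; gcongr; linarith

/-- the truncated nonlinearity -/
noncomputable def GF (S : Finset (ℤ × ℤ)) (θ φ : ℤ × ℤ → ℂ) (k : ℤ × ℤ) : ℂ :=
  ∑ j ∈ S, (bt (k - j) j : ℂ) * ((θ (k - j) + φ (k - j)) * φ j)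
  + ∑ m ∈ S, (bt m (k - m) : ℂ) * (φ m * θ (k - m))

/-- weighted energy -/
noncomputable def En (S : Finset (ℤ × ℤ)) (r : ℝ) (φ : ℤ × ℤ → ℂ) : ℝ :=
  ∑ k ∈ S, (wt k ^ r * ‖φ k‖) ^ 2

lemma En_nonneg (S : Finset (ℤ × ℤ)) (r : ℝ) (φ : ℤ × ℤ → ℂ) : 0 ≤ En S r φ :=
  Finset.sum_nonneg fun _ _ => sq_nonneg _

lemma skew_re (S : Finset (ℤ × ℤ)) (h g : ℤ × ℤ → ℂ) (hh : ∀ k, (starRingEnd ℂ) (h k) = h (-k)) :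
    (∑ k ∈ S, ∑ j ∈ S, (starRingEnd ℂ) (g k) * ((bt (k - j) j : ℂ) * h (k - j)) * g j).re = 0 := by
  set X := ∑ k ∈ S, ∑ j ∈ S, (starRingEnd ℂ) (g k) * ((bt (k - j) j : ℂ) * h (k - j)) * g j with hX
  have : (starRingEnd ℂ) X = - X := by
    rw [hX, map_sum]
    simp_rw [map_sum]
    rw [Finset.sum_comm, ← Finset.sum_neg_distrib]
    refine Finset.sum_congr rfl fun k _ => ?_
    rw [← Finset.sum_neg_distrib]
    refine Finset.sum_congr rfl fun j _ => ?_
    simp only [map_mul, Complex.conj_conj, Complex.conj_ofReal]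
    rw [hh, bt_skew k j]
    simp only [neg_sub]
    push_cast; ring
  have h2 := congrArg Complex.re this
  simp at h2; linarith

lemma one_le_wtr {r : ℝ} (hr : 1 ≤ r) (k : ℤ × ℤ) : 1 ≤ wt k ^ r :=
  Real.one_le_rpow (one_le_wt k) (by linarith)

lemma energy_est {r : ℝ} (hr : 1 ≤ r) {θ : ℤ × ℤ → ℂ}
    (hθ1 : Summable (fun k => ‖θ k‖ * wt k ^ (r + 1)))
    (hθr : ∀ k, (starRingEnd ℂ) (θ k) = θ (-k)) (S : Finset (ℤ × ℤ)) {φ : ℤ × ℤ → ℂ}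
    (hφ : ∀ k ∉ S, φ k = 0) (hφr : ∀ k, (starRingEnd ℂ) (φ k) = φ (-k)) :
    |(∑ k ∈ S, (((wt k ^ r) ^ 2 : ℝ) : ℂ) * ((starRingEnd ℂ) (φ k) * GF S θ φ k)).re| ≤
      ((2 * cR r + 2) * (∑' k, ‖θ k‖ * wt k ^ (r + 1)) + 2 * cR r * ∑ k ∈ S, ‖φ k‖) * En S r φ := by
  set l : ℤ × ℤ → ℝ := fun k => wt k ^ r with hl
  have hl1 : ∀ k, 1 ≤ l k := one_le_wtr hr
  have hl0 : ∀ k, 0 ≤ l k := fun k => by linarith [hl1 k]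
  set Θ : ℤ × ℤ → ℝ := fun k => ‖θ k‖ * wt k ^ (r + 1) with hΘ
  have hlw : ∀ k, wt k ^ (r + 1) = l k * wt k := fun k => Real.rpow_add_one (wt_pos k).ne' r
  have hΘ0 : ∀ k, 0 ≤ Θ k := fun k => by
    have := wt_pos k; simp only [hΘ]; positivity
  have hΘ1 : ∀ k, ‖θ k‖ ≤ Θ k := fun k => by
    simp only [hΘ, hlw]
    have := hl1 k
    have := one_le_wt k
    exact le_mul_of_one_le_right (norm_nonneg _) (by nlinarith)
  have hΘ2 : ∀ k, l k * ‖θ k‖ ≤ Θ k := fun k => by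
    simp only [hΘ, hlw]
    have h := one_le_wt k
    have := mul_nonneg (hl0 k) (norm_nonneg (θ k))
    nlinarith
  have hΘ3 : ∀ k, l k * wt k * ‖θ k‖ ≤ Θ k := fun k => by
    simp only [hΘ, hlw]; linarith
  set g : ℤ × ℤ → ℝ := fun k => l k * ‖φ k‖ with hg
  have hg0 : ∀ k, 0 ≤ g k := fun k => mul_nonneg (hl0 k) (norm_nonneg _)
  have hgS : ∀ k ∉ S, g k = 0 := fun k hk => by simp [hg, hφ k hk]
  have hfg : ∀ k, ‖φ k‖ ≤ g k := fun k => le_mul_of_one_le_left (norm_nonneg _) (hl1 k)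
  have hE : En S r φ = ∑ k ∈ S, g k ^ 2 := rfl
  have hc : 0 ≤ cR r := by unfold cR; positivity
  -- decomposition
  have hdec : ∑ k ∈ S, (((wt k ^ r) ^ 2 : ℝ) : ℂ) * ((starRingEnd ℂ) (φ k) * GF S θ φ k)
      = (∑ k ∈ S, ∑ j ∈ S, (starRingEnd ℂ) ((l k : ℂ) * φ k) *
          ((bt (k - j) j : ℂ) * (θ (k - j) + φ (k - j))) * ((l j : ℂ) * φ j))
        + ((∑ k ∈ S, ∑ j ∈ S, ((l k * (l k - l j)) * bt (k - j) j : ℝ) *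
          ((starRingEnd ℂ) (φ k) * (θ (k - j) + φ (k - j)) * φ j))
        + ∑ k ∈ S, ∑ m ∈ S, ((l k * l k) * bt m (k - m) : ℝ) *
          ((starRingEnd ℂ) (φ k) * φ m * θ (k - m))) := by
    simp_rw [← Finset.sum_add_distrib]
    refine Finset.sum_congr rfl fun k _ => ?_
    unfold GF
    rw [← Finset.sum_add_distrib, Finset.mul_sum, Finset.mul_sum]
    refine Finset.sum_congr rfl fun j _ => ?_
    simp only [map_mul, Complex.conj_ofReal]
    push_cast [hl]
    ring
  rw [hdec, Complex.add_re, skew_re S (fun k => θ k + φ k) (fun k => (l k : ℂ) * φ k)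
    (fun k => by rw [map_add, hθr, hφr]), zero_add]
  refine (Complex.abs_re_le_norm _).trans ((norm_add_le _ _).trans ?_)
  -- commutator part
  have hA : ‖∑ k ∈ S, ∑ j ∈ S, ((l k * (l k - l j) * bt (k - j) j : ℝ) : ℂ) *
          ((starRingEnd ℂ) (φ k) * (θ (k - j) + φ (k - j)) * φ j)‖ ≤
      2 * cR r * (∑' k, Θ k) * (∑ k ∈ S, g k ^ 2) + 2 * cR r * (∑ k ∈ S, ‖φ k‖) * ∑ k ∈ S, g k ^ 2 := by
    have hb : ∀ k ∈ S, ∀ j ∈ S, ‖((l k * (l k - l j) * bt (k - j) j : ℝ) : ℂ) *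
          ((starRingEnd ℂ) (φ k) * (θ (k - j) + φ (k - j)) * φ j)‖ ≤
        cR r * (2 * (g k * g j * Θ (k - j)) + g k * g j * ‖φ (k - j)‖ + g k * ‖φ j‖ * g (k - j)) := by
      intro k _ j _
      rw [norm_mul, norm_mul, norm_mul, Complex.norm_real, RCLike.norm_conj, Real.norm_eq_abs,
        abs_mul, abs_mul, abs_of_nonneg (hl0 k)]
      have h1 := commut_est hr k j
      have h2 := norm_add_le (θ (k - j)) (φ (k - j))
      have e1 : l k * |l k - l j| * |bt (k - j) j| * (‖φ k‖ * ‖θ (k - j) + φ (k - j)‖ * ‖φ j‖)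
        = g k * (|bt (k - j) j| * |l k - l j|) * ‖θ (k - j) + φ (k - j)‖ * ‖φ j‖ := by
        simp only [hg]; ring
      rw [e1]
      calc _ ≤ g k * (cR r * (l j + l (k - j))) * (‖θ (k - j)‖ + ‖φ (k - j)‖) * ‖φ j‖ := by
            have := hg0 k
            have := add_nonneg (hl0 j) (hl0 (k - j))
            have h0 : 0 ≤ g k * (cR r * (l j + l (k - j))) := by positivity
            gcongr
        _ = cR r * (g k * g j * ‖θ (k - j)‖ + g k * ‖φ j‖ * (l (k - j) * ‖θ (k - j)‖)
              + g k * g j * ‖φ (k - j)‖ + g k * ‖φ j‖ * g (k - j)) := by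
            simp only [hg]; ring
        _ ≤ cR r * (g k * g j * Θ (k - j) + g k * g j * Θ (k - j)
              + g k * g j * ‖φ (k - j)‖ + g k * ‖φ j‖ * g (k - j)) := by
            have := hg0 k
            have := hg0 j
            have := hΘ1 (k - j)
            have := hΘ2 (k - j)
            have := hfg j
            have := hΘ0 (k - j)
            have := mul_nonneg (hl0 (k - j)) (norm_nonneg (θ (k - j)))
            gcongr
        _ = _ := by ring
    have hφn : ∀ k ∉ S, ‖φ k‖ = 0 := fun k hk => by simp [hφ k hk]
    have y1 := young hθ1 hΘ0 S g
    have y2 := young (summable_supp hφn) (fun _ => norm_nonneg _) S g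
    rw [tsum_eq_sum hφn] at y2
    have y3 := young2 S g (fun k => ‖φ k‖) hgS (fun _ => norm_nonneg _)
    calc _ ≤ ∑ k ∈ S, ∑ j ∈ S, cR r * (2 * (g k * g j * Θ (k - j)) + g k * g j * ‖φ (k - j)‖ + g k * ‖φ j‖ * g (k - j)) :=
          (norm_sum_le _ _).trans (Finset.sum_le_sum fun k hk => (norm_sum_le _ _).trans
            (Finset.sum_le_sum fun j hj => hb k hk j hj))
      _ = cR r * (2 * (∑ k ∈ S, ∑ j ∈ S, g k * g j * Θ (k - j)) + (∑ k ∈ S, ∑ j ∈ S, g k * g j * ‖φ (k - j)‖)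
          + ∑ k ∈ S, ∑ j ∈ S, g k * ‖φ j‖ * g (k - j)) := by
          simp_rw [← Finset.mul_sum, Finset.sum_add_distrib, ← Finset.mul_sum]
      _ ≤ cR r * (2 * ((∑' k, Θ k) * ∑ k ∈ S, g k ^ 2) + (∑ k ∈ S, ‖φ k‖) * (∑ k ∈ S, g k ^ 2)
          + (∑ k ∈ S, ‖φ k‖) * ∑ k ∈ S, g k ^ 2) := by gcongr
      _ = _ := by ring
  have hB : ‖∑ k ∈ S, ∑ m ∈ S, ((l k * l k * bt m (k - m) : ℝ) : ℂ) *
          ((starRingEnd ℂ) (φ k) * φ m * θ (k - m))‖ ≤ 2 * (∑' k, Θ k) * ∑ k ∈ S, g k ^ 2 := by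
    have hb : ∀ k ∈ S, ∀ m ∈ S, ‖((l k * l k * bt m (k - m) : ℝ) : ℂ) *
          ((starRingEnd ℂ) (φ k) * φ m * θ (k - m))‖ ≤ 2 * (g k * g m * Θ (k - m)) := by
      intro k _ m _
      rw [norm_mul, norm_mul, norm_mul, Complex.norm_real, RCLike.norm_conj, Real.norm_eq_abs,
        abs_mul, abs_mul, abs_of_nonneg (hl0 k)]
      have h1 := (abs_bt_le m (k - m)).trans (mul_le_mul_of_nonneg_left (nn_le_wt (k - m)) two_pos.le)
      have h2 : l k ≤ l m * l (k - m) := by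
        simp only [hl]
        rw [← Real.mul_rpow (wt_pos _).le (wt_pos _).le]
        exact Real.rpow_le_rpow (wt_pos k).le (wt_le_mul_sub k m) (by linarith)
      calc l k * l k * |bt m (k - m)| * (‖φ k‖ * ‖φ m‖ * ‖θ (k - m)‖)
          ≤ l k * (l m * l (k - m)) * (2 * wt (k - m)) * (‖φ k‖ * ‖φ m‖ * ‖θ (k - m)‖) := by
            have := hl0 k
            have := mul_nonneg (hl0 m) (hl0 (k - m))
            gcongr
        _ = 2 * (g k * g m * (l (k - m) * wt (k - m) * ‖θ (k - m)‖)) := by simp only [hg]; ring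
        _ ≤ _ := by
            have := mul_nonneg (hg0 k) (hg0 m)
            have := hΘ3 (k - m)
            gcongr
    have y1 := young hθ1 hΘ0 S g
    calc _ ≤ ∑ k ∈ S, ∑ j ∈ S, 2 * (g k * g j * Θ (k - j)) :=
          (norm_sum_le _ _).trans (Finset.sum_le_sum fun k hk => (norm_sum_le _ _).trans
            (Finset.sum_le_sum fun j hj => hb k hk j hj))
      _ = 2 * (∑ k ∈ S, ∑ j ∈ S, g k * g j * Θ (k - j)) := by simp_rw [← Finset.mul_sum]
      _ ≤ _ := by linarith
  rw [hE]
  calc _ ≤ _ := add_le_add hA hB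
    _ = _ := by ring

lemma GF_eq_BB {θ φ : ℤ × ℤ → ℂ} (hθ : RDs θ) (S : Finset (ℤ × ℤ)) (hφ : ∀ k ∉ S, φ k = 0)
    (h0 : ∀ k, BB θ θ k = 0) (k : ℤ × ℤ) :
    GF S θ φ k = BB (fun k => θ k + φ k) (fun k => θ k + φ k) k := by
  have hφ' : RDs φ := RDs_of_support S hφ
  have e1 : BB (fun k => θ k + φ k) (fun k => θ k + φ k) k
      = BB θ θ k + (BB (fun k => θ k + φ k) φ k + BB φ θ k) := by
    unfold BB
    rw [← (BB_summable (hθ.add hφ') hφ' k).tsum_add (BB_summable hφ' hθ k),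
      ← (BB_summable hθ hθ k).tsum_add ((BB_summable (hθ.add hφ') hφ' k).add (BB_summable hφ' hθ k))]
    congr 1; ext m; ring
  rw [e1, h0, zero_add]
  unfold GF BB
  congr 1
  · rw [← (Equiv.subLeft k).tsum_eq, tsum_eq_sum (s := S)]
    · simp
    · intro j hj; simp [hφ j hj]
  · rw [tsum_eq_sum (s := S)]
    intro j hj; simp [hφ j hj]

/-! ### ODE tools -/

lemma ode_global {E : Type*} [NormedAddCommGroup E] [NormedSpace ℝ E] [CompleteSpace E]
    {v : E → E} (hv : ContDiff ℝ 1 v) (hc : HasCompactSupport v) (x₀ : E) {a b : ℝ} (ha : a < 0)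
    (hb : 0 < b) : ∃ α : ℝ → E, α 0 = x₀ ∧ ∀ s ∈ Ioo a b, HasDerivAt α (v (α s)) s := by
  obtain ⟨K, hK⟩ := hv.lipschitzWith_of_hasCompactSupport hc (by norm_num)
  obtain ⟨C, hC⟩ := hc.exists_bound_of_continuous hv.continuous
  have hC0 : 0 ≤ C := (norm_nonneg _).trans (hC x₀)
  lift C to NNReal using hC0
  have hm : 0 ≤ max (b - 0) (0 - a) := le_max_of_le_left (by linarith)
  have hpl : IsPicardLindelof (fun _ : ℝ => v) (tmin := a) (tmax := b) ⟨0, ha.le, hb.le⟩ x₀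
      (C * ⟨max (b - 0) (0 - a), hm⟩) 0 C K := by
    refine ⟨fun t _ => hK.lipschitzOnWith, fun x _ => continuousOn_const, fun t _ x _ => hC x, ?_⟩
    show (C:ℝ) * max (b - 0) (0 - a) ≤ (C:ℝ) * max (b - 0) (0 - a) - 0
    rw [sub_zero ((C:ℝ) * _)]
  obtain ⟨α, h0, h1⟩ := hpl.exists_eq_forall_mem_Icc_hasDerivWithinAt₀
  exact ⟨α, h0, fun s hs => (h1 s (Ioo_subset_Icc_self hs)).hasDerivAt (Icc_mem_nhds hs.1 hs.2)⟩

lemma ode_sym {E : Type*} [NormedAddCommGroup E] [NormedSpace ℝ E]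
    {v : E → E} (hv : ContDiff ℝ 1 v) (hc : HasCompactSupport v) {α : ℝ → E} {a b : ℝ} (ha : a < 0)
    (hb : 0 < b) (hα : ∀ s ∈ Ioo a b, HasDerivAt α (v (α s)) s) (R : E →L[ℝ] E)
    (hR : ∀ x, R (v x) = v (R x)) (h0 : R (α 0) = α 0) : ∀ s ∈ Ioo a b, R (α s) = α s := by
  obtain ⟨K, hK⟩ := hv.lipschitzWith_of_hasCompactSupport hc (by norm_num)
  exact ODE_solution_unique_of_mem_Ioo (v := fun _ => v) (s := fun _ => univ) (K := K)
    (fun t _ => hK.lipschitzOnWith) (t₀ := 0) ⟨ha, hb⟩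
    (fun s hs => ⟨by
      have := R.hasFDerivAt.comp_hasDerivAt s (hα s hs)
      rw [hR] at this; exact this, mem_univ _⟩)
    (fun s hs => ⟨hα s hs, mem_univ _⟩) h0

lemma gronwall2 {f f' : ℝ → ℝ} {a b K : ℝ} (ha : a < 0) (hb : 0 < b)
    (hf : ∀ s ∈ Ioo a b, HasDerivAt f (f' s) s) (hK : ∀ s ∈ Ioo a b, |f' s| ≤ K * f s)
    (s : ℝ) (hs : s ∈ Ioo a b) : f s ≤ Real.exp (K * |s|) * f 0 := by
  have hd : ∀ c : ℝ, ∀ t ∈ Ioo a b, HasDerivAt (fun s => f s * Real.exp (c * s))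
      ((f' t + c * f t) * Real.exp (c * t)) t := fun c t ht => by
    have h1 : HasDerivAt (fun s => Real.exp (c * s)) (Real.exp (c * t) * (c * 1)) t :=
      ((hasDerivAt_id t).const_mul c).exp
    exact ((hf t ht).mul h1).congr_deriv (by ring)
  have hcont : ∀ c : ℝ, ContinuousOn (fun s => f s * Real.exp (c * s)) (Ioo a b) := fun c t ht =>
    (hd c t ht).continuousAt.continuousWithinAt
  have h0 : (0 : ℝ) ∈ Ioo a b := ⟨ha, hb⟩
  rcases le_total 0 s with h | h
  · have hanti : AntitoneOn (fun s => f s * Real.exp (-K * s)) (Ioo a b) := by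
      refine antitoneOn_of_hasDerivWithinAt_nonpos (convex_Ioo a b) (hcont _)
        (f' := fun t => (f' t + -K * f t) * Real.exp (-K * t))
        (fun t ht => ?_) (fun t ht => ?_)
      · rw [interior_Ioo] at ht; exact (hd _ t ht).hasDerivWithinAt
      · rw [interior_Ioo] at ht
        have := hK t ht
        have := le_abs_self (f' t)
        exact mul_nonpos_of_nonpos_of_nonneg (by linarith) (Real.exp_pos _).le
    have := hanti h0 hs h
    simp only [mul_zero, Real.exp_zero, mul_one] at this
    rw [abs_of_nonneg h]
    have e : f s = (f s * Real.exp (-K * s)) * Real.exp (K * s) := by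
      rw [mul_assoc, ← Real.exp_add]; simp
    rw [e, mul_comm]
    exact mul_le_mul_of_nonneg_left this (Real.exp_pos _).le
  · have hmono : MonotoneOn (fun s => f s * Real.exp (K * s)) (Ioo a b) := by
      refine monotoneOn_of_hasDerivWithinAt_nonneg (convex_Ioo a b) (hcont _)
        (f' := fun t => (f' t + K * f t) * Real.exp (K * t))
        (fun t ht => ?_) (fun t ht => ?_)
      · rw [interior_Ioo] at ht; exact (hd _ t ht).hasDerivWithinAt
      · rw [interior_Ioo] at ht
        have := hK t ht
        have := neg_abs_le (f' t)
        exact mul_nonneg (by linarith) (Real.exp_pos _).le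
    have := hmono hs h0 h
    simp only [mul_zero, Real.exp_zero, mul_one] at this
    rw [abs_of_nonpos h]
    have e : f s = (f s * Real.exp (K * s)) * Real.exp (K * -s) := by
      rw [mul_assoc, ← Real.exp_add]; simp
    rw [e, mul_comm]
    exact mul_le_mul_of_nonneg_left this (Real.exp_pos _).le

/-! ### The Galerkin system -/

/-- extension by zero -/
noncomputable def ext0 (S : Finset (ℤ × ℤ)) (φ : S → ℂ) (k : ℤ × ℤ) : ℂ :=
  if h : k ∈ S then φ ⟨k, h⟩ else 0

lemma ext0_mem {S : Finset (ℤ × ℤ)} (φ : S → ℂ) (k : S) : ext0 S φ k = φ k := by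
  simp [ext0]
lemma ext0_not {S : Finset (ℤ × ℤ)} (φ : S → ℂ) {k : ℤ × ℤ} (h : k ∉ S) : ext0 S φ k = 0 := by
  simp [ext0, h]

lemma ext0_contDiff (S : Finset (ℤ × ℤ)) (k : ℤ × ℤ) : ContDiff ℝ 1 (fun φ : S → ℂ => ext0 S φ k) := by
  unfold ext0
  split_ifs with h
  · fun_prop
  · fun_prop

/-- cut-off -/
noncomputable def chi (z : ℝ) : ℝ := Real.smoothTransition (2 - 2 * z)

/-- truncated vector field -/
noncomputable def vG (S : Finset (ℤ × ℤ)) (θ : ℤ × ℤ → ℂ) (φ : S → ℂ) : S → ℂ := fun k =>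
  ((chi (En S (5/4) (ext0 S φ)) : ℝ) : ℂ) * GF S θ (ext0 S φ) k

lemma En_contDiff (S : Finset (ℤ × ℤ)) (r : ℝ) : ContDiff ℝ 1 (fun φ : S → ℂ => En S r (ext0 S φ)) := by
  unfold En
  refine ContDiff.sum fun k _ => ?_
  simp_rw [mul_pow]
  exact contDiff_const.mul ((ext0_contDiff S k).norm_sq ℝ)

lemma vG_contDiff (S : Finset (ℤ × ℤ)) (θ : ℤ × ℤ → ℂ) : ContDiff ℝ 1 (vG S θ) := by
  refine contDiff_pi.2 fun k => ?_
  unfold vG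
  have h1 : ContDiff ℝ 1 (fun φ : S → ℂ => chi (En S (5/4) (ext0 S φ))) := by
    unfold chi
    exact (Real.smoothTransition.contDiff (n := 1)).comp
      (contDiff_const.sub (contDiff_const.mul (En_contDiff S _)))
  refine (Complex.ofRealCLM.contDiff.comp h1).mul ?_
  unfold GF
  refine ContDiff.add (ContDiff.sum fun j _ => ?_) (ContDiff.sum fun j _ => ?_)
  · exact contDiff_const.mul ((contDiff_const.add (ext0_contDiff S _)).mul (ext0_contDiff S _))
  · exact contDiff_const.mul ((ext0_contDiff S _).mul contDiff_const)

lemma chi_zero {z : ℝ} (h : 1 ≤ z) : chi z = 0 := Real.smoothTransition.zero_of_nonpos (by linarith)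
lemma chi_one {z : ℝ} (h : z ≤ 1/2) : chi z = 1 := Real.smoothTransition.one_of_one_le (by linarith)

lemma norm_le_of_En {S : Finset (ℤ × ℤ)} {r : ℝ} (hr : 0 ≤ r) {φ : ℤ × ℤ → ℂ} {k : ℤ × ℤ} (hk : k ∈ S) :
    (wt k ^ r * ‖φ k‖) ^ 2 ≤ En S r φ :=
  Finset.single_le_sum (f := fun k => (wt k ^ r * ‖φ k‖) ^ 2) (fun _ _ => sq_nonneg _) hk

lemma vG_compact (S : Finset (ℤ × ℤ)) (θ : ℤ × ℤ → ℂ) : HasCompactSupport (vG S θ) := by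
  refine HasCompactSupport.intro (isCompact_closedBall (0 : S → ℂ) 1) fun φ hφ => ?_
  have : 1 ≤ En S (5/4) (ext0 S φ) := by
    by_contra h
    push Not at h
    refine hφ ?_
    rw [mem_closedBall_zero_iff, pi_norm_le_iff_of_nonneg zero_le_one]
    intro k
    have h1 := norm_le_of_En (S := S) (r := 5/4) (by norm_num) (φ := ext0 S φ) k.2
    rw [ext0_mem] at h1
    have h2 := one_le_wtr (by norm_num : (1:ℝ) ≤ 5/4) (k : ℤ × ℤ)
    have h3 := norm_nonneg (φ k)
    nlinarith [mul_le_mul_of_nonneg_right h2 h3]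
  ext k
  simp [vG, chi_zero this]

/-- symmetric index sets -/
def SymS (S : Finset (ℤ × ℤ)) : Prop := (∀ k ∈ S, -k ∈ S) ∧ ∀ k ∈ S, sx k ∈ S

lemma sx_sx (k : ℤ × ℤ) : sx (sx k) = k := by simp [sx_apply]
lemma sx_sub (k j : ℤ × ℤ) : sx (k - j) = sx k - sx j := by
  simp only [sx_apply]; ext <;> simp; abel
lemma sx_neg (k : ℤ × ℤ) : sx (-k) = - sx k := by
  simp only [sx_apply]; ext <;> simp
lemma nn_sx (k : ℤ × ℤ) : nn (sx k) = nn k := by simp [nn, sx_apply]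
lemma wt_sx (k : ℤ × ℤ) : wt (sx k) = wt k := by simp [wt, nn_sx]
lemma bt_sx (m j : ℤ × ℤ) : bt (sx m) (sx j) = - bt m j := by
  simp only [bt, sq2, sx_apply]; push_cast; rw [← neg_div]; congr 1 <;> ring
lemma bt_neg (m j : ℤ × ℤ) : bt (-m) (-j) = bt m j := by
  simp only [bt, sq2_neg]; simp

lemma sum_neg_S {S : Finset (ℤ × ℤ)} (hS : SymS S) {M : Type*} [AddCommMonoid M] (f : ℤ × ℤ → M) :
    ∑ k ∈ S, f (-k) = ∑ k ∈ S, f k :=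
  Finset.sum_nbij' (fun k => -k) (fun k => -k) hS.1 hS.1 (by simp) (by simp) (by simp)
lemma sum_sx_S {S : Finset (ℤ × ℤ)} (hS : SymS S) {M : Type*} [AddCommMonoid M] (f : ℤ × ℤ → M) :
    ∑ k ∈ S, f (sx k) = ∑ k ∈ S, f k :=
  Finset.sum_nbij' (fun k => sx k) (fun k => sx k) hS.2 hS.2 (by simp [sx_sx]) (by simp [sx_sx]) (by simp)

lemma GF_conj {S : Finset (ℤ × ℤ)} (hS : SymS S) {θ : ℤ × ℤ → ℂ}
    (hθ : ∀ k, (starRingEnd ℂ) (θ k) = θ (-k)) (φ : ℤ × ℤ → ℂ) (k : ℤ × ℤ) :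
    GF S θ (fun k => (starRingEnd ℂ) (φ (-k))) k = (starRingEnd ℂ) (GF S θ φ (-k)) := by
  unfold GF
  rw [← sum_neg_S hS (fun j => (bt (-k - j) j : ℂ) * ((θ (-k - j) + φ (-k - j)) * φ j)),
    ← sum_neg_S hS (fun m => (bt m (-k - m) : ℂ) * (φ m * θ (-k - m))), map_add, map_sum, map_sum]
  have e : ∀ j, -k - -j = -(k - j) := fun j => by abel
  congr 1
  · refine Finset.sum_congr rfl fun j _ => ?_
    simp only [map_mul, map_add, Complex.conj_ofReal, e, bt_neg, hθ, neg_neg]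
  · refine Finset.sum_congr rfl fun j _ => ?_
    simp only [map_mul, Complex.conj_ofReal, e, bt_neg, hθ, neg_neg]

lemma GF_odd {S : Finset (ℤ × ℤ)} (hS : SymS S) {θ : ℤ × ℤ → ℂ}
    (hθ : ∀ k, θ (sx k) = - θ k) (φ : ℤ × ℤ → ℂ) (k : ℤ × ℤ) :
    GF S θ (fun k => - φ (sx k)) k = - GF S θ φ (sx k) := by
  unfold GF
  rw [← sum_sx_S hS (fun j => (bt (sx k - j) j : ℂ) * ((θ (sx k - j) + φ (sx k - j)) * φ j)),
    ← sum_sx_S hS (fun m => (bt m (sx k - m) : ℂ) * (φ m * θ (sx k - m))), neg_add,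
    ← Finset.sum_neg_distrib, ← Finset.sum_neg_distrib]
  congr 1
  · refine Finset.sum_congr rfl fun j _ => ?_
    rw [← sx_sub, bt_sx, hθ]; push_cast; ring
  · refine Finset.sum_congr rfl fun j _ => ?_
    rw [← sx_sub, bt_sx, hθ]; push_cast; ring

lemma En_conj {S : Finset (ℤ × ℤ)} (hS : SymS S) (r : ℝ) (φ : ℤ × ℤ → ℂ) :
    En S r (fun k => (starRingEnd ℂ) (φ (-k))) = En S r φ := by
  unfold En
  rw [← sum_neg_S hS (fun k => (wt k ^ r * ‖φ k‖) ^ 2)]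
  simp [wt_neg]
lemma En_odd {S : Finset (ℤ × ℤ)} (hS : SymS S) (r : ℝ) (φ : ℤ × ℤ → ℂ) :
    En S r (fun k => - φ (sx k)) = En S r φ := by
  unfold En
  rw [← sum_sx_S hS (fun k => (wt k ^ r * ‖φ k‖) ^ 2)]
  simp [wt_sx]

/-- conjugation symmetry -/
noncomputable def R1 {S : Finset (ℤ × ℤ)} (hS : SymS S) : (S → ℂ) →L[ℝ] (S → ℂ) :=
  ContinuousLinearMap.pi fun k => (Complex.conjCLE : ℂ →L[ℝ] ℂ).comp
    (ContinuousLinearMap.proj ⟨-(k : ℤ × ℤ), hS.1 _ k.2⟩)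
/-- reflection symmetry -/
noncomputable def R2 {S : Finset (ℤ × ℤ)} (hS : SymS S) : (S → ℂ) →L[ℝ] (S → ℂ) :=
  ContinuousLinearMap.pi fun k => -(ContinuousLinearMap.proj ⟨sx (k : ℤ × ℤ), hS.2 _ k.2⟩)

lemma ext0_R1 {S : Finset (ℤ × ℤ)} (hS : SymS S) (φ : S → ℂ) :
    ext0 S (R1 hS φ) = fun k => (starRingEnd ℂ) (ext0 S φ (-k)) := by
  ext k
  by_cases hk : k ∈ S
  · have := hS.1 k hk
    simp [ext0, hk, this, R1]
  · have : -k ∉ S := fun h => hk (by simpa using hS.1 _ h)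
    simp [ext0, hk, this]
lemma ext0_R2 {S : Finset (ℤ × ℤ)} (hS : SymS S) (φ : S → ℂ) :
    ext0 S (R2 hS φ) = fun k => - (ext0 S φ (sx k)) := by
  ext k
  by_cases hk : k ∈ S
  · have := hS.2 k hk
    simp [ext0, hk, this, R2]
  · have : sx k ∉ S := fun h => hk (by simpa [sx_sx] using hS.2 _ h)
    simp [ext0, hk, this]

lemma vG_R1 {S : Finset (ℤ × ℤ)} (hS : SymS S) {θ : ℤ × ℤ → ℂ}
    (hθ : ∀ k, (starRingEnd ℂ) (θ k) = θ (-k)) (φ : S → ℂ) : R1 hS (vG S θ φ) = vG S θ (R1 hS φ) := by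
  ext k
  simp only [vG]
  rw [ext0_R1, En_conj hS, GF_conj hS hθ]
  simp [R1, vG]
lemma vG_R2 {S : Finset (ℤ × ℤ)} (hS : SymS S) {θ : ℤ × ℤ → ℂ}
    (hθ : ∀ k, θ (sx k) = - θ k) (φ : S → ℂ) : R2 hS (vG S θ φ) = vG S θ (R2 hS φ) := by
  ext k
  simp only [vG]
  rw [ext0_R2, En_odd hS, GF_odd hS hθ]
  simp [R2, vG]

/-- the constant in the embedding into the Wiener algebra -/
noncomputable def cS : ℝ := ∑' k : ℤ × ℤ, wt k ^ (-(5/2) : ℝ)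

lemma cS_nonneg : 0 ≤ cS := tsum_nonneg fun k => (Real.rpow_pos_of_pos (wt_pos k) _).le

lemma l1_le (S : Finset (ℤ × ℤ)) (φ : ℤ × ℤ → ℂ) :
    (∑ k ∈ S, ‖φ k‖) ^ 2 ≤ cS * En S (5/4) φ := by
  have h := Finset.sum_mul_sq_le_sq_mul_sq S (fun k => wt k ^ (-(5/4) : ℝ)) (fun k => wt k ^ (5/4 : ℝ) * ‖φ k‖)
  have e1 : ∀ k, wt k ^ (-(5/4) : ℝ) * (wt k ^ (5/4 : ℝ) * ‖φ k‖) = ‖φ k‖ := fun k => by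
    rw [← mul_assoc, ← Real.rpow_add (wt_pos k)]; norm_num
  have e2 : ∀ k, (wt k ^ (-(5/4) : ℝ)) ^ 2 = wt k ^ (-(5/2) : ℝ) := fun k => by
    rw [← Real.rpow_natCast, ← Real.rpow_mul (wt_pos k).le]; norm_num
  simp only [e1, e2] at h
  refine h.trans (mul_le_mul_of_nonneg_right ?_ (En_nonneg _ _ _))
  exact summable_wt_rpow.sum_le_tsum S (fun k _ => (Real.rpow_pos_of_pos (wt_pos k) _).le)

/-- growth constant -/
noncomputable def Kc (θ : ℤ × ℤ → ℂ) (r : ℝ) : ℝ :=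
  2 * ((2 * cR r + 2) * (∑' k, ‖θ k‖ * wt k ^ (r + 1)) + 2 * cR r * (1 + cS))

lemma RDs.summable_r {a : ℤ × ℤ → ℂ} (h : RDs a) (r : ℝ) : Summable (fun k => ‖a k‖ * wt k ^ r) := by
  obtain ⟨n, hn⟩ := exists_nat_ge r
  refine (h.summable n).of_nonneg_of_le (fun k => by have := wt_pos k; positivity) (fun k => ?_)
  rw [← Real.rpow_natCast]
  exact mul_le_mul_of_nonneg_left (Real.rpow_le_rpow_of_exponent_le (one_le_wt k) hn) (norm_nonneg _)

lemma Kc_nonneg {θ : ℤ × ℤ → ℂ} {r : ℝ} (hr : 1 ≤ r) : 0 ≤ Kc θ r := by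
  have h : 0 ≤ ∑' k, ‖θ k‖ * wt k ^ (r + 1) :=
    tsum_nonneg fun k => mul_nonneg (norm_nonneg _) (Real.rpow_pos_of_pos (wt_pos k) _).le
  have hc : 0 ≤ cR r := by unfold cR; positivity
  have := cS_nonneg
  unfold Kc; positivity

lemma galerkin {θ : ℤ × ℤ → ℂ} (hθ : RDs θ) (hθr : ∀ k, (starRingEnd ℂ) (θ k) = θ (-k))
    (hθo : ∀ k, θ (sx k) = - θ k) (hθ0 : ∀ k, BB θ θ k = 0) {S : Finset (ℤ × ℤ)} (hS : SymS S)
    {T : ℝ} (hT : 0 < T) {φ0 : ℤ × ℤ → ℂ} (h0S : ∀ k ∉ S, φ0 k = 0)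
    (h0r : ∀ k, (starRingEnd ℂ) (φ0 k) = φ0 (-k)) (h0o : ∀ k, φ0 (sx k) = - φ0 k)
    (hsmall : Real.exp (Kc θ (5/4) * (T + 1)) * En S (5/4) φ0 ≤ 1/2) :
    ∃ φ : ℤ × ℤ → ℝ → ℂ, (∀ k, φ k 0 = φ0 k) ∧ (∀ k ∉ S, ∀ s, φ k s = 0) ∧
      (∀ k, ∀ s ∈ Ioo (-1) (T + 1), (starRingEnd ℂ) (φ k s) = φ (-k) s) ∧
      (∀ k, ∀ s ∈ Ioo (-1) (T + 1), φ (sx k) s = - φ k s) ∧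
      (∀ k ∈ S, ∀ s ∈ Ioo (-1) (T + 1), HasDerivAt (φ k)
        (BB (fun k => θ k + φ k s) (fun k => θ k + φ k s) k) s) ∧
      (∀ r, 1 ≤ r → ∀ s ∈ Ioo (-1) (T + 1), En S r (fun k => φ k s) ≤
        Real.exp (Kc θ r * (T + 1)) * En S r φ0) := by
  have hT1 : 0 < T + 1 := by linarith
  have hv := vG_contDiff S θ
  have hvc := vG_compact S θ
  obtain ⟨α, hα0, hα⟩ := ode_global hv hvc (fun k : S => φ0 k) (by norm_num : (-1:ℝ) < 0) hT1
  have hext0 : ext0 S (α 0) = φ0 := by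
    ext k
    by_cases hk : k ∈ S
    · simp [ext0, hk, hα0]
    · simp [ext0, hk, h0S k hk]
  have hr1 : R1 hS (α 0) = α 0 := by
    rw [hα0]; ext k; simp [R1, h0r]
  have hr2 : R2 hS (α 0) = α 0 := by
    rw [hα0]; ext k; simp [R2, h0o]
  have hreal := ode_sym hv hvc (by norm_num) hT1 hα (R1 hS) (vG_R1 hS hθr) hr1
  have hodd := ode_sym hv hvc (by norm_num) hT1 hα (R2 hS) (vG_R2 hS hθo) hr2
  have hreal' : ∀ k, ∀ s ∈ Ioo (-1) (T + 1), (starRingEnd ℂ) (ext0 S (α s) k) = ext0 S (α s) (-k) := by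
    intro k s hs
    have := congrFun (ext0_R1 hS (α s)) (-k)
    rw [hreal s hs] at this
    rw [this]; simp
  have hodd' : ∀ k, ∀ s ∈ Ioo (-1) (T + 1), ext0 S (α s) (sx k) = - ext0 S (α s) k := by
    intro k s hs
    have := congrFun (ext0_R2 hS (α s)) k
    rw [hodd s hs] at this
    rw [this]; simp
  have hder : ∀ k ∈ S, ∀ s ∈ Ioo (-1) (T + 1), HasDerivAt (fun s => ext0 S (α s) k)
      (((chi (En S (5/4) (ext0 S (α s))) : ℝ) : ℂ) * GF S θ (ext0 S (α s)) k) s := by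
    intro k hk s hs
    have := hasDerivAt_pi.1 (hα s hs) ⟨k, hk⟩
    have e : (fun s => ext0 S (α s) k) = fun s => α s ⟨k, hk⟩ := by ext s; simp [ext0, hk]
    rw [e]; exact this
  have hen : ∀ r, 1 ≤ r → ∀ s ∈ Ioo (-1) (T + 1), En S r (ext0 S (α s)) ≤
        Real.exp (Kc θ r * (T + 1)) * En S r φ0 := by
    intro r hr s hs
    have hd : ∀ s ∈ Ioo (-1) (T + 1), HasDerivAt (fun s => En S r (ext0 S (α s)))
        (2 * (chi (En S (5/4) (ext0 S (α s)))) *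
          (∑ k ∈ S, (((wt k ^ r) ^ 2 : ℝ) : ℂ) * ((starRingEnd ℂ) (ext0 S (α s) k) * GF S θ (ext0 S (α s)) k)).re) s := by
      intro s hs
      unfold En
      simp_rw [mul_pow]
      have := HasDerivAt.fun_sum (u := S) (fun k hk => ((hder k hk s hs).norm_sq).const_mul ((wt k ^ r) ^ 2))
      refine this.congr_deriv ?_
      rw [Complex.re_sum, Finset.mul_sum]
      refine Finset.sum_congr rfl fun k _ => ?_
      rw [Complex.inner, Complex.re_ofReal_mul]
      set c := chi (∑ k ∈ S, (wt k ^ (5/4:ℝ)) ^ 2 * ‖ext0 S (α s) k‖ ^ 2) with hc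
      have : chi (En S (5/4) (ext0 S (α s))) = c := by rw [hc]; simp [En, mul_pow]
      rw [this]
      have e : ∀ z w : ℂ, (((c : ℂ) * z) * w).re = c * (w * z).re := fun z w => by
        simp; ring
      rw [e]; ring
    have hb : ∀ s ∈ Ioo (-1) (T + 1), |2 * (chi (En S (5/4) (ext0 S (α s)))) *
          (∑ k ∈ S, (((wt k ^ r) ^ 2 : ℝ) : ℂ) * ((starRingEnd ℂ) (ext0 S (α s) k) * GF S θ (ext0 S (α s)) k)).re|
          ≤ Kc θ r * En S r (ext0 S (α s)) := by
      intro s hs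
      have hE := En_nonneg S r (ext0 S (α s))
      rcases le_total 1 (En S (5/4) (ext0 S (α s))) with h1 | h1
      · rw [chi_zero h1]; simp
        exact mul_nonneg (Kc_nonneg hr) hE
      · have he := energy_est hr (hθ.summable_r (r + 1)) hθr S (φ := ext0 S (α s))
          (fun k hk => ext0_not _ hk) (fun k => hreal' k s hs)
        have hl : ∑ k ∈ S, ‖ext0 S (α s) k‖ ≤ 1 + cS := by
          have h2 := l1_le S (ext0 S (α s))
          have h3 := cS_nonneg
          have h4 : cS * En S (5/4) (ext0 S (α s)) ≤ cS := mul_le_of_le_one_right h3 h1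
          nlinarith
        have hc : 0 ≤ cR r := by unfold cR; positivity
        have hchi0 : 0 ≤ chi (En S (5/4) (ext0 S (α s))) := Real.smoothTransition.nonneg _
        have hchi1 : chi (En S (5/4) (ext0 S (α s))) ≤ 1 := Real.smoothTransition.le_one _
        rw [abs_mul, abs_mul, abs_two, abs_of_nonneg hchi0]
        set A := |(∑ k ∈ S, (((wt k ^ r) ^ 2 : ℝ) : ℂ) * ((starRingEnd ℂ) (ext0 S (α s) k) * GF S θ (ext0 S (α s)) k)).re|
        have hA : 0 ≤ A := abs_nonneg _
        calc 2 * chi (En S (5/4) (ext0 S (α s))) * A ≤ 2 * 1 * A := by gcongr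
          _ ≤ 2 * (((2 * cR r + 2) * (∑' k, ‖θ k‖ * wt k ^ (r + 1)) + 2 * cR r * (1 + cS)) * En S r (ext0 S (α s))) := by
            rw [mul_one]
            refine mul_le_mul_of_nonneg_left (he.trans ?_) two_pos.le
            gcongr
          _ = _ := by unfold Kc; ring
    have h1 := gronwall2 (by norm_num) hT1 hd hb s hs
    rw [hext0] at h1
    refine h1.trans (mul_le_mul_of_nonneg_right ?_ (En_nonneg _ _ _))
    refine Real.exp_le_exp.2 (mul_le_mul_of_nonneg_left ?_ (Kc_nonneg hr))
    exact abs_le.2 ⟨by linarith [hs.1], hs.2.le⟩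
  refine ⟨fun k s => ext0 S (α s) k, fun k => congrFun hext0 k, fun k hk s => ext0_not _ hk, hreal', hodd',
    fun k hk s hs => ?_, hen⟩
  have := hder k hk s hs
  have hc := (hen (5/4) (by norm_num) s hs).trans hsmall
  rw [chi_one hc, GF_eq_BB hθ S (fun k hk => ext0_not _ hk) hθ0] at this
  simpa using this

/-! ### Passing to the limit in the Galerkin scheme -/

lemma taylor2 {J : Set ℝ} (hJ : Convex ℝ J) {f g g' : ℝ → ℂ} {L : ℝ}
    (hf : ∀ s ∈ J, HasDerivAt f (g s) s) (hg : ∀ s ∈ J, HasDerivAt g (g' s) s)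
    (hL : ∀ s ∈ J, ‖g' s‖ ≤ L) {s s' : ℝ} (hs : s ∈ J) (hs' : s' ∈ J) :
    ‖f s - f s' - (s - s') • g s'‖ ≤ L * ‖s - s'‖ ^ 2 := by
  have hL0 : 0 ≤ L := (norm_nonneg _).trans (hL s hs)
  have hlip : ∀ a ∈ J, ‖g a - g s'‖ ≤ L * ‖a - s'‖ := fun a ha =>
    hJ.norm_image_sub_le_of_norm_hasDerivWithin_le (fun x hx => (hg x hx).hasDerivWithinAt) hL hs' ha
  have hsub : segment ℝ s' s ⊆ J := hJ.segment_subset hs' hs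
  have h := (convex_segment (𝕜 := ℝ) s' s).norm_image_sub_le_of_norm_hasDerivWithin_le
    (f := fun a => f a - a • g s') (f' := fun a => g a - (1:ℝ) • g s') (C := L * ‖s - s'‖)
    (fun x hx => ((hf x (hsub hx)).sub ((hasDerivAt_id x).smul_const (g s'))).hasDerivWithinAt)
    (fun x hx => by
      rw [one_smul]
      refine (hlip x (hsub hx)).trans ?_
      refine mul_le_mul_of_nonneg_left ?_ hL0
      rw [segment_eq_uIcc] at hx
      rw [Real.norm_eq_abs, Real.norm_eq_abs]
      exact abs_sub_left_of_mem_uIcc hx)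
    (left_mem_segment ℝ s' s) (right_mem_segment ℝ s' s)
  calc _ = ‖(f s - s • g s') - (f s' - s' • g s')‖ := by rw [sub_smul]; congr 1; abel
    _ ≤ _ := h
    _ = _ := by ring

lemma hasDerivAt_of_sq {J : Set ℝ} (hJ : IsOpen J) {f : ℝ → ℂ} {d : ℂ} {L s' : ℝ} (hs' : s' ∈ J)
    (h : ∀ s ∈ J, ‖f s - f s' - (s - s') • d‖ ≤ L * ‖s - s'‖ ^ 2) : HasDerivAt f d s' := by
  rw [hasDerivAt_iff_isLittleO]
  have h1 : (fun s => f s - f s' - (s - s') • d) =O[nhds s'] fun s => (s - s') ^ 2 := by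
    refine Asymptotics.IsBigO.of_bound L ?_
    filter_upwards [hJ.mem_nhds hs'] with s hs
    rw [norm_pow]; exact h s hs
  refine h1.trans_isLittleO ?_
  have : (fun s : ℝ => (s - s') ^ 2) = (fun s => s ^ 2) ∘ fun s => s - s' := rfl
  have h2 : (fun x : ℝ => x ^ 2) =o[nhds 0] fun x => x := by
    simpa using Asymptotics.isLittleO_pow_pow (𝕜 := ℝ) (show 1 < 2 by norm_num)
  refine h2.comp_tendsto (k := fun s : ℝ => s - s') ?_
  have : Filter.Tendsto (fun s : ℝ => s - s') (nhds s') (nhds (s' - s')) :=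
    (continuous_id.sub continuous_const).tendsto s'
  simpa using this

/-- the box of size `N` -/
noncomputable def bx (N : ℕ) : Finset (ℤ × ℤ) := Finset.Icc (-(N : ℤ)) N ×ˢ Finset.Icc (-(N : ℤ)) N

lemma bx_sym (N : ℕ) : SymS (bx N) := by
  constructor <;> intro k hk <;> simp [bx, sx_apply] at hk ⊢ <;> lia

lemma bx_mono {M N : ℕ} (h : M ≤ N) : bx M ⊆ bx N := by
  intro k hk; simp [bx] at hk ⊢; lia

lemma mem_bx (k : ℤ × ℤ) (N : ℕ) (h : k.1.natAbs + k.2.natAbs ≤ N) : k ∈ bx N := by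
  simp [bx]; lia

lemma En_bx {M N : ℕ} (h : M ≤ N) {φ : ℤ × ℤ → ℂ} (hφ : ∀ k ∉ bx M, φ k = 0) (r : ℝ) :
    En (bx N) r φ = En (bx M) r φ :=
  (Finset.sum_subset (bx_mono h) fun k _ hk => by simp [hφ k hk]).symm

theorem euler_exist {θ : ℤ × ℤ → ℂ} (hθ : RDs θ) (hθr : ∀ k, (starRingEnd ℂ) (θ k) = θ (-k))
    (hθo : ∀ k, θ (sx k) = - θ k) (hθ0 : ∀ k, BB θ θ k = 0) {T : ℝ} (hT : 0 < T) :
    ∃ ε0 > 0, ∃ C ≥ 0, ∀ (φ0 : ℤ × ℤ → ℂ) (N0 : ℕ), (∀ k ∉ bx N0, φ0 k = 0) →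
      (∀ k, (starRingEnd ℂ) (φ0 k) = φ0 (-k)) → (∀ k, φ0 (sx k) = - φ0 k) →
      En (bx N0) (5/4) φ0 ≤ ε0 →
      ∃ φ : ℤ × ℤ → ℝ → ℂ, (∀ k, φ k 0 = φ0 k) ∧ URD (Ioo (-1) (T + 1)) φ ∧
        (∀ k, ∀ s ∈ Ioo (-1) (T + 1), HasDerivAt (φ k)
          (BB (fun k => θ k + φ k s) (fun k => θ k + φ k s) k) s) ∧
        (∀ k, ∀ s ∈ Ioo (-1) (T + 1), (starRingEnd ℂ) (φ k s) = φ (-k) s) ∧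
        (∀ k, ∀ s ∈ Ioo (-1) (T + 1), φ (sx k) s = - φ k s) ∧
        (∀ s ∈ Ioo (-1) (T + 1), (∑' k, ‖φ k s‖) ^ 2 ≤ C * En (bx N0) (5/4) φ0) := by
  set J := Ioo (-1) (T + 1) with hJdef
  have hJ : IsOpen J := isOpen_Ioo
  have hJc : Convex ℝ J := convex_Ioo _ _
  have hJ' : IsPreconnected J := isPreconnected_Ioo
  have h0J : (0:ℝ) ∈ J := ⟨by norm_num, by linarith⟩
  set X := Real.exp (Kc θ (5/4) * (T + 1)) with hX
  have hXpos : 0 < X := Real.exp_pos _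
  refine ⟨1 / (2 * X), by positivity, cS * X, by have := cS_nonneg; positivity, ?_⟩
  intro φ0 N0 h0S h0r h0o hsm
  have h0S' : ∀ N, ∀ k ∉ bx (N0 + N), φ0 k = 0 := fun N k hk =>
    h0S k fun h => hk (bx_mono (Nat.le_add_right _ _) h)
  have hEn : ∀ N r, En (bx (N0 + N)) r φ0 = En (bx N0) r φ0 := fun N r =>
    En_bx (Nat.le_add_right _ _) h0S r
  have hex := fun N => galerkin hθ hθr hθo hθ0 (bx_sym (N0 + N)) hT (h0S' N) h0r h0o
    (by rw [hEn]
        calc X * En (bx N0) (5/4) φ0 ≤ X * (1 / (2 * X)) := by gcongr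
          _ = 1 / 2 := by field_simp)
  choose Φ hΦ0 hΦS hΦr hΦo hΦd hΦe using hex
  -- uniform bounds
  have hub : ∀ r : ℕ, ∃ C, ∀ N k, ∀ s ∈ J, ‖Φ N k s‖ * wt k ^ r ≤ C := by
    intro r
    refine ⟨1 + Real.exp (Kc θ ((r + 1 : ℕ) : ℝ) * (T + 1)) * En (bx N0) ((r + 1 : ℕ) : ℝ) φ0, fun N k s hs => ?_⟩
    have hw := one_le_wt k
    have hpos : 0 ≤ Real.exp (Kc θ ((r + 1 : ℕ) : ℝ) * (T + 1)) * En (bx N0) ((r + 1 : ℕ) : ℝ) φ0 :=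
      mul_nonneg (Real.exp_pos _).le (En_nonneg _ _ _)
    by_cases hk : k ∈ bx (N0 + N)
    · have h1 := norm_le_of_En (r := ((r + 1 : ℕ) : ℝ)) (by positivity) (φ := fun k => Φ N k s) hk
      have h2 := hΦe N ((r + 1 : ℕ) : ℝ) (by push_cast; linarith [Nat.cast_nonneg (α := ℝ) r]) s hs
      rw [hEn] at h2
      have h3 := h1.trans h2
      rw [Real.rpow_natCast] at h3
      have h4 : ‖Φ N k s‖ * wt k ^ r ≤ wt k ^ (r + 1) * ‖Φ N k s‖ := by
        rw [mul_comm]; gcongr; lia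
      have h5 : 0 ≤ ‖Φ N k s‖ * wt k ^ r := by have := wt_pos k; positivity
      nlinarith
    · rw [hΦS N k hk, norm_zero, zero_mul]; linarith
  have hΦu : ∀ N, URD J (Φ N) := fun N r => by
    obtain ⟨C, hC⟩ := hub r; exact ⟨C, fun k s hs => hC N k s hs⟩
  -- full field
  obtain ⟨θb, hθb⟩ : ∃ θb : ℕ → ℝ, ∀ r k, ‖θ k‖ * wt k ^ r ≤ θb r := by
    choose b hb using hθ; exact ⟨b, hb⟩
  have hcb : ∀ r : ℕ, ∃ C, ∀ N k, ∀ s ∈ J, ‖θ k + Φ N k s‖ * wt k ^ r ≤ C := by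
    intro r
    obtain ⟨C, hC⟩ := hub r
    refine ⟨θb r + C, fun N k s hs => ?_⟩
    have := wt_pos k
    calc ‖θ k + Φ N k s‖ * wt k ^ r ≤ (‖θ k‖ + ‖Φ N k s‖) * wt k ^ r := by
          gcongr; exact norm_add_le _ _
      _ ≤ _ := by rw [add_mul]; exact add_le_add (hθb r k) (hC N k s hs)
  let G : ℕ → ℤ × ℤ → ℝ → ℂ := fun N k s => BB (fun k => θ k + Φ N k s) (fun k => θ k + Φ N k s) k
  let D : ℕ → ℤ × ℤ → ℝ → ℂ := fun N k s => if k ∈ bx (N0 + N) then G N k s else 0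
  have hGb : ∀ r : ℕ, ∃ C, ∀ N k, ∀ s ∈ J, ‖G N k s‖ * wt k ^ r ≤ C := by
    intro r
    obtain ⟨A, hA⟩ := hcb (r + 3)
    obtain ⟨B, hB⟩ := hcb (r + 1)
    exact ⟨_, fun N k s hs => BB_bound (fun k => hA N k s hs) (fun k => hB N k s hs) k⟩
  have hDb : ∀ r : ℕ, ∃ C, ∀ N k, ∀ s ∈ J, ‖D N k s‖ * wt k ^ r ≤ C := by
    intro r
    obtain ⟨A, hA⟩ := hGb r
    refine ⟨A, fun N k s hs => le_trans ?_ (hA N k s hs)⟩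
    have := wt_pos k
    gcongr
    simp only [D]; split_ifs <;> simp
  have hcd : ∀ N k, ∀ s ∈ J, HasDerivAt (fun s => θ k + Φ N k s) (D N k s) s := by
    intro N k s hs
    by_cases hk : k ∈ bx (N0 + N)
    · simp only [D, hk, if_true]; exact (hΦd N k hk s hs).const_add _
    · simp only [D, hk, if_false]
      have : (fun s => θ k + Φ N k s) = fun _ => θ k := by ext s; simp [hΦS N k hk]
      rw [this]; exact hasDerivAt_const _ _
  have hGd : ∀ N k, ∀ s ∈ J, HasDerivAt (G N k)
      (BB (fun m => D N m s) (fun m => θ m + Φ N m s) k + BB (fun m => θ m + Φ N m s) (fun m => D N m s) k) s := by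
    intro N k s hs
    have hu : URD J (fun k s => θ k + Φ N k s) := fun r => by
      obtain ⟨C, hC⟩ := hcb r; exact ⟨C, hC N⟩
    have hu' : URD J (D N) := fun r => by
      obtain ⟨C, hC⟩ := hDb r; exact ⟨C, hC N⟩
    exact BB_deriv hJ hJ' hu hu hu' hu' (hcd N) (hcd N) k s hs
  obtain ⟨L, hL⟩ : ∃ L, ∀ N k, ∀ s ∈ J, ‖BB (fun m => D N m s) (fun m => θ m + Φ N m s) k +
      BB (fun m => θ m + Φ N m s) (fun m => D N m s) k‖ ≤ L := by
    obtain ⟨A, hA⟩ := hcb 3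
    obtain ⟨A', hA'⟩ := hcb 1
    obtain ⟨B, hB⟩ := hDb 3
    obtain ⟨B', hB'⟩ := hDb 1
    refine ⟨2 * B * A' * cB + 2 * A * B' * cB, fun N k s hs => ?_⟩
    have h1 := BB_bound (r := 0) (a := fun m => D N m s) (b := fun m => θ m + Φ N m s) (fun k => hB N k s hs) (fun k => hA' N k s hs) k
    have h2 := BB_bound (r := 0) (a := fun m => θ m + Φ N m s) (b := fun m => D N m s) (fun k => hA N k s hs) (fun k => hB' N k s hs) k
    rw [pow_zero, mul_one] at h1 h2
    exact (norm_add_le _ _).trans (add_le_add h1 h2)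
  -- the limit
  let U : Ultrafilter ℕ := Filter.hyperfilter ℕ
  have hU : (U : Filter ℕ) ≤ Filter.atTop := Nat.hyperfilter_le_atTop
  have hlim : ∀ k s, ∃ z, s ∈ J → Filter.Tendsto (fun N => Φ N k s) U (nhds z) := by
    intro k s
    by_cases hs : s ∈ J
    · obtain ⟨C, hC⟩ := hub 0
      have hcpt := isCompact_closedBall (0:ℂ) C
      obtain ⟨z, _, hz⟩ := hcpt.ultrafilter_le_nhds (U.map fun N => Φ N k s) (by
        simp only [Ultrafilter.coe_map, Filter.le_principal_iff, Filter.mem_map]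
        refine Filter.univ_mem' fun N => ?_
        simpa using hC N k s hs)
      exact ⟨z, fun _ => hz⟩
    · exact ⟨0, fun h => absurd h hs⟩
  choose φ hφ using hlim
  have hk : ∀ k, ∀ᶠ N in (U : Filter ℕ), k ∈ bx (N0 + N) := fun k => hU <| by
    filter_upwards [Filter.eventually_ge_atTop (k.1.natAbs + k.2.natAbs)] with N hN
    exact mem_bx k _ (by lia)
  have hGlim : ∀ k, ∀ s ∈ J, Filter.Tendsto (fun N => G N k s) U
      (nhds (BB (fun k => θ k + φ k s) (fun k => θ k + φ k s) k)) := by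
    intro k s hs
    obtain ⟨A, hA⟩ := hcb 3
    obtain ⟨B, hB⟩ := hcb 1
    refine tendsto_tsum_of_dominated_convergence (bound := fun m => 2 * A * B * (1 / wt m ^ 3))
      (summable_wt_inv.mul_left _) (fun m => ?_) (Filter.Eventually.of_forall fun N m => ?_)
    · exact (((hφ m s hs).const_add _).mul ((hφ (k - m) s hs).const_add _)).const_mul _
    · simpa using BB_term_bound (r := 0) (a := fun m => θ m + Φ N m s) (b := fun m => θ m + Φ N m s)
        (fun k => hA N k s hs) (fun k => hB N k s hs) k m
  have hφu : URD J φ := fun r => by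
    obtain ⟨C, hC⟩ := hub r
    refine ⟨C, fun k s hs => ?_⟩
    exact le_of_tendsto (((hφ k s hs).norm).mul_const _) (Filter.Eventually.of_forall fun N => hC N k s hs)
  refine ⟨φ, fun k => ?_, hφu, fun k s hs => ?_, fun k s hs => ?_, fun k s hs => ?_, fun s hs => ?_⟩
  · have h1 := hφ k 0 h0J
    simp only [hΦ0] at h1
    exact tendsto_nhds_unique h1 tendsto_const_nhds
  · refine hasDerivAt_of_sq (L := L) hJ hs fun s' hs' => ?_
    have hten := (((hφ k s' hs').sub (hφ k s hs)).sub ((hGlim k s hs).const_smul (s' - s))).norm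
    refine le_of_tendsto hten ?_
    filter_upwards [hk k] with N hN
    exact taylor2 hJc (fun s hs => hΦd N k hN s hs) (hGd N k) (fun s hs => hL N k s hs) hs' hs
  · refine tendsto_nhds_unique ((Complex.continuous_conj.tendsto _).comp (hφ k s hs)) ?_
    refine (hφ (-k) s hs).congr fun N => ?_
    exact (hΦr N k s hs).symm
  · refine tendsto_nhds_unique (hφ (sx k) s hs) ?_
    refine ((hφ k s hs).neg).congr fun N => ?_
    exact (hΦo N k s hs).symm
  · have hsm := (hφu.rds hs).summable0
    have hfin : ∀ F : Finset (ℤ × ℤ), (∑ k ∈ F, ‖φ k s‖) ^ 2 ≤ cS * X * En (bx N0) (5/4) φ0 := by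
      intro F
      refine le_of_tendsto ((tendsto_finsetSum F fun k _ => (hφ k s hs).norm).pow 2)
        (Filter.Eventually.of_forall fun N => ?_)
      have h1 := l1_le (bx (N0 + N)) (fun k => Φ N k s)
      have h2 := hΦe N (5/4) (by norm_num) s hs
      rw [hEn] at h2
      have h3 : ∑ k ∈ F, ‖Φ N k s‖ ≤ ∑ k ∈ bx (N0 + N), ‖Φ N k s‖ := by
        classical
        rw [← Finset.sum_filter_add_sum_filter_not F (fun k => k ∈ bx (N0 + N)),
          Finset.sum_eq_zero (s := F.filter fun k => k ∉ bx (N0 + N)) (fun k hk => by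
            rw [hΦS N k (Finset.mem_filter.1 hk).2, norm_zero]), add_zero]
        exact Finset.sum_le_sum_of_subset_of_nonneg (fun k hk => (Finset.mem_filter.1 hk).2)
          (fun _ _ _ => norm_nonneg _)
      calc (∑ k ∈ F, ‖Φ N k s‖) ^ 2 ≤ (∑ k ∈ bx (N0 + N), ‖Φ N k s‖) ^ 2 := by
            gcongr
        _ ≤ _ := h1
        _ ≤ cS * (X * En (bx N0) (5/4) φ0) := mul_le_mul_of_nonneg_left h2 cS_nonneg
        _ = _ := by ring
    exact le_of_tendsto (hsm.hasSum.pow 2) (Filter.Eventually.of_forall hfin)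

/-! ### Weighted `ℓ¹` norms and convolution -/

/-- weighted `ℓ¹` norm -/
noncomputable def NN (r : ℕ) (a : ℤ × ℤ → ℂ) : ℝ := ∑' k, ‖a k‖ * wt k ^ r

lemma NN_term_nonneg (r : ℕ) (a : ℤ × ℤ → ℂ) (k : ℤ × ℤ) : 0 ≤ ‖a k‖ * wt k ^ r := by
  have := wt_pos k; positivity

lemma NN_nonneg (r : ℕ) (a : ℤ × ℤ → ℂ) : 0 ≤ NN r a := tsum_nonneg (NN_term_nonneg r a)

lemma le_NN {r : ℕ} {a : ℤ × ℤ → ℂ} (h : RDs a) (k : ℤ × ℤ) : ‖a k‖ * wt k ^ r ≤ NN r a :=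
  (h.summable r).le_tsum k fun j _ => NN_term_nonneg r a j

lemma cv_weight {a b : ℤ × ℤ → ℂ} (ha : RDs a) (hb : RDs b) (r : ℕ) (k : ℤ × ℤ) :
    ‖cv a b k‖ * wt k ^ r ≤
      ‖cv (fun k => ((‖a k‖ * wt k ^ r : ℝ) : ℂ)) (fun k => ((‖b k‖ * wt k ^ r : ℝ) : ℂ)) k‖ := by
  have hs := (summable_cv_prod (ha.summable r) (hb.summable r) (NN_term_nonneg r a)
    (NN_term_nonneg r b)).prod_factor k
  simp only at hs
  have e : cv (fun k => ((‖a k‖ * wt k ^ r : ℝ) : ℂ)) (fun k => ((‖b k‖ * wt k ^ r : ℝ) : ℂ)) k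
      = ((∑' m, (‖a m‖ * wt m ^ r) * (‖b (k - m)‖ * wt (k - m) ^ r) : ℝ) : ℂ) := by
    unfold cv; rw [Complex.ofReal_tsum]; congr 1; ext m; push_cast; ring
  rw [e, Complex.norm_real, Real.norm_eq_abs, abs_of_nonneg (tsum_nonneg fun m =>
    mul_nonneg (NN_term_nonneg r a m) (NN_term_nonneg r b _))]
  have hw := pow_pos (wt_pos k) r
  rw [← le_div_iff₀ hw]
  unfold cv
  rw [← tsum_div_const]
  refine tsum_of_norm_bounded (hs.div_const _).hasSum fun m => ?_
  rw [le_div_iff₀ hw, norm_mul]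
  have h1 : wt k ^ r ≤ wt m ^ r * wt (k - m) ^ r := by
    rw [← mul_pow]; exact pow_le_pow_left₀ (wt_pos k).le (wt_le_mul_sub k m) r
  calc ‖a m‖ * ‖b (k - m)‖ * wt k ^ r ≤ ‖a m‖ * ‖b (k - m)‖ * (wt m ^ r * wt (k - m) ^ r) := by gcongr
    _ = _ := by ring

lemma cv_NN_aux {a b : ℤ × ℤ → ℂ} (ha : RDs a) (hb : RDs b) (r : ℕ) :
    Summable (fun k => ‖cv a b k‖ * wt k ^ r) ∧ NN r (cv a b) ≤ NN r a * NN r b := by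
  have e : ∀ (a : ℤ × ℤ → ℂ) k, ‖((‖a k‖ * wt k ^ r : ℝ) : ℂ)‖ = ‖a k‖ * wt k ^ r := fun a k => by
    rw [Complex.norm_real, Real.norm_eq_abs, abs_of_nonneg (NN_term_nonneg r a k)]
  have h := cv_norm_summable (a := fun k => ((‖a k‖ * wt k ^ r : ℝ) : ℂ))
    (b := fun k => ((‖b k‖ * wt k ^ r : ℝ) : ℂ)) (by simp only [e]; exact ha.summable r)
    (by simp only [e]; exact hb.summable r)
  simp only [e] at h
  have hs := h.1.of_nonneg_of_le (NN_term_nonneg r _) (cv_weight ha hb r)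
  exact ⟨hs, (hs.tsum_le_tsum (cv_weight ha hb r) h.1).trans h.2⟩

lemma RDs.cv {a b : ℤ × ℤ → ℂ} (ha : RDs a) (hb : RDs b) : RDs (cv a b) := fun r =>
  ⟨NN r (_root_.cv a b), fun k => (cv_NN_aux ha hb r).1.le_tsum k fun j _ => NN_term_nonneg r _ j⟩

lemma NN_cv {a b : ℤ × ℤ → ℂ} (ha : RDs a) (hb : RDs b) (r : ℕ) :
    NN r (cv a b) ≤ NN r a * NN r b := (cv_NN_aux ha hb r).2

lemma NN_add {a b : ℤ × ℤ → ℂ} (ha : RDs a) (hb : RDs b) (r : ℕ) :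
    NN r (fun k => a k + b k) ≤ NN r a + NN r b := by
  unfold NN
  rw [← (ha.summable r).tsum_add (hb.summable r)]
  refine ((ha.add hb).summable r).tsum_le_tsum (fun k => ?_) ((ha.summable r).add (hb.summable r))
  have := wt_pos k
  rw [← add_mul]; gcongr; exact norm_add_le _ _

lemma NN_const_mul (a : ℤ × ℤ → ℂ) (c : ℂ) (r : ℕ) : NN r (fun k => c * a k) = ‖c‖ * NN r a := by
  unfold NN; rw [← tsum_mul_left]; congr 1; ext k; rw [norm_mul, mul_assoc]

/-! ### The nonlinearity -/

/-- the cubic on coefficients -/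
noncomputable def Gc (a : ℤ × ℤ → ℂ) : ℤ × ℤ → ℂ :=
  fun k => (3/2 : ℂ) * a k + (-(1/2) : ℂ) * cv a (cv a a) k

/-- the cubic -/
noncomputable def gr (z : ℝ) : ℝ := z * (3 - z ^ 2) / 2

lemma RDs.Gc {a : ℤ × ℤ → ℂ} (ha : RDs a) : RDs (Gc a) :=
  (ha.const_mul _).add ((ha.cv (ha.cv ha)).const_mul _)

lemma Fs_Gc {a : ℤ × ℤ → ℂ} (ha : RDs a) (x y : ℝ) :
    Fs (Gc a) x y = Fs a x y * (3 - Fs a x y ^ 2) / 2 := by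
  unfold Gc
  rw [Fs_add (ha.const_mul _).summable0 ((ha.cv (ha.cv ha)).const_mul _).summable0, Fs_const_mul,
    Fs_const_mul, Fs_cv ha.summable0 (ha.cv ha).summable0, Fs_cv ha.summable0 ha.summable0]
  ring

lemma NN_Gc {a : ℤ × ℤ → ℂ} (ha : RDs a) (r : ℕ) {A : ℝ} (h : NN r a ≤ A) :
    NN r (Gc a) ≤ 3/2 * A + 1/2 * (A * (A * A)) := by
  have h0 := NN_nonneg r a
  have h1 := NN_add (ha.const_mul (3/2)) ((ha.cv (ha.cv ha)).const_mul (-(1/2))) r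
  rw [NN_const_mul, NN_const_mul] at h1
  have h2 := NN_cv ha (ha.cv ha) r
  have h3 := NN_cv ha ha r
  have h4 : NN r (cv a (cv a a)) ≤ A * (A * A) :=
    h2.trans (mul_le_mul h (h3.trans (mul_le_mul h h h0 (h0.trans h))) (NN_nonneg _ _) (h0.trans h))
  refine h1.trans ?_
  norm_num
  linarith

lemma RDs.Gc_iter {a : ℤ × ℤ → ℂ} (ha : RDs a) (m : ℕ) : RDs (_root_.Gc^[m] a) := by
  induction m with
  | zero => exact ha
  | succ m ih => rw [Function.iterate_succ_apply']; exact ih.Gc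

lemma NN_Gc_iter (m r : ℕ) (A : ℝ) : ∃ B, ∀ a, RDs a → NN r a ≤ A → NN r (Gc^[m] a) ≤ B := by
  induction m with
  | zero => exact ⟨A, fun a _ h => h⟩
  | succ m ih =>
    obtain ⟨B, hB⟩ := ih
    refine ⟨3/2 * B + 1/2 * (B * (B * B)), fun a ha h => ?_⟩
    rw [Function.iterate_succ_apply']
    exact NN_Gc (ha.Gc_iter m) r (hB a ha h)

/-- the nonlinearity on coefficients -/
noncomputable def Fc (m : ℕ) (a : ℤ × ℤ → ℂ) : ℤ × ℤ → ℂ := fun k => (1/2 : ℂ) * (Gc^[m] a) k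

/-- the nonlinearity -/
noncomputable def fr (m : ℕ) (z : ℝ) : ℝ := gr^[m] z / 2

lemma Fs_Fc {a : ℤ × ℤ → ℂ} (ha : RDs a) (m : ℕ) (x y : ℝ) {z : ℝ} (h : Fs a x y = z) :
    Fs (Fc m a) x y = (fr m z : ℝ) := by
  have : Fs (Gc^[m] a) x y = ((gr^[m] z : ℝ) : ℂ) := by
    induction m with
    | zero => simpa using h
    | succ m ih =>
      rw [Function.iterate_succ_apply', Function.iterate_succ_apply', Fs_Gc (ha.Gc_iter m), ih]
      unfold gr; push_cast; ring
  unfold Fc fr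
  rw [Fs_const_mul, this]; push_cast; ring

lemma gr_continuous : Continuous gr := by unfold gr; fun_prop
lemma fr_continuous (m : ℕ) : Continuous (fr m) :=
  (gr_continuous.iterate m).div_const 2

lemma gr_neg (z : ℝ) : gr (-z) = - gr z := by unfold gr; ring
lemma fr_neg (m : ℕ) (z : ℝ) : fr m (-z) = - fr m z := by
  have : gr^[m] (-z) = - gr^[m] z := by
    induction m with
    | zero => rfl
    | succ m ih => rw [Function.iterate_succ_apply', Function.iterate_succ_apply', ih, gr_neg]
  unfold fr; rw [this]; ring

lemma gr_mono {z w : ℝ} (h0 : 0 ≤ z) (h1 : z ≤ w) (h2 : w ≤ 1) : gr z ≤ gr w := by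
  unfold gr
  nlinarith [mul_nonneg (sub_nonneg.2 h1) (by nlinarith : (0:ℝ) ≤ 3 - (z^2 + z*w + w^2))]

lemma gr_mem {z : ℝ} (h0 : 0 ≤ z) (h1 : z ≤ 1) : 0 ≤ gr z ∧ gr z ≤ 1 := by
  have a := gr_mono le_rfl h0 h1
  have b := gr_mono h0 h1 le_rfl
  norm_num [gr] at a b ⊢; exact ⟨a, b⟩

lemma gr_iter_mem (m : ℕ) {z : ℝ} (h0 : 0 ≤ z) (h1 : z ≤ 1) : 0 ≤ gr^[m] z ∧ gr^[m] z ≤ 1 := by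
  induction m with
  | zero => exact ⟨h0, h1⟩
  | succ m ih => rw [Function.iterate_succ_apply']; exact gr_mem ih.1 ih.2

lemma gr_iter_mono (m : ℕ) {z w : ℝ} (h0 : 0 ≤ z) (h1 : z ≤ w) (h2 : w ≤ 1) : gr^[m] z ≤ gr^[m] w := by
  induction m with
  | zero => exact h1
  | succ m ih =>
    rw [Function.iterate_succ_apply', Function.iterate_succ_apply']
    exact gr_mono (gr_iter_mem m h0 (h1.trans h2)).1 ih (gr_iter_mem m (h0.trans h1) h2).2

lemma gr_iter_low (m : ℕ) {z : ℝ} (h0 : 0 ≤ z) (h1 : z ≤ 1) :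
    1/2 ≤ gr^[m] z ∨ (11/8) ^ m * z ≤ gr^[m] z := by
  induction m with
  | zero => right; simp
  | succ m ih =>
    obtain ⟨a, b⟩ := gr_iter_mem m h0 h1
    rw [Function.iterate_succ_apply']
    set w := gr^[m] z
    rcases le_total (1/2) w with h | h
    · left
      have := gr_mono (by norm_num) h b
      norm_num [gr] at this ⊢; linarith
    · rcases ih with ih | ih
      · left
        have := gr_mono (by norm_num) ih b
        norm_num [gr] at this ⊢; linarith
      · right
        have : 11/8 * w ≤ gr w := by
          unfold gr; nlinarith [mul_nonneg a (by nlinarith : (0:ℝ) ≤ 1/4 - w^2)]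
        calc (11/8) ^ (m+1) * z = 11/8 * ((11/8)^m * z) := by ring
          _ ≤ 11/8 * w := by gcongr
          _ ≤ _ := this

lemma fr_mem (m : ℕ) {z : ℝ} (h0 : 0 ≤ z) (h1 : z ≤ 1) : 0 ≤ fr m z ∧ fr m z ≤ 1/2 := by
  obtain ⟨a, b⟩ := gr_iter_mem m h0 h1
  unfold fr; constructor <;> linarith

lemma fr_mono (m : ℕ) {z w : ℝ} (h0 : 0 ≤ z) (h1 : z ≤ w) (h2 : w ≤ 1) : fr m z ≤ fr m w := by
  have := gr_iter_mono m h0 h1 h2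
  unfold fr; linarith

lemma fr_abs (m : ℕ) {z : ℝ} (h : |z| ≤ 1) : |fr m z| ≤ 1/2 := by
  rcases le_total 0 z with h0 | h0
  · rw [abs_of_nonneg h0] at h
    obtain ⟨a, b⟩ := fr_mem m h0 h
    rw [abs_of_nonneg a]; exact b
  · rw [abs_of_nonpos h0] at h
    obtain ⟨a, b⟩ := fr_mem m (neg_nonneg.2 h0) h
    rw [fr_neg] at a b
    rw [abs_of_nonpos (by linarith)]; exact b

lemma fr_low (m : ℕ) {z L v : ℝ} (h0 : 0 ≤ z) (h1 : z ≤ 1) (hm : L ≤ (11/8) ^ m / 2)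
    (hv : v ≤ 1/4) (hv' : v ≤ L * z) : v ≤ fr m z := by
  unfold fr
  rcases gr_iter_low m h0 h1 with h | h
  · linarith
  · have : L * z ≤ (11/8)^m / 2 * z := by gcongr
    linarith

/-! ### Real doubly odd coefficient sequences -/

lemma RDs.comp_equiv {a : ℤ × ℤ → ℂ} (h : RDs a) (e : ℤ × ℤ → ℤ × ℤ) (he : ∀ k, wt (e k) = wt k) :
    RDs (fun k => a (e k)) := fun r => by
  obtain ⟨C, hC⟩ := h r
  exact ⟨C, fun k => by have := hC (e k); rwa [he] at this⟩

lemma wt_sy (k : ℤ × ℤ) : wt (sy k) = wt k := by simp [wt, nn, sy_apply]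

/-- real, odd in both variables, rapidly decaying -/
structure OO (a : ℤ × ℤ → ℂ) : Prop where
  rd : RDs a
  re : ∀ k, (starRingEnd ℂ) (a k) = a (-k)
  ox : ∀ k, a (sx k) = - a k
  oy : ∀ k, a (sy k) = - a k

/-- the real function -/
noncomputable def uu (a : ℤ × ℤ → ℂ) (x y : ℝ) : ℝ := (Fs a x y).re

lemma OO.eq {a : ℤ × ℤ → ℂ} (h : OO a) (x y : ℝ) : Fs a x y = (uu a x y : ℝ) := (Fs_real h.re x y).symm

lemma Fs_conj (a : ℤ × ℤ → ℂ) (x y : ℝ) :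
    Fs (fun k => (starRingEnd ℂ) (a (-k))) x y = (starRingEnd ℂ) (Fs a x y) := by
  unfold Fs
  rw [Complex.conj_tsum, ← (Equiv.neg (ℤ × ℤ)).tsum_eq (fun k => (starRingEnd ℂ) (a k * ee k x y))]
  congr 1; ext k
  simp [ee_conj]

lemma Fs_inj {a b : ℤ × ℤ → ℂ} (ha : RDs a) (hb : RDs b) (h : ∀ x y, Fs a x y = Fs b x y) (k : ℤ × ℤ) :
    a k = b k := by
  have := Fs_eq_zero (ha.sub hb).summable0 (fun x y => by
    rw [Fs_sub ha.summable0 hb.summable0, h, sub_self]) k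
  exact sub_eq_zero.1 this

lemma Fs_sx (a : ℤ × ℤ → ℂ) (x y : ℝ) : Fs (fun k => a (sx k)) x y = Fs a (-x) y := by
  unfold Fs
  rw [← sx.tsum_eq (fun k => a k * ee k (-x) y)]
  congr 1; ext k; rw [ee_sx, neg_neg]

lemma Fs_sy (a : ℤ × ℤ → ℂ) (x y : ℝ) : Fs (fun k => a (sy k)) x y = Fs a x (-y) := by
  unfold Fs
  rw [← sy.tsum_eq (fun k => a k * ee k x (-y))]
  congr 1; ext k; rw [ee_sy, neg_neg]

lemma OO.of_fun {a : ℤ × ℤ → ℂ} (ha : RDs a) {g : ℝ → ℝ → ℝ} (hg : ∀ x y, Fs a x y = g x y)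
    (hx : ∀ x y, g (-x) y = - g x y) (hy : ∀ x y, g x (-y) = - g x y) : OO a := by
  have hn : RDs (fun k => -a k) := by simpa using ha.const_mul (-1)
  have hneg : ∀ x y, Fs (fun k => -a k) x y = - Fs a x y := fun x y => by
    have := Fs_const_mul a (-1) x y; simpa using this
  refine ⟨ha, fun k => ?_, fun k => ?_, fun k => ?_⟩
  · have hc : RDs (fun k => (starRingEnd ℂ) (a (-k))) := fun r => by
      obtain ⟨C, hC⟩ := ha.comp_equiv (fun k => -k) wt_neg r
      exact ⟨C, fun k => by simpa using hC k⟩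
    have := Fs_inj hc ha (fun x y => by rw [Fs_conj, hg]; simp) (-k)
    simpa using this
  · exact Fs_inj (ha.comp_equiv sx wt_sx) hn (fun x y => by
      rw [hneg, Fs_sx, hg, hg, hx]; simp) k
  · exact Fs_inj (ha.comp_equiv sy wt_sy) hn (fun x y => by
      rw [hneg, Fs_sy, hg, hg, hy]; simp) k

lemma OO.odd_x {a : ℤ × ℤ → ℂ} (h : OO a) (x y : ℝ) : uu a (-x) y = - uu a x y := by
  unfold uu; rw [Fs_odd_x h.ox]; simp
lemma OO.odd_y {a : ℤ × ℤ → ℂ} (h : OO a) (x y : ℝ) : uu a x (-y) = - uu a x y := by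
  unfold uu; rw [Fs_odd_y h.oy]; simp

lemma OO.zero {a : ℤ × ℤ → ℂ} (h : OO a) : a 0 = 0 := by
  have := h.ox 0
  have e : sx 0 = 0 := rfl
  rw [e] at this
  exact self_eq_neg.1 this

lemma OO.neg {a : ℤ × ℤ → ℂ} (h : OO a) : OO (fun k => - a k) :=
  ⟨by simpa using h.rd.const_mul (-1), fun k => by simp [h.re], fun k => by simp [h.ox], fun k => by simp [h.oy]⟩

lemma OO.sub {a b : ℤ × ℤ → ℂ} (h : OO a) (h' : OO b) : OO (fun k => a k - b k) :=
  ⟨h.rd.sub h'.rd, fun k => by simp [h.re, h'.re], fun k => by simp [h.ox, h'.ox]; ring,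
    fun k => by simp [h.oy, h'.oy]; ring⟩

lemma sq2_sx (k : ℤ × ℤ) : sq2 (sx k) = sq2 k := by simp [sq2, sx_apply]
lemma sq2_sy (k : ℤ × ℤ) : sq2 (sy k) = sq2 k := by simp [sq2, sy_apply]

lemma OO.iL {a : ℤ × ℤ → ℂ} (h : OO a) : OO (iL a) :=
  ⟨h.rd.iL, fun k => by simp [_root_.iL, h.re, sq2_neg], fun k => by simp [_root_.iL, h.ox, sq2_sx],
    fun k => by simp [_root_.iL, h.oy, sq2_sy]⟩

lemma OO.Fc {a : ℤ × ℤ → ℂ} (h : OO a) (m : ℕ) : OO (Fc m a) :=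
  OO.of_fun ((h.rd.Gc_iter m).const_mul _) (g := fun x y => fr m (uu a x y))
    (fun x y => Fs_Fc h.rd m x y (h.eq x y))
    (fun x y => by rw [h.odd_x, fr_neg]) (fun x y => by rw [h.odd_y, fr_neg])

lemma uu_Fc {a : ℤ × ℤ → ℂ} (h : OO a) (m : ℕ) (x y : ℝ) : uu (Fc m a) x y = fr m (uu a x y) := by
  unfold uu; rw [Fs_Fc h.rd m x y (h.eq x y)]; simp; rfl

lemma uu_dx {a : ℤ × ℤ → ℂ} (h : RDs a) (x y : ℝ) : HasDerivAt (fun x' => uu a x' y) (uu (dX a) x y) x :=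
  Complex.reCLM.hasFDerivAt.comp_hasDerivAt x (Fs_hasDerivAt_x h x y)
lemma uu_dy {a : ℤ × ℤ → ℂ} (h : RDs a) (x y : ℝ) : HasDerivAt (fun y' => uu a x y') (uu (dY a) x y) y :=
  Complex.reCLM.hasFDerivAt.comp_hasDerivAt y (Fs_hasDerivAt_y h x y)
lemma uu_cont {a : ℤ × ℤ → ℂ} (h : RDs a) : Continuous (fun p : ℝ × ℝ => uu a p.1 p.2) :=
  Complex.continuous_re.comp (Fs_continuous h.summable0)
lemma uu_sub {a b : ℤ × ℤ → ℂ} (ha : RDs a) (hb : RDs b) (x y : ℝ) :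
    uu (fun k => a k - b k) x y = uu a x y - uu b x y := by
  unfold uu; rw [Fs_sub ha.summable0 hb.summable0]; simp
lemma uu_add {a b : ℤ × ℤ → ℂ} (ha : RDs a) (hb : RDs b) (x y : ℝ) :
    uu (fun k => a k + b k) x y = uu a x y + uu b x y := by
  unfold uu; rw [Fs_add ha.summable0 hb.summable0]; simp
lemma uu_neg (a : ℤ × ℤ → ℂ) (x y : ℝ) : uu (fun k => - a k) x y = - uu a x y := by
  have := Fs_const_mul a (-1) x y
  simp only [neg_one_mul] at this
  unfold uu; rw [this]; simp
lemma uu_per_x (a : ℤ × ℤ → ℂ) (x y : ℝ) : uu a (x + 2 * π) y = uu a x y := by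
  unfold uu; rw [Fs_period_x]
lemma uu_per_y (a : ℤ × ℤ → ℂ) (x y : ℝ) : uu a x (y + 2 * π) = uu a x y := by
  unfold uu; rw [Fs_period_y]

lemma uu_laplace {a : ℤ × ℤ → ℂ} (h : RDs a) (h0 : a 0 = 0) (x y : ℝ) :
    uu (dX (dX (iL a))) x y + uu (dY (dY (iL a))) x y = uu a x y := by
  rw [← uu_add h.iL.dX.dX h.iL.dY.dY]
  congr 1; ext k; exact iL_laplace a h0 k

/-- vanishing on the boundary of the quarter cell -/
lemma OO.bd_x0 {a : ℤ × ℤ → ℂ} (h : OO a) (y : ℝ) : uu a 0 y = 0 := by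
  have := h.odd_x 0 y; rw [neg_zero] at this; linarith
lemma OO.bd_y0 {a : ℤ × ℤ → ℂ} (h : OO a) (x : ℝ) : uu a x 0 = 0 := by
  have := h.odd_y x 0; rw [neg_zero] at this; linarith
lemma OO.bd_xp {a : ℤ × ℤ → ℂ} (h : OO a) (y : ℝ) : uu a π y = 0 := by
  have := h.odd_x π y
  have h2 := uu_per_x a (-π) y
  rw [show -π + 2 * π = π by ring] at h2
  linarith
lemma OO.bd_yp {a : ℤ × ℤ → ℂ} (h : OO a) (x : ℝ) : uu a x π = 0 := by
  have := h.odd_y x π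
  have h2 := uu_per_y a x (-π)
  rw [show -π + 2 * π = π by ring] at h2
  linarith

lemma fold_period {g : ℝ → ℝ} (ho : ∀ x, g (-x) = - g x) (hp : ∀ x, g (x + 2 * π) = g x) (x : ℝ) :
    ∃ x' ∈ Icc 0 π, |g x| = |g x'| := by
  have hp' : Function.Periodic g (2 * π) := hp
  obtain ⟨z, hz, hgz⟩ := hp'.exists_mem_Ico (by positivity) x (-π)
  rw [hgz]
  rcases le_total 0 z with h | h
  · exact ⟨z, ⟨h, by have := hz.2; linarith⟩, rfl⟩
  · exact ⟨-z, ⟨by linarith, by have := hz.1; linarith⟩, by rw [ho, abs_neg]⟩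

lemma OO.bound {a : ℤ × ℤ → ℂ} (h : OO a) {C : ℝ}
    (hC : ∀ x ∈ Icc 0 π, ∀ y ∈ Icc 0 π, |uu a x y| ≤ C) (x y : ℝ) : |uu a x y| ≤ C := by
  obtain ⟨x', hx', e⟩ := fold_period (g := fun x => uu a x y) (fun x => h.odd_x x y) (fun x => uu_per_x a x y) x
  obtain ⟨y', hy', e'⟩ := fold_period (g := fun y => uu a x' y) (fun y => h.odd_y x' y) (fun y => uu_per_y a x' y) y
  rw [e, e']; exact hC x' hx' y' hy'

/-- Parseval bound -/
lemma parseval {a : ℤ × ℤ → ℂ} (h : OO a) {C : ℝ} (hC : ∀ x y, |uu a x y| ≤ C) :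
    Summable (fun k => ‖a k‖ ^ 2) ∧ ∑' k, ‖a k‖ ^ 2 ≤ C ^ 2 := by
  have e : ∀ m, a m * a (0 - m) = ((‖a m‖ ^ 2 : ℝ) : ℂ) := fun m => by
    rw [zero_sub, ← h.re, Complex.mul_conj, Complex.normSq_eq_norm_sq]
  have hsum : Summable (fun k => ‖a k‖ ^ 2) := by
    refine (h.rd.summable0.mul_left (NN 0 a)).of_nonneg_of_le (fun k => sq_nonneg _) fun k => ?_
    have := le_NN (r := 0) h.rd k
    rw [pow_zero, mul_one] at this
    rw [sq]; gcongr
  refine ⟨hsum, ?_⟩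
  have h1 := integral_Fs (h.rd.cv h.rd).summable0
  have h2 : cv a a 0 = ((∑' k, ‖a k‖ ^ 2 : ℝ) : ℂ) := by
    unfold cv; rw [Complex.ofReal_tsum]; congr 1; ext m; exact e m
  have h3 : ‖∫ x in (0:ℝ)..(2 * π), ∫ y in (0:ℝ)..(2 * π), Fs (cv a a) x y‖ ≤ (C ^ 2 * |2 * π - 0|) * |2 * π - 0| := by
    refine intervalIntegral.norm_integral_le_of_norm_le_const fun x _ => ?_
    refine intervalIntegral.norm_integral_le_of_norm_le_const fun y _ => ?_
    rw [Fs_cv h.rd.summable0 h.rd.summable0, h.eq, norm_mul, Complex.norm_real, Real.norm_eq_abs, sq]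
    have := hC x y
    exact mul_le_mul this this (abs_nonneg _) ((abs_nonneg _).trans this)
  rw [h1, h2, norm_mul, Complex.norm_real, Real.norm_eq_abs, abs_of_nonneg (tsum_nonneg fun k => sq_nonneg _)] at h3
  have hpi := Real.pi_pos
  have : ‖(2 * π : ℂ) ^ 2‖ = (2 * π) ^ 2 := by
    rw [norm_pow]; simp [abs_of_pos hpi]
  rw [this, sub_zero, abs_of_pos (by positivity)] at h3
  have h4 : (2 * π) ^ 2 * ∑' k, ‖a k‖ ^ 2 ≤ (2 * π) ^ 2 * C ^ 2 := by linarith [h3]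
  exact le_of_mul_le_mul_left h4 (by positivity)

/-! ### Maximum principle on the quarter cell -/

lemma second_deriv_min {g g' : ℝ → ℝ} {d x0 a b : ℝ} (hx : x0 ∈ Ioo a b)
    (h1 : ∀ x ∈ Ioo a b, HasDerivAt g (g' x) x) (h2 : HasDerivAt g' d x0)
    (hmin : ∀ x ∈ Ioo a b, g x0 ≤ g x) : 0 ≤ d := by
  by_contra hd
  push Not at hd
  have hloc : IsLocalMin g x0 := by
    filter_upwards [Ioo_mem_nhds hx.1 hx.2] with x hx using hmin x hx
  have h0 : g' x0 = 0 := hloc.hasDerivAt_eq_zero (h1 x0 hx)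
  have hev : ∀ᶠ x in nhds x0, HasDerivAt g (g' x) x := by
    filter_upwards [Ioo_mem_nhds hx.1 hx.2] with x hx using h1 x hx
  -- derivative negative just to the right
  have hlo := hasDerivAt_iff_isLittleO.1 h2
  have hb := hlo.def (c := -d / 2) (by linarith)
  obtain ⟨δ, hδ, hball⟩ := Metric.eventually_nhds_iff.1 (hb.and (Ioo_mem_nhds hx.1 hx.2))
  have hneg : ∀ x, x0 < x → x < x0 + δ → g' x < 0 := by
    intro x hx1 hx2
    have := (hball (y := x) (by rw [Real.dist_eq, abs_of_pos (by linarith)]; linarith)).1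
    rw [h0, sub_zero, Real.norm_eq_abs, Real.norm_eq_abs, abs_of_pos (sub_pos.2 hx1), smul_eq_mul] at this
    have := (abs_le.1 this).2
    nlinarith
  have hin : ∀ x, x0 ≤ x → x < x0 + δ → x ∈ Ioo a b := fun x hx1 hx2 =>
    (hball (y := x) (by rw [Real.dist_eq, abs_of_nonneg (by linarith)]; linarith)).2
  obtain ⟨c, hc, hce⟩ := exists_hasDerivAt_eq_slope g g' (a := x0) (b := x0 + δ/2) (by linarith)
    (fun x hx => (h1 x (hin x hx.1 (by linarith [hx.2]))).continuousAt.continuousWithinAt)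
    (fun x hx => h1 x (hin x hx.1.le (by linarith [hx.2])))
  have hn := hneg c hc.1 (by linarith [hc.2])
  have hm := hmin (x0 + δ/2) (hin _ (by linarith) (by linarith))
  rw [hce] at hn
  have : 0 ≤ (g (x0 + δ/2) - g x0) / (x0 + δ/2 - x0) := div_nonneg (by linarith) (by linarith)
  linarith

lemma max_principle {w wx wy wxx wyy : ℝ → ℝ → ℝ} (hc : Continuous (fun p : ℝ × ℝ => w p.1 p.2))
    (hx : ∀ x y, HasDerivAt (fun x' => w x' y) (wx x y) x)
    (hxx : ∀ x y, HasDerivAt (fun x' => wx x' y) (wxx x y) x)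
    (hy : ∀ x y, HasDerivAt (fun y' => w x y') (wy x y) y)
    (hyy : ∀ x y, HasDerivAt (fun y' => wy x y') (wyy x y) y)
    (hL : ∀ x ∈ Icc 0 π, ∀ y ∈ Icc 0 π, wxx x y + wyy x y ≤ 0)
    (hb : ∀ x ∈ Icc 0 π, ∀ y ∈ Icc 0 π, (x = 0 ∨ x = π ∨ y = 0 ∨ y = π) → 0 ≤ w x y) :
    ∀ x ∈ Icc 0 π, ∀ y ∈ Icc 0 π, 0 ≤ w x y := by
  have hpi := Real.pi_pos
  -- perturbed version
  have key : ∀ ε > 0, ∀ x ∈ Icc 0 π, ∀ y ∈ Icc 0 π, -(ε * π ^ 2) ≤ w x y - ε * x ^ 2 := by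
    intro ε hε
    have hcp : IsCompact (Icc (0:ℝ) π ×ˢ Icc (0:ℝ) π) := isCompact_Icc.prod isCompact_Icc
    have hcv : ContinuousOn (fun p : ℝ × ℝ => w p.1 p.2 - ε * p.1 ^ 2) (Icc (0:ℝ) π ×ˢ Icc (0:ℝ) π) :=
      (hc.sub (by fun_prop)).continuousOn
    obtain ⟨⟨x0, y0⟩, ⟨hx0, hy0⟩, hmin⟩ := hcp.exists_isMinOn ⟨(0,0), by simp [hpi.le]⟩ hcv
    have hmin' : ∀ x ∈ Icc 0 π, ∀ y ∈ Icc 0 π, w x0 y0 - ε * x0 ^ 2 ≤ w x y - ε * x ^ 2 :=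
      fun x hx y hy => hmin (show (x, y) ∈ _ from ⟨hx, hy⟩)
    simp only at hx0 hy0
    suffices -(ε * π ^ 2) ≤ w x0 y0 - ε * x0 ^ 2 from fun x hx y hy => this.trans (hmin' x hx y hy)
    by_cases hbd : x0 = 0 ∨ x0 = π ∨ y0 = 0 ∨ y0 = π
    · have h1 := hb x0 hx0 y0 hy0 hbd
      have : ε * x0 ^ 2 ≤ ε * π ^ 2 := by
        have := hx0.1; have := hx0.2; gcongr
      linarith
    · push Not at hbd
      obtain ⟨b1, b2, b3, b4⟩ := hbd
      have hxi : x0 ∈ Ioo 0 π := ⟨lt_of_le_of_ne hx0.1 (Ne.symm b1), lt_of_le_of_ne hx0.2 b2⟩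
      have hyi : y0 ∈ Ioo 0 π := ⟨lt_of_le_of_ne hy0.1 (Ne.symm b3), lt_of_le_of_ne hy0.2 b4⟩
      have d1 := second_deriv_min (g := fun x => w x y0 - ε * x ^ 2) (g' := fun x => wx x y0 - ε * (2 * x))
        (d := wxx x0 y0 - ε * 2) hxi
        (fun x _ => (hx x y0).sub (by simpa using (hasDerivAt_pow 2 x).const_mul ε))
        ((hxx x0 y0).sub (by simpa using ((hasDerivAt_id x0).const_mul 2).const_mul ε))
        (fun x hx => hmin' x (Ioo_subset_Icc_self hx) y0 hy0)
      have d2 := second_deriv_min (g := fun y => w x0 y - ε * x0 ^ 2) (g' := fun y => wy x0 y)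
        (d := wyy x0 y0) hyi
        (fun y _ => (hy x0 y).sub_const _) (hyy x0 y0)
        (fun y hy => hmin' x0 hx0 y (Ioo_subset_Icc_self hy))
      have := hL x0 hx0 y0 hy0
      linarith
  intro x hx y hy
  refine le_of_forall_pos_le_add fun δ hδ => ?_
  have := key (δ / π ^ 2) (by positivity) x hx y hy
  have h1 : δ / π ^ 2 * π ^ 2 = δ := by field_simp
  have h2 : 0 ≤ δ / π ^ 2 * x ^ 2 := by positivity
  linarith

/-! ### Trigonometric polynomials -/

/-- representable functions -/
def Rp (g : ℝ → ℝ → ℝ) : Prop := ∃ a, RDs a ∧ ∀ x y, Fs a x y = g x y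

lemma Fs_fin {a : ℤ × ℤ → ℂ} (S : Finset (ℤ × ℤ)) (h : ∀ k ∉ S, a k = 0) (x y : ℝ) :
    Fs a x y = ∑ k ∈ S, a k * ee k x y :=
  tsum_eq_sum fun k hk => by rw [h k hk, zero_mul]

lemma Rp.add {f g : ℝ → ℝ → ℝ} (hf : Rp f) (hg : Rp g) : Rp (fun x y => f x y + g x y) := by
  obtain ⟨a, ha, ha'⟩ := hf
  obtain ⟨b, hb, hb'⟩ := hg
  exact ⟨_, ha.add hb, fun x y => by rw [Fs_add ha.summable0 hb.summable0, ha', hb']; push_cast; rfl⟩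

lemma Rp.mul {f g : ℝ → ℝ → ℝ} (hf : Rp f) (hg : Rp g) : Rp (fun x y => f x y * g x y) := by
  obtain ⟨a, ha, ha'⟩ := hf
  obtain ⟨b, hb, hb'⟩ := hg
  exact ⟨_, ha.cv hb, fun x y => by rw [Fs_cv ha.summable0 hb.summable0, ha', hb']; push_cast; rfl⟩

lemma Rp_const (c : ℝ) : Rp (fun _ _ => c) := by
  refine ⟨fun k => if k = 0 then (c : ℂ) else 0, RDs_of_support {0} (fun k hk => by simp only [Finset.mem_singleton] at hk; simp only [hk, if_false]), fun x y => ?_⟩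
  rw [Fs_fin {0} (fun k hk => by simp only [Finset.mem_singleton] at hk; simp only [hk, if_false])]; simp [ee_zero]

lemma Rp_sin_x : Rp (fun x _ => Real.sin x) := by
  refine ⟨fun k => if k = (1, 0) then -Complex.I / 2 else if k = (-1, 0) then Complex.I / 2 else 0,
    RDs_of_support {(1, 0), (-1, 0)} (fun k hk => by simp only [Finset.mem_insert, Finset.mem_singleton, not_or] at hk; simp only [hk.1, hk.2, if_false]), fun x y => ?_⟩
  rw [Fs_fin {(1, 0), (-1, 0)} (fun k hk => by simp only [Finset.mem_insert, Finset.mem_singleton, not_or] at hk; simp only [hk.1, hk.2, if_false]), Finset.sum_pair (by decide)]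
  simp [ee, Complex.sin]
  ring_nf

lemma Rp_sin_y : Rp (fun _ y => Real.sin y) := by
  refine ⟨fun k => if k = (0, 1) then -Complex.I / 2 else if k = (0, -1) then Complex.I / 2 else 0,
    RDs_of_support {(0, 1), (0, -1)} (fun k hk => by simp only [Finset.mem_insert, Finset.mem_singleton, not_or] at hk; simp only [hk.1, hk.2, if_false]), fun x y => ?_⟩
  rw [Fs_fin {(0, 1), (0, -1)} (fun k hk => by simp only [Finset.mem_insert, Finset.mem_singleton, not_or] at hk; simp only [hk.1, hk.2, if_false]), Finset.sum_pair (by decide)]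
  simp [ee, Complex.sin]
  ring_nf

lemma Rp.pow {f : ℝ → ℝ → ℝ} (hf : Rp f) (n : ℕ) : Rp (fun x y => f x y ^ n) := by
  induction n with
  | zero => simpa using Rp_const 1
  | succ n ih => simp only [pow_succ]; exact ih.mul hf

lemma Rp.sum {f : ℕ → ℝ → ℝ → ℝ} (hf : ∀ n, Rp (f n)) (N : ℕ) :
    Rp (fun x y => ∑ n ∈ Finset.range N, f n x y) := by
  induction N with
  | zero => simpa using Rp_const 0
  | succ n ih => simp only [Finset.sum_range_succ]; exact ih.add (hf n)

/-! ### The subsolution -/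

/-- truncated logarithm -/
noncomputable def hh (N : ℕ) (q : ℝ) : ℝ := 1 + ∑ n ∈ Finset.range N, (1 / ((n : ℝ) + 1)) * (1 - q) ^ (n + 1)
/-- its derivative -/
noncomputable def hh1 (N : ℕ) (q : ℝ) : ℝ := ∑ n ∈ Finset.range N, -(1 - q) ^ n
/-- its second derivative -/
noncomputable def hh2 (N : ℕ) (q : ℝ) : ℝ := ∑ n ∈ Finset.range N, (n : ℝ) * (1 - q) ^ (n - 1)

lemma hh_deriv (N : ℕ) (q : ℝ) : HasDerivAt (hh N) (hh1 N q) q := by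
  unfold hh hh1
  have h1 : HasDerivAt (fun q : ℝ => 1 - q) (-1) q := by simpa using (hasDerivAt_id q).const_sub 1
  refine HasDerivAt.const_add 1 (HasDerivAt.fun_sum fun n _ => ?_)
  have := ((h1.pow (n + 1)).const_mul (1 / ((n : ℝ) + 1)))
  refine this.congr_deriv ?_
  have : (n : ℝ) + 1 ≠ 0 := by positivity
  push_cast; simp; field_simp

lemma hh1_deriv (N : ℕ) (q : ℝ) : HasDerivAt (hh1 N) (hh2 N q) q := by
  unfold hh1 hh2
  have h1 : HasDerivAt (fun q : ℝ => 1 - q) (-1) q := by simpa using (hasDerivAt_id q).const_sub 1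
  refine HasDerivAt.fun_sum fun n _ => ?_
  refine (h1.pow n).neg.congr_deriv ?_
  ring

lemma hh_ge (N : ℕ) {q : ℝ} (h1 : q ≤ 1) : 1 ≤ hh N q := by
  unfold hh
  have : 0 ≤ ∑ n ∈ Finset.range N, (1 / ((n : ℝ) + 1)) * (1 - q) ^ (n + 1) :=
    Finset.sum_nonneg fun n _ => by have : 0 ≤ 1 - q := by linarith
                                    positivity
  linarith

lemma hh1_nonpos (N : ℕ) {q : ℝ} (h1 : q ≤ 1) : hh1 N q ≤ 0 :=
  Finset.sum_nonpos fun n _ => by have : 0 ≤ 1 - q := by linarith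
                                  have : 0 ≤ (1 - q) ^ n := by positivity
                                  linarith

lemma hh2_nonneg (N : ℕ) {q : ℝ} (h1 : q ≤ 1) : 0 ≤ hh2 N q :=
  Finset.sum_nonneg fun n _ => by have : 0 ≤ 1 - q := by linarith
                                  positivity

lemma hh1_ge (N : ℕ) {q : ℝ} (h0 : 0 ≤ q) (h1 : q ≤ 1) : -hh1 N q ≤ N := by
  unfold hh1
  rw [← Finset.sum_neg_distrib]
  calc _ ≤ ∑ n ∈ Finset.range N, (1:ℝ) := Finset.sum_le_sum fun n _ => by
        rw [neg_neg]; exact pow_le_one₀ (by linarith) (by linarith)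
    _ = N := by simp

lemma q_hh1 (N : ℕ) {q : ℝ} (h1 : q ≤ 1) : q * (-hh1 N q) ≤ 1 := by
  have : q * (-hh1 N q) = 1 - (1 - q) ^ N := by
    unfold hh1
    rw [Finset.sum_neg_distrib, neg_neg]
    have := geom_sum_mul (1 - q) N
    linarith
  rw [this]
  have : 0 ≤ (1 - q) ^ N := pow_nonneg (by linarith) _
  linarith

lemma q_hh (N : ℕ) {q : ℝ} (h0 : 0 ≤ q) (h1 : q ≤ 1) : q * hh N q ≤ 2 := by
  have : hh N q ≤ 1 + -hh1 N q := by
    unfold hh hh1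
    rw [Finset.sum_neg_distrib, neg_neg]
    gcongr with n _
    have h3 : 0 ≤ 1 - q := by linarith
    calc 1 / ((n : ℝ) + 1) * (1 - q) ^ (n + 1) ≤ 1 * (1 - q) ^ n := by
          refine mul_le_mul ?_ ?_ (by positivity) zero_le_one
          · rw [div_le_one (by positivity)]; linarith [Nat.cast_nonneg (α := ℝ) n]
          · exact pow_le_pow_of_le_one h3 (by linarith) (Nat.le_succ n)
      _ = _ := one_mul _
  calc q * hh N q ≤ q * (1 + -hh1 N q) := by gcongr
    _ = q + q * (-hh1 N q) := by ring
    _ ≤ _ := by linarith [q_hh1 N h1]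

/-- the argument of the truncated logarithm -/
noncomputable def qq (x y : ℝ) : ℝ := (Real.sin x ^ 2 + Real.sin y ^ 2) / 2
/-- the subsolution -/
noncomputable def sub0 (N : ℕ) (x y : ℝ) : ℝ := 1/40 * (Real.sin x * Real.sin y * hh N (qq x y))
/-- its `x` derivative -/
noncomputable def sub0x (N : ℕ) (x y : ℝ) : ℝ :=
  1/40 * (Real.cos x * Real.sin y * hh N (qq x y)
    + Real.sin x * Real.sin y * (hh1 N (qq x y) * (Real.sin x * Real.cos x)))
/-- its second `x` derivative -/
noncomputable def sub0xx (N : ℕ) (x y : ℝ) : ℝ :=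
  1/40 * (-Real.sin x * Real.sin y * hh N (qq x y)
    + Real.cos x * Real.sin y * (hh1 N (qq x y) * (Real.sin x * Real.cos x))
    + (Real.sin y * (2 * Real.sin x * Real.cos x * Real.cos x - Real.sin x ^ 2 * Real.sin x) * hh1 N (qq x y)
      + Real.sin x ^ 2 * Real.cos x * Real.sin y * (hh2 N (qq x y) * (Real.sin x * Real.cos x))))

lemma qq_symm (x y : ℝ) : qq x y = qq y x := by unfold qq; ring
lemma sub0_symm (N : ℕ) (x y : ℝ) : sub0 N x y = sub0 N y x := by
  unfold sub0; rw [qq_symm]; ring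

lemma qq_dx (x y : ℝ) : HasDerivAt (fun x => qq x y) (Real.sin x * Real.cos x) x := by
  unfold qq
  refine ((((Real.hasDerivAt_sin x).pow 2).add_const (Real.sin y ^ 2)).div_const 2).congr_deriv ?_
  push_cast; ring

lemma sub0_dx (N : ℕ) (x y : ℝ) : HasDerivAt (fun x => sub0 N x y) (sub0x N x y) x := by
  have h := ((Real.hasDerivAt_sin x).mul_const (Real.sin y)).mul ((hh_deriv N (qq x y)).comp x (qq_dx x y))
  exact (h.const_mul (1/40))

lemma sub0x_dx (N : ℕ) (x y : ℝ) : HasDerivAt (fun x => sub0x N x y) (sub0xx N x y) x := by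
  have h1 := ((Real.hasDerivAt_cos x).mul_const (Real.sin y)).mul ((hh_deriv N (qq x y)).comp x (qq_dx x y))
  have h2 := (((Real.hasDerivAt_sin x).mul_const (Real.sin y)).mul
    (((hh1_deriv N (qq x y)).comp x (qq_dx x y)).mul ((Real.hasDerivAt_sin x).mul (Real.hasDerivAt_cos x))))
  refine ((h1.add h2).const_mul (1/40)).congr_deriv ?_
  unfold sub0xx
  simp only [Function.comp, Pi.mul_apply]
  ring

lemma sub0_rep (N : ℕ) : Rp (sub0 N) := by
  have hq : Rp qq := by
    have := ((Rp_sin_x.pow 2).add (Rp_sin_y.pow 2)).mul (Rp_const (1/2))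
    convert this using 3; unfold qq; ring
  have hq1 : Rp (fun x y => 1 - qq x y) := by
    have := (Rp_const 1).add ((Rp_const (-1)).mul hq)
    convert this using 3; ring
  have hH : Rp (fun x y => hh N (qq x y)) := by
    unfold hh
    exact (Rp_const 1).add (Rp.sum (fun n => (Rp_const _).mul (hq1.pow (n + 1))) N)
  exact (Rp_const (1/40)).mul ((Rp_sin_x.mul Rp_sin_y).mul hH)

lemma sub0_lap (N : ℕ) {x y : ℝ} (hx : x ∈ Icc 0 π) (hy : y ∈ Icc 0 π) :
    -(sub0xx N x y + sub0xx N y x) ≤ 1/4 ∧ -(sub0xx N x y + sub0xx N y x) ≤ (2 + 6 * N) * sub0 N x y ∧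
    0 ≤ sub0 N x y ∧ sub0 N x y ≤ 1 := by
  have sx := Real.sin_nonneg_of_mem_Icc hx
  have sy := Real.sin_nonneg_of_mem_Icc hy
  have px := Real.sin_sq_add_cos_sq x
  have py := Real.sin_sq_add_cos_sq y
  unfold sub0xx sub0
  rw [qq_symm y x]
  set a := Real.sin x
  set b := Real.sin y
  set c := Real.cos x
  set d := Real.cos y
  have hqd : qq x y = (a ^ 2 + b ^ 2) / 2 := rfl
  have hq0 : 0 ≤ qq x y := by rw [hqd]; positivity
  have hq1 : qq x y ≤ 1 := by rw [hqd]; nlinarith [sq_nonneg c, sq_nonneg d]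
  set q := qq x y
  have e1 := hh_ge N hq1
  have e2 := hh1_nonpos N hq1
  have e3 := hh2_nonneg N hq1
  have e4 := hh1_ge N hq0 hq1
  have e5 := q_hh1 N hq1
  have e6 := q_hh N hq0 hq1
  set h := hh N q
  set h1 := hh1 N q
  set h2 := hh2 N q
  have hS0 : 0 ≤ a * b := mul_nonneg sx sy
  have hSq : a * b ≤ q := by rw [hqd]; nlinarith [sq_nonneg (a - b)]
  have hc2 : c ^ 2 = 1 - a ^ 2 := by linarith
  have hd2 : d ^ 2 = 1 - b ^ 2 := by linarith
  have main : -(1/40 * (-a * b * h + c * b * (h1 * (a * c)) + (b * (2 * a * c * c - a ^ 2 * a) * h1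
      + a ^ 2 * c * b * (h2 * (a * c)))) + 1/40 * (-b * a * h + d * a * (h1 * (b * d)) + (a * (2 * b * d * d - b ^ 2 * b) * h1
      + b ^ 2 * d * a * (h2 * (b * d))))) = 1/40 * (a * b * (2 * h - h1 * (6 - 8 * q)
        - h2 * (a ^ 2 * c ^ 2 + b ^ 2 * d ^ 2))) := by
    rw [hqd]
    linear_combination (-(1/40) * 3 * a * b * h1) * hc2 + (-(1/40) * 3 * a * b * h1) * hd2
  rw [main]
  have b1 : a * b * (2 * h - h1 * (6 - 8 * q) - h2 * (a ^ 2 * c ^ 2 + b ^ 2 * d ^ 2)) ≤ a * b * (2 * h + 6 * (-h1)) := by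
    refine mul_le_mul_of_nonneg_left ?_ hS0
    have : 0 ≤ h2 * (a ^ 2 * c ^ 2 + b ^ 2 * d ^ 2) := by positivity
    have : 0 ≤ -h1 * q := mul_nonneg (by linarith) hq0
    linarith
  have b2 : a * b * (2 * h + 6 * (-h1)) ≤ q * (2 * h + 6 * (-h1)) :=
    mul_le_mul_of_nonneg_right hSq (by linarith)
  have b3 : a * b * (2 * h + 6 * (-h1)) ≤ a * b * ((2 + 6 * N) * h) := by
    refine mul_le_mul_of_nonneg_left ?_ hS0
    have : (N : ℝ) ≤ N * h := le_mul_of_one_le_right (Nat.cast_nonneg N) e1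
    linarith
  have b4 : a * b * h ≤ q * h := mul_le_mul_of_nonneg_right hSq (by linarith)
  refine ⟨by linarith, by linarith, by positivity, by linarith⟩

lemma sub0_xy (N : ℕ) : HasDerivAt (fun y => sub0x N 0 y) (1/40 * hh N 0) 0 := by
  have e : (fun y => sub0x N 0 y) = fun y => 1/40 * (Real.sin y * hh N (qq y 0)) := by
    ext y; unfold sub0x; rw [qq_symm]; simp
  rw [e]
  have h2 : HasDerivAt (fun y => hh N (qq y 0)) (hh1 N (qq 0 0) * (Real.sin 0 * Real.cos 0)) 0 :=
    HasDerivAt.comp (h := fun y => qq y 0) 0 (hh_deriv N (qq 0 0)) (qq_dx 0 0)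
  have h := ((Real.hasDerivAt_sin 0).mul h2).const_mul (1/40)
  refine h.congr_deriv ?_
  simp [qq]

lemma hh_zero (N : ℕ) : hh N 0 = 1 + ∑ n ∈ Finset.range N, 1 / ((n : ℝ) + 1) := by
  unfold hh; simp

/-! ### The monotone iteration -/

/-- one step of the monotone iteration -/
noncomputable def st (m : ℕ) (a : ℤ × ℤ → ℂ) : ℤ × ℤ → ℂ := iL (fun k => -(Fc m a k))

lemma OO.st {a : ℤ × ℤ → ℂ} (h : OO a) (m : ℕ) : OO (st m a) := ((h.Fc m).neg).iL

lemma st_lap {a : ℤ × ℤ → ℂ} (h : OO a) (m : ℕ) (x y : ℝ) :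
    uu (dX (dX (st m a))) x y + uu (dY (dY (st m a))) x y = - fr m (uu a x y) := by
  unfold st
  rw [uu_laplace (h.Fc m).neg.rd (h.Fc m).neg.zero, uu_neg, uu_Fc h]

lemma lap_compare {a b : ℤ × ℤ → ℂ} (ha : OO a) (hb : OO b)
    (h : ∀ x ∈ Icc 0 π, ∀ y ∈ Icc 0 π, uu (dX (dX b)) x y + uu (dY (dY b)) x y ≤
      uu (dX (dX a)) x y + uu (dY (dY a)) x y) :
    ∀ x ∈ Icc 0 π, ∀ y ∈ Icc 0 π, uu a x y ≤ uu b x y := by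
  have := max_principle (w := fun x y => uu b x y - uu a x y)
    (wx := fun x y => uu (dX b) x y - uu (dX a) x y) (wy := fun x y => uu (dY b) x y - uu (dY a) x y)
    (wxx := fun x y => uu (dX (dX b)) x y - uu (dX (dX a)) x y)
    (wyy := fun x y => uu (dY (dY b)) x y - uu (dY (dY a)) x y)
    ((uu_cont hb.rd).sub (uu_cont ha.rd))
    (fun x y => (uu_dx hb.rd x y).sub (uu_dx ha.rd x y))
    (fun x y => (uu_dx hb.rd.dX x y).sub (uu_dx ha.rd.dX x y))
    (fun x y => (uu_dy hb.rd x y).sub (uu_dy ha.rd x y))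
    (fun x y => (uu_dy hb.rd.dY x y).sub (uu_dy ha.rd.dY x y))
    (fun x hx y hy => by have := h x hx y hy; linarith)
    (by
      rintro x hx y hy (rfl | rfl | rfl | rfl)
      · simp [ha.bd_x0, hb.bd_x0]
      · simp [ha.bd_xp, hb.bd_xp]
      · simp [ha.bd_y0, hb.bd_y0]
      · simp [ha.bd_yp, hb.bd_yp])
  intro x hx y hy
  have := this x hx y hy
  linarith

lemma lap_upper {a : ℤ × ℤ → ℂ} (ha : OO a)
    (h : ∀ x ∈ Icc 0 π, ∀ y ∈ Icc 0 π, -(1/2) ≤ uu (dX (dX a)) x y + uu (dY (dY a)) x y) :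
    ∀ x ∈ Icc 0 π, ∀ y ∈ Icc 0 π, uu a x y ≤ 1 := by
  have hd : ∀ x : ℝ, HasDerivAt (fun x : ℝ => x * (π - x) / 4) ((π - 2 * x) / 4) x := fun x => by
    refine (((hasDerivAt_id x).mul ((hasDerivAt_id x).const_sub π)).div_const 4).congr_deriv ?_
    simp; ring
  have hd2 : ∀ x : ℝ, HasDerivAt (fun x : ℝ => (π - 2 * x) / 4) (-(1/2)) x := fun x => by
    refine ((((hasDerivAt_id x).const_mul 2).const_sub π).div_const 4).congr_deriv ?_
    norm_num
  have hq : ∀ x ∈ Icc 0 π, 0 ≤ x * (π - x) / 4 := fun x hx => by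
    have := hx.1; have : 0 ≤ π - x := by linarith [hx.2]
    positivity
  have := max_principle (w := fun x y => x * (π - x) / 4 - uu a x y)
    (wx := fun x y => (π - 2 * x) / 4 - uu (dX a) x y) (wy := fun x y => 0 - uu (dY a) x y)
    (wxx := fun x y => -(1/2) - uu (dX (dX a)) x y)
    (wyy := fun x y => 0 - uu (dY (dY a)) x y)
    (Continuous.sub (by fun_prop) (uu_cont ha.rd))
    (fun x y => (hd x).sub (uu_dx ha.rd x y))
    (fun x y => (hd2 x).sub (uu_dx ha.rd.dX x y))
    (fun x y => (hasDerivAt_const y _).sub (uu_dy ha.rd x y))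
    (fun x y => (hasDerivAt_const y _).sub (uu_dy ha.rd.dY x y))
    (fun x hx y hy => by have := h x hx y hy; linarith)
    (by
      intro x hx y hy hh
      have : uu a x y = 0 := by
        rcases hh with rfl | rfl | rfl | rfl
        · exact ha.bd_x0 _
        · exact ha.bd_xp _
        · exact ha.bd_y0 _
        · exact ha.bd_yp _
      simp only [this]; linarith [hq x hx])
  intro x hx y hy
  have := this x hx y hy
  have h4 := Real.pi_lt_four
  have h0 := Real.pi_pos
  nlinarith [sq_nonneg (x - π / 2)]

/-- the monotone iteration -/
noncomputable def itr (m : ℕ) (a : ℤ × ℤ → ℂ) (n : ℕ) : ℤ × ℤ → ℂ := (st m)^[n] a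

lemma itr_succ (m : ℕ) (a : ℤ × ℤ → ℂ) (n : ℕ) : itr m a (n + 1) = st m (itr m a n) :=
  Function.iterate_succ_apply' _ _ _

lemma OO.itr {a : ℤ × ℤ → ℂ} (h : OO a) (m n : ℕ) : OO (itr m a n) := by
  induction n with
  | zero => exact h
  | succ n ih => rw [itr_succ]; exact ih.st m

lemma itr_mono {a : ℤ × ℤ → ℂ} (h : OO a) (m : ℕ)
    (h1 : ∀ x ∈ Icc 0 π, ∀ y ∈ Icc 0 π, -(uu (dX (dX a)) x y + uu (dY (dY a)) x y) ≤ fr m (uu a x y))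
    (h2 : ∀ x ∈ Icc 0 π, ∀ y ∈ Icc 0 π, 0 ≤ uu a x y ∧ uu a x y ≤ 1) (n : ℕ) :
    ∀ x ∈ Icc 0 π, ∀ y ∈ Icc 0 π, (0 ≤ uu (itr m a n) x y ∧ uu (itr m a n) x y ≤ 1) ∧
      uu (itr m a n) x y ≤ uu (itr m a (n + 1)) x y := by
  induction n with
  | zero =>
    intro x hx y hy
    refine ⟨h2 x hx y hy, ?_⟩
    rw [itr_succ]
    refine lap_compare h (h.st m) (fun x hx y hy => ?_) x hx y hy
    rw [st_lap h]; linarith [h1 x hx y hy]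
  | succ n ih =>
    have up : ∀ x ∈ Icc 0 π, ∀ y ∈ Icc 0 π, uu (itr m a (n + 1)) x y ≤ 1 := by
      refine lap_upper (h.itr m _) fun x hx y hy => ?_
      rw [itr_succ, st_lap (h.itr m n)]
      have := (fr_mem m (ih x hx y hy).1.1 (ih x hx y hy).1.2).2
      linarith
    intro x hx y hy
    refine ⟨⟨(ih x hx y hy).1.1.trans (ih x hx y hy).2, up x hx y hy⟩, ?_⟩
    refine lap_compare (h.itr m _) (h.itr m _) (fun x hx y hy => ?_) x hx y hy
    rw [itr_succ m a (n + 1), st_lap (h.itr m _), itr_succ m a n, st_lap (h.itr m n), ← itr_succ]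
    have := fr_mono m (ih x hx y hy).1.1 (ih x hx y hy).2 (up x hx y hy)
    linarith

/-! ### Uniform bounds -/

lemma inv_sq2_wt (k : ℤ × ℤ) : 1 / sq2 k ≤ 8 / wt k ^ 2 := by
  by_cases hk : k = 0
  · have : sq2 k = 0 := by subst hk; simp [sq2]
    rw [this]; have := wt_pos k; simp; positivity
  · have h1 := one_le_nn hk
    have h2 := nn_sq_le k
    rw [div_le_div_iff₀ (sq2_pos hk) (by have := wt_pos k; positivity)]
    unfold wt; nlinarith

lemma norm_st (m : ℕ) (a : ℤ × ℤ → ℂ) (k : ℤ × ℤ) : ‖st m a k‖ ≤ 8 / wt k ^ 2 * ‖Fc m a k‖ := by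
  unfold st iL
  rw [norm_mul, norm_neg, Complex.norm_real, Real.norm_eq_abs, abs_neg,
    abs_of_nonneg (by have := sq2_nonneg k; positivity)]
  exact mul_le_mul_of_nonneg_right (inv_sq2_wt k) (norm_nonneg _)

lemma st_NN0 (m : ℕ) {a : ℤ × ℤ → ℂ} (h : OO a) (hb : ∀ x y, |uu a x y| ≤ 1) :
    NN 0 (st m a) ≤ 1/8 + 32 * cB := by
  obtain ⟨p1, p2⟩ := parseval (h.Fc m) (C := 1/2) (fun x y => by rw [uu_Fc h]; exact fr_abs m (hb x y))
  have key : ∀ k, ‖st m a k‖ * wt k ^ 0 ≤ 1/2 * ‖Fc m a k‖ ^ 2 + 32 * (1 / wt k ^ 3) := fun k => by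
    have h1 := norm_st m a k
    have hw := one_le_wt k
    have hp := wt_pos k
    have e1 : (1 / wt k ^ 2) ^ 2 ≤ 1 / wt k ^ 3 := by
      rw [div_pow, one_pow, ← pow_mul]
      exact one_div_le_one_div_of_le (by positivity) (pow_le_pow_right₀ hw (by norm_num))
    have e2 : 8 / wt k ^ 2 = 8 * (1 / wt k ^ 2) := by ring
    rw [e2] at h1
    rw [pow_zero, mul_one]
    nlinarith [sq_nonneg (‖Fc m a k‖ - 8 * (1 / wt k ^ 2))]
  unfold NN
  refine ((h.st m).rd.summable 0).tsum_le_tsum key ((p1.mul_left _).add (summable_wt_inv.mul_left _)) |>.trans ?_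
  rw [(p1.mul_left _).tsum_add (summable_wt_inv.mul_left _), tsum_mul_left, tsum_mul_left]
  unfold cB; linarith

lemma st_NN_succ (m r : ℕ) (A : ℝ) : ∃ B, ∀ a, OO a → NN r a ≤ A → NN (r + 1) (st m a) ≤ B := by
  obtain ⟨B, hB⟩ := NN_Gc_iter m r A
  refine ⟨8 * (1/2 * B), fun a ha h => ?_⟩
  have h1 : NN r (Fc m a) ≤ 1/2 * B := by
    unfold Fc; rw [NN_const_mul]
    have := hB a ha.rd h
    norm_num; linarith
  refine le_trans ?_ (mul_le_mul_of_nonneg_left h1 (by norm_num : (0:ℝ) ≤ 8))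
  unfold NN
  rw [← tsum_mul_left]
  refine ((ha.st m).rd.summable _).tsum_le_tsum (fun k => ?_) (((ha.Fc m).rd.summable r).mul_left _)
  have hw := one_le_wt k
  have hp := wt_pos k
  calc ‖st m a k‖ * wt k ^ (r + 1) ≤ (8 / wt k ^ 2 * ‖Fc m a k‖) * wt k ^ (r + 1) := by
        gcongr; exact norm_st m a k
    _ = (8 * (‖Fc m a k‖ * wt k ^ r)) * (1 / wt k) := by field_simp; ring
    _ ≤ (8 * (‖Fc m a k‖ * wt k ^ r)) * 1 := by
        gcongr; rw [div_le_one hp]; exact hw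
    _ = _ := mul_one _

lemma itr_NN {a : ℤ × ℤ → ℂ} (h : OO a) (m : ℕ) (hb : ∀ n x y, |uu (itr m a n) x y| ≤ 1) (r : ℕ) :
    ∃ C, ∀ n, NN r (itr m a n) ≤ C := by
  have red : (∃ C, ∀ n, NN r (st m (itr m a n)) ≤ C) → ∃ C, ∀ n, NN r (itr m a n) ≤ C := by
    rintro ⟨C, hC⟩
    refine ⟨max (NN r a) C, fun n => ?_⟩
    cases n with
    | zero => exact le_max_left _ _
    | succ n => rw [itr_succ]; exact (hC n).trans (le_max_right _ _)
  apply red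
  clear red
  induction r with
  | zero => exact ⟨_, fun n => st_NN0 m (h.itr m n) (hb n)⟩
  | succ r ih =>
    obtain ⟨C, hC⟩ := ih
    obtain ⟨B, hB⟩ := st_NN_succ m r (max (NN r a) C)
    refine ⟨B, fun n => hB _ (h.itr m n) ?_⟩
    cases n with
    | zero => exact le_max_left _ _
    | succ n => rw [itr_succ]; exact (hC n).trans (le_max_right _ _)

/-! ### Limits along ultrafilters -/

open Filter Topology in
lemma ulim (U : Ultrafilter ℕ) (s : ℕ → ℤ × ℤ → ℂ) (hs : ∀ n, OO (s n))
    (hC : ∀ r, ∃ C, ∀ n, NN r (s n) ≤ C) :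
    ∃ α, OO α ∧ (∀ k, Tendsto (fun n => s n k) U (𝓝 (α k))) ∧
      ∀ x y, Tendsto (fun n => uu (s n) x y) U (𝓝 (uu α x y)) := by
  have hC' : ∀ r, ∃ C, ∀ n k, ‖s n k‖ * wt k ^ r ≤ C := fun r => by
    obtain ⟨C, h⟩ := hC r
    exact ⟨C, fun n k => (le_NN (hs n).rd k).trans (h n)⟩
  have hex : ∀ k, ∃ z : ℂ, Tendsto (fun n => s n k) U (𝓝 z) := fun k => by
    obtain ⟨C, h⟩ := hC' 0
    have hc : IsCompact (Metric.closedBall (0:ℂ) C) := isCompact_closedBall _ _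
    obtain ⟨z, -, hz⟩ := hc.ultrafilter_le_nhds (U.map (fun n => s n k)) (by
      rw [le_principal_iff]
      refine Filter.mem_map.2 (Filter.univ_mem' fun n => ?_)
      have := h n k
      simpa using this)
    exact ⟨z, hz⟩
  choose α hα using hex
  have hrd : RDs α := fun r => by
    obtain ⟨C, h⟩ := hC' r
    exact ⟨C, fun k => le_of_tendsto ((hα k).norm.mul_const _) (Filter.Eventually.of_forall fun n => h n k)⟩
  refine ⟨α, ⟨hrd, fun k => ?_, fun k => ?_, fun k => ?_⟩, hα, fun x y => ?_⟩
  · have h1 : Tendsto (fun n => (starRingEnd ℂ) (s n k)) U (𝓝 ((starRingEnd ℂ) (α k))) :=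
      (Complex.continuous_conj.tendsto _).comp (hα k)
    exact tendsto_nhds_unique h1 (by simpa only [(hs _).re] using hα (-k))
  · exact tendsto_nhds_unique (hα (sx k)) (by simpa only [(hs _).ox] using (hα k).neg)
  · exact tendsto_nhds_unique (hα (sy k)) (by simpa only [(hs _).oy] using (hα k).neg)
  · obtain ⟨C, h⟩ := hC' 3
    refine (Complex.continuous_re.tendsto _).comp ?_
    refine tendsto_tsum_of_dominated_convergence (bound := fun k => C * (1 / wt k ^ 3))
      (summable_wt_inv.mul_left _) (fun k => (hα k).mul_const _) (Filter.Eventually.of_forall fun n k => ?_)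
    rw [norm_mul, norm_ee, mul_one]
    have := wt_pos k
    rw [mul_one_div, le_div_iff₀ (by positivity)]
    exact h n k

open Filter Topology in
lemma steady {a : ℤ × ℤ → ℂ} (h : OO a) (m : ℕ)
    (h1 : ∀ x ∈ Icc 0 π, ∀ y ∈ Icc 0 π, -(uu (dX (dX a)) x y + uu (dY (dY a)) x y) ≤ fr m (uu a x y))
    (h2 : ∀ x ∈ Icc 0 π, ∀ y ∈ Icc 0 π, 0 ≤ uu a x y ∧ uu a x y ≤ 1) :
    ∃ θ, OO θ ∧ (∀ x y, |uu θ x y| ≤ 1/2) ∧ (∀ x y, uu θ x y = - fr m (uu (iL θ) x y)) ∧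
      ∀ x ∈ Icc 0 π, ∀ y ∈ Icc 0 π, uu a x y ≤ uu (iL θ) x y := by
  have hm := itr_mono h m h1 h2
  have hb : ∀ n x y, |uu (itr m a n) x y| ≤ 1 := fun n => by
    refine (h.itr m n).bound fun x hx y hy => ?_
    have := (hm n x hx y hy).1
    rw [abs_of_nonneg this.1]; exact this.2
  have hN := itr_NN h m hb
  have hNF : ∀ r, ∃ C, ∀ n, NN r (fun k => -(Fc m (itr m a n) k)) ≤ C := fun r => by
    obtain ⟨A, hA⟩ := hN r
    obtain ⟨B, hB⟩ := NN_Gc_iter m r A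
    refine ⟨1/2 * B, fun n => ?_⟩
    have e : (fun k => -(Fc m (itr m a n) k)) = fun k => (-(1/2) : ℂ) * (Gc^[m] (itr m a n)) k := by
      ext k; unfold Fc; ring
    rw [e, NN_const_mul]
    have := hB _ (h.itr m n).rd (hA n)
    norm_num; linarith
  set U : Ultrafilter ℕ := hyperfilter ℕ
  have hU : (U : Filter ℕ) ≤ atTop := by
    rw [← Nat.cofinite_eq_atTop]; exact hyperfilter_le_cofinite
  obtain ⟨α, hα, hα1, hα2⟩ := ulim U (itr m a) (h.itr m) hN
  obtain ⟨γ, hγ, hγ1, hγ2⟩ := ulim U (fun n k => -(Fc m (itr m a n) k)) (fun n => ((h.itr m n).Fc m).neg) hNF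
  obtain ⟨β, hβ, hβ1, hβ2⟩ := ulim U (fun n => itr m a (n + 1)) (fun n => h.itr m _) (fun r => by
    obtain ⟨C, hC⟩ := hN r; exact ⟨C, fun n => hC _⟩)
  have eβ : β = iL γ := by
    ext k
    refine tendsto_nhds_unique (hβ1 k) ?_
    simp only [itr_succ]
    exact (hγ1 k).const_mul _
  have mono : ∀ x ∈ Icc 0 π, ∀ y ∈ Icc 0 π, Monotone (fun n => uu (itr m a n) x y) := fun x hx y hy =>
    monotone_nat_of_le_succ fun n => (hm n x hx y hy).2
  have eq1 : ∀ x ∈ Icc 0 π, ∀ y ∈ Icc 0 π, uu α x y = uu β x y := fun x hx y hy => by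
    have hl := tendsto_atTop_ciSup (mono x hx y hy) ⟨1, by
      rintro _ ⟨n, rfl⟩; exact (hm n x hx y hy).1.2⟩
    have hl2 := (tendsto_add_atTop_iff_nat 1).2 hl
    exact (tendsto_nhds_unique (hα2 x y) (hl.mono_left hU)).trans
      (tendsto_nhds_unique (hβ2 x y) (hl2.mono_left hU)).symm
  have eq2 : ∀ x y, uu α x y = uu β x y := fun x y => by
    have := (hα.sub hβ).bound (C := 0) (fun x hx y hy => by
      rw [uu_sub hα.rd hβ.rd, eq1 x hx y hy]; simp) x y
    rw [uu_sub hα.rd hβ.rd] at this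
    linarith [abs_nonpos_iff.1 this]
  have eq3 : ∀ x y, uu γ x y = - fr m (uu α x y) := fun x y => by
    refine tendsto_nhds_unique (hγ2 x y) ?_
    simp only [uu_neg, uu_Fc (h.itr m _)]
    exact (((fr_continuous m).tendsto _).comp (hα2 x y)).neg
  have ab : ∀ x y, |uu α x y| ≤ 1 := fun x y =>
    le_of_tendsto (hα2 x y).abs (Filter.Eventually.of_forall fun n => hb n x y)
  refine ⟨γ, hγ, fun x y => ?_, fun x y => ?_, fun x hx y hy => ?_⟩
  · rw [eq3, abs_neg]; exact fr_abs m (ab x y)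
  · rw [eq3, eq2, eβ]
  · rw [← eβ, ← eq2]
    exact ge_of_tendsto (hα2 x y) (Filter.Eventually.of_forall fun n => mono x hx y hy (Nat.zero_le n))

/-! ### The base state -/

lemma dX_re {a : ℤ × ℤ → ℂ} (h : ∀ k, (starRingEnd ℂ) (a k) = a (-k)) (k : ℤ × ℤ) :
    (starRingEnd ℂ) (dX a k) = dX a (-k) := by
  unfold dX; simp [h]

lemma dY_re {a : ℤ × ℤ → ℂ} (h : ∀ k, (starRingEnd ℂ) (a k) = a (-k)) (k : ℤ × ℤ) :
    (starRingEnd ℂ) (dY a k) = dY a (-k) := by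
  unfold dY; simp [h]

lemma gr_diff : Differentiable ℝ gr := by unfold gr; fun_prop
lemma fr_diff (m : ℕ) : Differentiable ℝ (fr m) := (gr_diff.iterate m).div_const 2

lemma steady_BB {θ : ℤ × ℤ → ℂ} (h : OO θ) (m : ℕ) (he : ∀ x y, uu θ x y = - fr m (uu (iL θ) x y))
    (k : ℤ × ℤ) : BB θ θ k = 0 := by
  refine Fs_eq_zero (h.rd.BB h.rd).summable0 (fun x y => ?_) k
  rw [Fs_BB h.rd h.rd, ← Fs_real (dX_re h.re), ← Fs_real (dY_re h.re), ← Fs_real (dX_re h.iL.re),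
    ← Fs_real (dY_re h.iL.re)]
  have hx : uu (dX θ) x y = - (deriv (fr m) (uu (iL θ) x y) * uu (dX (iL θ)) x y) := by
    refine (uu_dx h.rd x y).unique ?_
    simp only [he]
    exact (HasDerivAt.comp (h := fun x' => uu (iL θ) x' y) x (fr_diff m _).hasDerivAt (uu_dx h.iL.rd x y)).neg
  have hy : uu (dY θ) x y = - (deriv (fr m) (uu (iL θ) x y) * uu (dY (iL θ)) x y) := by
    refine (uu_dy h.rd x y).unique ?_
    simp only [he]
    exact (HasDerivAt.comp (h := fun y' => uu (iL θ) x y') y (fr_diff m _).hasDerivAt (uu_dy h.iL.rd x y)).neg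
  change ((uu (dX θ) x y : ℝ) : ℂ) * (uu (dY (iL θ)) x y : ℝ) - (uu (dY θ) x y : ℝ) * (uu (dX (iL θ)) x y : ℝ) = 0
  rw [hx, hy]; push_cast; ring

lemma deriv_nonneg_right {f : ℝ → ℝ} {d : ℝ} (h : HasDerivAt f d 0) (h0 : f 0 = 0)
    (hf : ∀ x ∈ Icc 0 π, 0 ≤ f x) : 0 ≤ d := by
  have h1 := (hasDerivWithinAt_iff_tendsto_slope' (s := Ioi (0:ℝ)) (by simp)).1 (h.hasDerivWithinAt (s := Ioi 0))
  refine ge_of_tendsto h1 ?_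
  filter_upwards [Ioo_mem_nhdsGT Real.pi_pos] with x hx
  rw [slope_def_field, h0, sub_zero, sub_zero]
  exact div_nonneg (hf x ⟨hx.1.le, hx.2.le⟩) hx.1.le

lemma base_state (K : ℝ) : ∃ θ, OO θ ∧ (∀ k, BB θ θ k = 0) ∧ (∀ x y, |uu θ x y| ≤ 1/2) ∧
    K ≤ uu (dY (dX (iL θ))) 0 0 := by
  obtain ⟨N, hN⟩ : ∃ N, K ≤ 1/40 * hh N 0 := by
    obtain ⟨N, hN⟩ := (Real.tendsto_sum_range_one_div_nat_succ_atTop.eventually_ge_atTop (40 * K)).exists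
    exact ⟨N, by rw [hh_zero]; linarith⟩
  obtain ⟨m, hm⟩ : ∃ m : ℕ, 2 + 6 * (N : ℝ) ≤ (11/8) ^ m / 2 := by
    obtain ⟨m, hm⟩ := pow_unbounded_of_one_lt (2 * (2 + 6 * (N : ℝ))) (by norm_num : (1:ℝ) < 11/8)
    exact ⟨m, by linarith⟩
  obtain ⟨a, ha, haf⟩ := sub0_rep N
  have hqx : ∀ x y, qq (-x) y = qq x y := fun x y => by unfold qq; simp
  have hO : OO a := OO.of_fun ha haf (fun x y => by unfold sub0; rw [hqx]; simp; try ring)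
    (fun x y => by rw [sub0_symm, sub0_symm N x]; unfold sub0; rw [hqx]; simp; try ring)
  have hu : ∀ x y, uu a x y = sub0 N x y := fun x y => by unfold uu; rw [haf]; simp
  have hux : ∀ x y, uu (dX a) x y = sub0x N x y := fun x y =>
    (uu_dx ha x y).unique (by simpa only [hu] using sub0_dx N x y)
  have huxx : ∀ x y, uu (dX (dX a)) x y = sub0xx N x y := fun x y =>
    (uu_dx ha.dX x y).unique (by simpa only [hux] using sub0x_dx N x y)
  have huy : ∀ x y, uu (dY a) x y = sub0x N y x := fun x y =>
    (uu_dy ha x y).unique (by simpa only [hu, sub0_symm N x] using sub0_dx N y x)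
  have huyy : ∀ x y, uu (dY (dY a)) x y = sub0xx N y x := fun x y =>
    (uu_dy ha.dY x y).unique (by simpa only [huy] using sub0x_dx N y x)
  obtain ⟨θ, hθ, hb, he, hl⟩ := steady hO m (fun x hx y hy => by
    obtain ⟨l1, l2, l3, l4⟩ := sub0_lap N hx hy
    rw [huxx, huyy, hu]
    exact fr_low m l3 l4 hm l1 l2) (fun x hx y hy => by
    obtain ⟨l1, l2, l3, l4⟩ := sub0_lap N hx hy
    rw [hu]; exact ⟨l3, l4⟩)
  refine ⟨θ, hθ, steady_BB hθ m he, hb, hN.trans ?_⟩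
  have hψ := hθ.iL
  have g0 : ∀ y ∈ Icc 0 π, 0 ≤ uu (dX (iL θ)) 0 y - sub0x N 0 y := fun y hy => by
    refine deriv_nonneg_right ((uu_dx hψ.rd 0 y).sub (sub0_dx N 0 y)) ?_ fun x hx => ?_
    · change uu (iL θ) 0 y - sub0 N 0 y = 0
      rw [hψ.bd_x0, ← hu, hO.bd_x0, sub_zero]
    · change 0 ≤ uu (iL θ) x y - sub0 N x y
      have := hl x hx y hy
      rw [hu] at this; linarith
  have := deriv_nonneg_right ((uu_dy hψ.rd.dX 0 0).sub (sub0_xy N)) (by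
    change uu (dX (iL θ)) 0 0 - sub0x N 0 0 = 0
    have : uu (dX (iL θ)) 0 0 = 0 := (uu_dx hψ.rd 0 0).unique (by
      simp only [hψ.bd_y0]; exact hasDerivAt_const _ _)
    rw [this]; simp [sub0x]) g0
  linarith

/-! ### The perturbation -/

/-- coefficients of the perturbation -/
noncomputable def pt (ε : ℝ) (N : ℕ) (k : ℤ × ℤ) : ℂ :=
  if k.2 = 0 ∧ k.1.natAbs ≤ N then -Complex.I * ((ε / (2 * (k.1 : ℝ) * |(k.1 : ℝ)|) : ℝ) : ℂ) else 0

lemma norm_pt {ε : ℝ} (hε : 0 ≤ ε) (N : ℕ) (k : ℤ × ℤ) :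
    ‖pt ε N k‖ ≤ if k.2 = 0 then 2 * ε / wt k ^ 2 else 0 := by
  unfold pt
  by_cases h2 : k.2 = 0
  · by_cases h1 : k.1.natAbs ≤ N
    · rw [if_pos ⟨h2, h1⟩, if_pos h2, norm_mul, norm_neg, Complex.norm_I, one_mul, Complex.norm_real,
        Real.norm_eq_abs, abs_div, abs_of_nonneg hε, abs_mul, abs_mul, abs_abs]
      have hw : wt k = 1 + |(k.1 : ℝ)| := by unfold wt nn; rw [h2]; simp
      rw [hw]
      by_cases h0 : k.1 = 0
      · rw [h0]; simp; positivity
      · have : (1 : ℝ) ≤ |(k.1 : ℝ)| := by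
          rw [← Int.cast_abs]; exact_mod_cast Int.one_le_abs h0
        rw [div_le_div_iff₀ (by positivity) (by positivity)]
        have h4 : (1 + |(k.1 : ℝ)|) ^ 2 ≤ 4 * (|(k.1 : ℝ)| * |(k.1 : ℝ)|) := by nlinarith
        simp only [Nat.abs_ofNat]
        nlinarith
    · rw [if_neg (fun h => h1 h.2), if_pos h2, norm_zero]
      have := wt_pos k; positivity
  · rw [if_neg (fun h => h2 h.1), if_neg h2, norm_zero]

lemma pt_En {ε : ℝ} (hε : 0 ≤ ε) (N : ℕ) :
    En (bx N) (5/4) (pt ε N) ≤ 4 * ε ^ 2 * ∑' n : ℤ, (1 + |(n : ℝ)|) ^ (-(5/4) : ℝ) := by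
  unfold En
  have h1 : ∀ k : ℤ × ℤ, (wt k ^ (5/4 : ℝ) * ‖pt ε N k‖) ^ 2 ≤
      if k.2 = 0 then 4 * ε ^ 2 * (1 + |(k.1 : ℝ)|) ^ (-(5/4) : ℝ) else 0 := fun k => by
    have hn := norm_pt hε N k
    by_cases h2 : k.2 = 0
    · rw [if_pos h2] at hn ⊢
      have hw : wt k = 1 + |(k.1 : ℝ)| := by unfold wt nn; rw [h2]; simp
      rw [← hw]
      have hp := wt_pos k
      calc (wt k ^ (5/4 : ℝ) * ‖pt ε N k‖) ^ 2 ≤ (wt k ^ (5/4 : ℝ) * (2 * ε / wt k ^ 2)) ^ 2 := by gcongr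
        _ = 4 * ε ^ 2 * wt k ^ (-(3/2) : ℝ) := by
          have e1 : (wt k ^ (5/4 : ℝ)) ^ 2 = wt k ^ (5/2 : ℝ) := by
            rw [← Real.rpow_natCast, ← Real.rpow_mul hp.le]; norm_num
          have e2 : wt k ^ (-(3/2) : ℝ) = wt k ^ (5/2 : ℝ) / wt k ^ 4 := by
            rw [← Real.rpow_natCast, ← Real.rpow_sub hp]; norm_num
          rw [mul_pow, e1, e2]; ring
        _ ≤ _ := by
          exact mul_le_mul_of_nonneg_left
            (Real.rpow_le_rpow_of_exponent_le (one_le_wt k) (by norm_num)) (by positivity)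
    · rw [if_neg h2] at hn ⊢
      have : ‖pt ε N k‖ = 0 := le_antisymm hn (norm_nonneg _)
      rw [this]; simp
  refine (Finset.sum_le_sum fun k _ => h1 k).trans ?_
  unfold bx
  rw [Finset.sum_product]
  simp only
  rw [← tsum_mul_left]
  refine le_trans (Finset.sum_le_sum fun n _ => ?_) ((summable_one_add_abs_rpow.mul_left _).sum_le_tsum
    (Finset.Icc (-(N : ℤ)) N) fun n _ => by positivity)
  rw [Finset.sum_ite_eq' (Finset.Icc (-(N : ℤ)) N) 0]
  simp

lemma pert {e0 : ℝ} (he0 : 0 < e0) (G0 : ℝ) : ∃ (φ0 : ℤ × ℤ → ℂ) (N0 : ℕ), (∀ k ∉ bx N0, φ0 k = 0) ∧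
    (∀ k, (starRingEnd ℂ) (φ0 k) = φ0 (-k)) ∧ (∀ k, φ0 (sx k) = - φ0 k) ∧
    En (bx N0) (5/4) φ0 ≤ e0 ∧ RDs φ0 ∧ G0 ≤ ∑' k, ‖dX φ0 k‖ ∧
    (uu (dX φ0) 0 0 = ∑' k, ‖dX φ0 k‖) ∧ ∀ k, dY φ0 k = 0 := by
  set S1 := ∑' n : ℤ, (1 + |(n : ℝ)|) ^ (-(5/4) : ℝ) with hS1
  have hS : 0 ≤ S1 := tsum_nonneg fun n => by positivity
  obtain ⟨ε, hε, hε2⟩ : ∃ ε > 0, 4 * ε ^ 2 * S1 ≤ e0 := by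
    refine ⟨min 1 (e0 / (4 * (S1 + 1))), by positivity, ?_⟩
    set ε := min 1 (e0 / (4 * (S1 + 1)))
    have h0 : 0 < ε := by positivity
    have h1 : ε ≤ 1 := min_le_left _ _
    have h2 : ε * (4 * (S1 + 1)) ≤ e0 := (le_div_iff₀ (by positivity)).1 (min_le_right _ _)
    nlinarith [mul_nonneg h0.le hS]
  obtain ⟨N, hN⟩ := (Real.tendsto_sum_range_one_div_nat_succ_atTop.eventually_ge_atTop (2 * G0 / ε)).exists
  have supp : ∀ k ∉ bx N, pt ε N k = 0 := fun k hk => by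
    unfold pt
    rw [if_neg]
    rintro ⟨h2, h1⟩
    exact hk (mem_bx k N (by rw [h2]; simpa using h1))
  have hrd : RDs (pt ε N) := RDs_of_support _ supp
  have hdX : ∀ k, dX (pt ε N) k = (‖dX (pt ε N) k‖ : ℝ) := fun k => by
    have : ∃ r : ℝ, 0 ≤ r ∧ dX (pt ε N) k = (r : ℝ) := by
      unfold dX pt
      by_cases h : k.2 = 0 ∧ k.1.natAbs ≤ N
      · rw [if_pos h]
        refine ⟨(k.1 : ℝ) * (ε / (2 * (k.1 : ℝ) * |(k.1 : ℝ)|)), ?_, ?_⟩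
        · by_cases h0 : (k.1 : ℝ) = 0
          · simp [h0]
          · have e : (k.1 : ℝ) * (ε / (2 * (k.1 : ℝ) * |(k.1 : ℝ)|)) = ε / (2 * |(k.1 : ℝ)|) := by field_simp
            rw [e]; positivity
        · push_cast
          linear_combination (-(k.1 : ℂ) * ((ε : ℂ) / (2 * (k.1 : ℂ) * (|(k.1 : ℝ)| : ℝ)))) * Complex.I_mul_I
      · rw [if_neg h]; exact ⟨0, le_rfl, by simp⟩
    obtain ⟨r, hr, e⟩ := this
    rw [e, Complex.norm_real, Real.norm_of_nonneg hr]
  refine ⟨pt ε N, N, supp, fun k => ?_, fun k => ?_, (pt_En hε.le N).trans hε2, hrd, ?_, ?_, fun k => ?_⟩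
  · unfold pt
    by_cases h : k.2 = 0 ∧ k.1.natAbs ≤ N
    · rw [if_pos h, if_pos (by simpa using h), map_mul, map_neg, Complex.conj_I, Complex.conj_ofReal]
      simp [div_neg]
    · rw [if_neg h, if_neg (by simpa using h)]; simp
  · unfold pt
    rw [sx_apply]
    by_cases h : k.2 = 0 ∧ k.1.natAbs ≤ N
    · rw [if_pos h, if_pos (by simpa using h)]
      simp [div_neg]
    · rw [if_neg h, if_neg (by simpa using h)]; simp
  · have inj : Function.Injective (fun n : ℕ => (((n : ℤ) + 1, 0) : ℤ × ℤ)) := fun a b h => by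
      simpa using h
    have h1 := hrd.dX.summable0.sum_le_tsum ((Finset.range N).map ⟨_, inj⟩) fun k _ => norm_nonneg _
    refine le_trans ?_ h1
    rw [Finset.sum_map]
    have h2 : ∀ n ∈ Finset.range N, ‖dX (pt ε N) ((⟨_, inj⟩ : ℕ ↪ ℤ × ℤ) n)‖ = ε / 2 * (1 / ((n : ℝ) + 1)) := by
      intro n hn
      have hn' := Finset.mem_range.1 hn
      change ‖dX (pt ε N) (((n : ℤ) + 1, 0) : ℤ × ℤ)‖ = _
      unfold dX pt
      rw [if_pos ⟨rfl, by simp only; lia⟩]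
      have hp : (0:ℝ) < (n : ℝ) + 1 := by positivity
      simp only [norm_mul, Complex.norm_I, norm_neg, one_mul, Complex.norm_real, Real.norm_eq_abs]
      have e3 : ‖(((n : ℤ) + 1 : ℤ) : ℂ)‖ = (n : ℝ) + 1 := by
        rw [← Complex.ofReal_intCast, Complex.norm_real]; push_cast; exact abs_of_pos hp
      rw [e3]
      push_cast
      rw [abs_of_pos hp, abs_of_pos (by positivity)]
      field_simp
    rw [Finset.sum_congr rfl h2, ← Finset.mul_sum]
    have := mul_le_mul_of_nonneg_left hN (by positivity : 0 ≤ ε / 2)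
    refine le_trans (le_of_eq ?_) this
    field_simp
  · unfold uu Fs
    have e : ∀ k, dX (pt ε N) k * ee k 0 0 = ((‖dX (pt ε N) k‖ : ℝ) : ℂ) := fun k => by
      rw [← hdX]; simp [ee]
    simp only [e]
    rw [← Complex.ofReal_tsum, Complex.ofReal_re]
  · unfold dY pt
    by_cases h : k.2 = 0 ∧ k.1.natAbs ≤ N
    · rw [h.1]; simp
    · rw [if_neg h]; simp

/-! ### Growth along trajectories -/

lemma abs_uu_le {a : ℤ × ℤ → ℂ} (h : Summable (fun k => ‖a k‖)) (x y : ℝ) : |uu a x y| ≤ ∑' k, ‖a k‖ :=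
  (Complex.abs_re_le_norm _).trans (Fs_norm_le h x y)

lemma uu_lip_y {a : ℤ × ℤ → ℂ} (h : RDs a) (x y z : ℝ) :
    |uu a x y - uu a x z| ≤ (∑' k, ‖dY a k‖) * |y - z| := by
  have := convex_univ.norm_image_sub_le_of_norm_hasDerivWithin_le (f := fun y => uu a x y)
    (f' := fun y => uu (dY a) x y) (C := ∑' k, ‖dY a k‖) (s := univ) (x := z) (y := y)
    (fun y _ => (uu_dy h x y).hasDerivWithinAt) (fun y _ => abs_uu_le h.dY.summable0 x y) (mem_univ _) (mem_univ _)
  simpa [Real.norm_eq_abs] using this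

lemma int_abs_le_sq (n : ℤ) : |(n : ℝ)| ≤ (n : ℝ) ^ 2 := by
  rw [← sq_abs, ← Int.cast_abs]
  have h : |n| ≤ |n| ^ 2 := by
    rcases eq_or_ne n 0 with rfl | h
    · simp
    · have := Int.one_le_abs h; nlinarith
  exact_mod_cast h

lemma norm_I_int (n : ℤ) : ‖Complex.I * (n : ℂ)‖ = |(n : ℝ)| := by
  rw [norm_mul, Complex.norm_I, one_mul, ← Complex.ofReal_intCast, Complex.norm_real, Real.norm_eq_abs]

lemma norm_iL_eq (a : ℤ × ℤ → ℂ) (k : ℤ × ℤ) : ‖iL a k‖ = 1 / sq2 k * ‖a k‖ := by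
  unfold iL
  rw [norm_mul, Complex.norm_real, Real.norm_eq_abs, abs_neg,
    abs_of_nonneg (by have := sq2_nonneg k; positivity)]

lemma dXiL_norm (a : ℤ × ℤ → ℂ) (k : ℤ × ℤ) : ‖dX (iL a) k‖ ≤ ‖a k‖ := by
  unfold dX
  rw [norm_mul, norm_I_int, norm_iL_eq, ← mul_assoc, mul_one_div]
  refine mul_le_of_le_one_left (norm_nonneg _) (div_le_one_of_le₀ ?_ (sq2_nonneg k))
  have := int_abs_le_sq k.1
  unfold sq2; nlinarith [sq_nonneg (k.2 : ℝ)]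

lemma dYdXiL_norm (a : ℤ × ℤ → ℂ) (k : ℤ × ℤ) : ‖dY (dX (iL a)) k‖ ≤ ‖a k‖ := by
  unfold dY dX
  rw [norm_mul, norm_I_int, norm_mul, norm_I_int, norm_iL_eq, ← mul_assoc, ← mul_assoc, mul_one_div]
  refine mul_le_of_le_one_left (norm_nonneg _) (div_le_one_of_le₀ ?_ (sq2_nonneg k))
  unfold sq2
  rw [← sq_abs (k.1 : ℝ), ← sq_abs (k.2 : ℝ)]
  nlinarith [sq_nonneg (|(k.1 : ℝ)| - |(k.2 : ℝ)|), sq_nonneg (|(k.1 : ℝ)| + |(k.2 : ℝ)|)]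

lemma dX_add (a b : ℤ × ℤ → ℂ) : dX (fun k => a k + b k) = fun k => dX a k + dX b k := by
  ext k; unfold dX; ring
lemma dY_add (a b : ℤ × ℤ → ℂ) : dY (fun k => a k + b k) = fun k => dY a k + dY b k := by
  ext k; unfold dY; ring
lemma iL_add (a b : ℤ × ℤ → ℂ) : iL (fun k => a k + b k) = fun k => iL a k + iL b k := by
  ext k; unfold iL; ring

lemma iL_re {a : ℤ × ℤ → ℂ} (h : ∀ k, (starRingEnd ℂ) (a k) = a (-k)) (k : ℤ × ℤ) :
    (starRingEnd ℂ) (iL a k) = iL a (-k) := by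
  unfold iL; rw [map_mul, Complex.conj_ofReal, h, sq2_neg]

lemma Fs_x0 {a : ℤ × ℤ → ℂ} (h : ∀ k, a (sx k) = -a k) (y : ℝ) : Fs a 0 y = 0 := by
  have := Fs_odd_x h 0 y
  rw [neg_zero] at this
  linear_combination this / 2

lemma dY_sx {a : ℤ × ℤ → ℂ} (h : ∀ k, a (sx k) = -a k) (k : ℤ × ℤ) : dY a (sx k) = - dY a k := by
  unfold dY; rw [h, sx_apply]; simp
lemma iL_sx {a : ℤ × ℤ → ℂ} (h : ∀ k, a (sx k) = -a k) (k : ℤ × ℤ) : iL a (sx k) = - iL a k := by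
  unfold iL; rw [h, sq2_sx]; simp

lemma Fs_BB_dx {a : ℤ × ℤ → ℂ} (h : RDs a) (ho : ∀ k, a (sx k) = -a k) (y : ℝ) :
    Fs (dX (BB a a)) 0 y = Fs (dX a) 0 y * Fs (dY (dX (iL a))) 0 y -
      Fs (dY (dX a)) 0 y * Fs (dX (iL a)) 0 y := by
  have h1 := Fs_hasDerivAt_x (h.BB h) 0 y
  have h2 := ((Fs_hasDerivAt_x h.dX 0 y).mul (Fs_hasDerivAt_x h.iL.dY 0 y)).sub
    ((Fs_hasDerivAt_x h.dY 0 y).mul (Fs_hasDerivAt_x h.iL.dX 0 y))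
  have e := h1.unique (h2.congr_of_eventuallyEq (Filter.Eventually.of_forall fun x => Fs_BB h h x y))
  rw [e, Fs_x0 (dY_sx (iL_sx ho)), Fs_x0 (dY_sx ho)]
  have c1 : ∀ b, dX (dY b) = dY (dX b) := fun b => by ext k; unfold dX dY; ring
  rw [c1, c1]; ring

lemma growth_core {J : Set ℝ} (hJ : IsOpen J) (hJ' : IsPreconnected J) {c : ℤ × ℤ → ℝ → ℂ} (hc : URD J c)
    (hd : ∀ k, ∀ s ∈ J, HasDerivAt (c k) (BB (fun k => c k s) (fun k => c k s) k) s)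
    (hr : ∀ k, ∀ s ∈ J, (starRingEnd ℂ) (c k s) = c (-k) s)
    (ho : ∀ k, ∀ s ∈ J, c (sx k) s = - c k s) {y : ℝ → ℝ} {s : ℝ} (hs : s ∈ J)
    (hy : HasDerivAt y (uu (dX (iL (fun k => c k s))) 0 (y s)) s) :
    HasDerivAt (fun s => uu (dX (fun k => c k s)) 0 (y s))
      (uu (dY (dX (iL (fun k => c k s)))) 0 (y s) * uu (dX (fun k => c k s)) 0 (y s)) s := by
  have hcs := hc.rds hs
  have h1 := Ph_fderiv hJ hJ' (c := fun k s => Complex.I * k.1 * c k s)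
    (c' := fun k s => Complex.I * k.1 * BB (fun k => c k s) (fun k => c k s) k)
    (hc.mult norm_I_fst) ((hc.BB hc).mult norm_I_fst) (fun k s hs => (hd k s hs).const_mul _)
    (0, y s, s) ⟨mem_univ _, mem_univ _, hs⟩
  have h2 : HasDerivAt (fun s => ((0 : ℝ), y s, s)) (0, uu (dX (iL (fun k => c k s))) 0 (y s), 1) s :=
    (hasDerivAt_const s (0:ℝ)).prodMk (hy.prodMk (hasDerivAt_id s))
  have h3 := h1.comp_hasDerivAt s h2
  have h4 := Complex.reCLM.hasFDerivAt.comp_hasDerivAt s h3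
  refine h4.congr_deriv ?_
  have e1 : Ph (fun k s => Complex.I * k.1 * BB (fun k => c k s) (fun k => c k s) k) (0, y s, s)
    = Fs (dX (BB (fun k => c k s) (fun k => c k s))) 0 (y s) := rfl
  have e2 : Ph (fun k s => Complex.I * k.2 * (Complex.I * k.1 * c k s)) (0, y s, s)
    = Fs (dY (dX (fun k => c k s))) 0 (y s) := rfl
  rw [e1, e2, Fs_BB_dx hcs (fun k => ho k s hs)]
  have hrs : ∀ k, (starRingEnd ℂ) (c k s) = c (-k) s := fun k => hr k s hs
  have r1 := Fs_real (dX_re (a := fun k => c k s) hrs) 0 (y s)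
  have r2 := Fs_real (dY_re (dX_re (iL_re (a := fun k => c k s) hrs))) 0 (y s)
  have r3 := Fs_real (dY_re (dX_re (a := fun k => c k s) hrs)) 0 (y s)
  have r4 := Fs_real (dX_re (iL_re (a := fun k => c k s) hrs)) 0 (y s)
  rw [← r1, ← r2, ← r3, ← r4]
  simp [L1, L2, L3, uu]
  ring

lemma ode_line {v : ℝ → ℝ → ℝ} {a b C : ℝ} (ha : a < 0) (hb : 0 < b) (hC0 : 0 ≤ C)
    (hL : ∀ s ∈ Icc a b, ∀ y z, |v s y - v s z| ≤ C * |y - z|) (hC : ∀ s ∈ Icc a b, ∀ y, |v s y| ≤ C)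
    (hc : ∀ y, ContinuousOn (fun s => v s y) (Icc a b)) :
    ∃ α : ℝ → ℝ, α 0 = 0 ∧ ∀ s ∈ Ioo a b, HasDerivAt α (v s (α s)) s := by
  lift C to NNReal using hC0
  have hm : 0 ≤ max (b - 0) (0 - a) := le_max_of_le_left (by linarith)
  have hpl : IsPicardLindelof v (tmin := a) (tmax := b) ⟨0, ha.le, hb.le⟩ (0:ℝ)
      (C * ⟨max (b - 0) (0 - a), hm⟩) 0 C C := by
    refine ⟨fun t ht => (LipschitzWith.of_dist_le_mul fun y z => hL t ht y z).lipschitzOnWith,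
      fun x _ => hc x, fun t ht x _ => hC t ht x, ?_⟩
    show (C:ℝ) * max (b - 0) (0 - a) ≤ (C:ℝ) * max (b - 0) (0 - a) - 0
    rw [sub_zero ((C:ℝ) * _)]
  obtain ⟨α, h0, h1⟩ := hpl.exists_eq_forall_mem_Icc_hasDerivWithinAt₀
  exact ⟨α, h0, fun s hs => (h1 s (Ioo_subset_Icc_self hs)).hasDerivAt (Icc_mem_nhds hs.1 hs.2)⟩

lemma exp_growth {p g : ℝ → ℝ} {κ T : ℝ} (hT : 0 ≤ T) (hp : ∀ s ∈ Icc 0 T, HasDerivAt p (g s * p s) s)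
    (hg : ∀ s ∈ Icc 0 T, κ ≤ g s) : |p 0| * Real.exp (κ * T) ≤ |p T| := by
  have hq : ∀ s ∈ Icc 0 T, HasDerivAt (fun s => p s ^ 2 * Real.exp (-(2 * κ) * s))
      (2 * (g s - κ) * (p s ^ 2 * Real.exp (-(2 * κ) * s))) s := fun s hs => by
    have h1 := ((hp s hs).pow 2).mul (((hasDerivAt_id s).const_mul (-(2 * κ))).exp)
    refine h1.congr_deriv ?_
    simp; ring
  have mono : MonotoneOn (fun s => p s ^ 2 * Real.exp (-(2 * κ) * s)) (Icc 0 T) := by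
    refine monotoneOn_of_deriv_nonneg (convex_Icc 0 T) (fun s hs => (hq s hs).continuousAt.continuousWithinAt)
      (fun s hs => (hq s (interior_subset hs)).differentiableAt.differentiableWithinAt) fun s hs => ?_
    rw [(hq s (interior_subset hs)).deriv]
    have := hg s (interior_subset hs)
    have : 0 ≤ g s - κ := by linarith
    positivity
  have h := mono (left_mem_Icc.2 hT) (right_mem_Icc.2 hT) hT
  simp only [mul_zero, Real.exp_zero, mul_one] at h
  refine abs_le_of_sq_le_sq' ?_ (abs_nonneg _) |>.2
  rw [mul_pow, sq_abs, sq_abs]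
  have e : Real.exp (κ * T) ^ 2 * Real.exp (-(2 * κ) * T) = 1 := by
    rw [← Real.exp_nat_mul, ← Real.exp_add]; rw [← Real.exp_zero]; congr 1; push_cast; ring
  calc p 0 ^ 2 * Real.exp (κ * T) ^ 2 ≤ (p T ^ 2 * Real.exp (-(2 * κ) * T)) * Real.exp (κ * T) ^ 2 := by gcongr
    _ = p T ^ 2 * (Real.exp (κ * T) ^ 2 * Real.exp (-(2 * κ) * T)) := by ring
    _ = _ := by rw [e, mul_one]

lemma grow {θ : ℤ × ℤ → ℂ} (hθ : OO θ) {K T : ℝ} (hT : 0 < T) (hK : K ≤ uu (dY (dX (iL θ))) 0 0) :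
    ∃ δ > 0, ∀ φ : ℤ × ℤ → ℝ → ℂ, URD (Ioo (-1) (T + 1)) φ →
      (∀ k, ∀ s ∈ Ioo (-1) (T + 1), HasDerivAt (φ k) (BB (fun k => θ k + φ k s) (fun k => θ k + φ k s) k) s) →
      (∀ k, ∀ s ∈ Ioo (-1) (T + 1), (starRingEnd ℂ) (φ k s) = φ (-k) s) →
      (∀ k, ∀ s ∈ Ioo (-1) (T + 1), φ (sx k) s = - φ k s) →
      (∀ s ∈ Ioo (-1) (T + 1), ∑' k, ‖φ k s‖ ≤ δ) →
      ∃ y, |uu (dX (fun k => θ k + φ k 0)) 0 0| * Real.exp ((K - 1) * T) ≤ |uu (dX (fun k => θ k + φ k T)) 0 y| := by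
  set A := (∑' k, ‖dY (dX (iL θ)) k‖) + 1 with hA
  set B := ∑' k, ‖dY (dY (dX (iL θ))) k‖ with hB
  have hA1 : 1 ≤ A := by
    have : 0 ≤ ∑' k, ‖dY (dX (iL θ)) k‖ := tsum_nonneg fun _ => norm_nonneg _
    linarith
  have hB0 : 0 ≤ B := tsum_nonneg fun _ => norm_nonneg _
  set E := Real.exp (A * T) with hE
  have hE0 : 0 < E := Real.exp_pos _
  refine ⟨1 / (B * E + 1), by positivity, fun φ hφ hd hr ho hδ => ?_⟩
  set δ := 1 / (B * E + 1) with hδd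
  have hδ0 : 0 < δ := by positivity
  have hδ1 : B * (δ * E) + δ = 1 := by rw [hδd]; field_simp
  set J := Ioo (-1) (T + 1) with hJd
  have hJ : IsOpen J := isOpen_Ioo
  have hJ' : IsPreconnected J := isPreconnected_Ioo
  set c : ℤ × ℤ → ℝ → ℂ := fun k s => θ k + φ k s with hcd
  have hc : URD J c := (SM_const 0 hθ.rd).urd.add hφ
  have hdc : ∀ k, ∀ s ∈ J, HasDerivAt (c k) (BB (fun k => c k s) (fun k => c k s) k) s := fun k s hs =>
    (hd k s hs).const_add (θ k)
  have hrc : ∀ k, ∀ s ∈ J, (starRingEnd ℂ) (c k s) = c (-k) s := fun k s hs => by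
    simp only [hcd, map_add, hθ.re, hr k s hs]
  have hoc : ∀ k, ∀ s ∈ J, c (sx k) s = - c k s := fun k s hs => by
    simp only [hcd, hθ.ox, ho k s hs]; ring
  obtain ⟨u, hu, hub⟩ := hc.bound 0
  set C := ∑' k, u k with hC
  have hcu : ∀ s ∈ J, ∑' k, ‖c k s‖ ≤ C := fun s hs =>
    (hc.rds hs).summable0.tsum_le_tsum (fun k => by simpa using hub k s hs) hu
  have sub : Icc (-(1/2)) (T + 1/2) ⊆ J := fun s hs => ⟨by linarith [hs.1], by linarith [hs.2]⟩
  have h0J : (0:ℝ) ∈ J := ⟨by norm_num, by linarith⟩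
  have hC0 : 0 ≤ C := (tsum_nonneg fun _ => norm_nonneg _).trans (hcu 0 h0J)
  obtain ⟨y, y0, hy⟩ := ode_line (v := fun s y => uu (dX (iL (fun k => c k s))) 0 y) (a := -(1/2)) (b := T + 1/2)
    (by norm_num) (by linarith) hC0
    (fun s hs y z => by
      refine (uu_lip_y (hc.rds (sub hs)).iL.dX 0 y z).trans ?_
      refine mul_le_mul_of_nonneg_right (le_trans ?_ (hcu s (sub hs))) (abs_nonneg _)
      exact (hc.rds (sub hs)).iL.dX.dY.summable0.tsum_le_tsum (fun k => dYdXiL_norm _ k) (hc.rds (sub hs)).summable0)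
    (fun s hs y => by
      refine (abs_uu_le (hc.rds (sub hs)).iL.dX.summable0 0 y).trans (le_trans ?_ (hcu s (sub hs)))
      exact (hc.rds (sub hs)).iL.dX.summable0.tsum_le_tsum (fun k => dXiL_norm _ k) (hc.rds (sub hs)).summable0)
    (fun y s hs => by
      have hμ : ∀ k : ℤ × ℤ, ‖Complex.I * (k.1 : ℂ) * ((-(1 / sq2 k) : ℝ) : ℂ)‖ ≤ 1 * wt k ^ 0 := fun k => by
        have h1 := dXiL_norm (fun _ => 1) k
        unfold dX iL at h1
        simpa using h1
      have h2 := Ph_time hJ hJ' (hc.mult hμ) ((hc.BB hc).mult hμ) (fun k s hs => (hdc k s hs).const_mul _)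
        0 y s (sub hs)
      have h3 : ContinuousAt (fun s => uu (dX (iL (fun k => c k s))) 0 y) s := by
        have h4 : (fun s => uu (dX (iL (fun k => c k s))) 0 y) = fun s =>
            (Fs (fun k => Complex.I * (k.1 : ℂ) * ((-(1 / sq2 k) : ℝ) : ℂ) * c k s) 0 y).re := by
          ext s; unfold uu; congr 2; ext k; unfold dX iL; ring
        rw [h4]
        exact Complex.continuous_re.continuousAt.comp h2.continuousAt
      exact h3.continuousWithinAt)
  have hyT : ∀ s ∈ Icc 0 T, HasDerivAt y (uu (dX (iL (fun k => c k s))) 0 (y s)) s := fun s hs =>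
    hy s ⟨by linarith [hs.1], by linarith [hs.2]⟩
  have hTJ : ∀ s ∈ Icc 0 T, s ∈ J := fun s hs => ⟨by linarith [hs.1], by linarith [hs.2]⟩
  have hψ := hθ.iL
  have v00 : uu (dX (iL θ)) 0 0 = 0 := (uu_dx hψ.rd 0 0).unique (by
    simp only [hψ.bd_y0]; exact hasDerivAt_const _ _)
  have vb : ∀ s ∈ Icc 0 T, |uu (dX (iL (fun k => c k s))) 0 (y s)| ≤ A * |y s| + δ := fun s hs => by
    have hφs := hφ.rds (hTJ s hs)
    rw [hcd]
    simp only
    rw [iL_add, dX_add, uu_add hψ.rd.dX hφs.iL.dX]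
    refine (abs_add_le _ _).trans (add_le_add ?_ ?_)
    · have := uu_lip_y hψ.rd.dX 0 (y s) 0
      rw [v00, sub_zero, sub_zero] at this
      refine this.trans (mul_le_mul_of_nonneg_right (by linarith) (abs_nonneg _))
    · refine (abs_uu_le hφs.iL.dX.summable0 _ _).trans (le_trans ?_ (hδ s (hTJ s hs)))
      exact hφs.iL.dX.summable0.tsum_le_tsum (fun k => dXiL_norm _ k) hφs.summable0
  have yb : ∀ s ∈ Icc 0 T, |y s| ≤ δ * E := fun s hs => by
    have h := norm_le_gronwallBound_of_norm_deriv_right_le (f := y) (δ := 0) (K := A) (ε := δ) (a := 0) (b := T)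
      (fun s hs => (hyT s hs).continuousAt.continuousWithinAt)
      (fun s hs => (hyT s (Ico_subset_Icc_self hs)).hasDerivWithinAt) (by simp [y0])
      (fun s hs => vb s (Ico_subset_Icc_self hs)) s hs
    rw [gronwallBound_of_K_ne_0 (by linarith)] at h
    simp only [sub_zero, zero_mul, zero_add] at h
    refine h.trans ?_
    have h1 : Real.exp (A * s) ≤ E := Real.exp_le_exp.2 (by nlinarith [hs.2])
    have h2 : 1 ≤ Real.exp (A * s) := Real.one_le_exp (by nlinarith [hs.1])
    have h3 : δ / A ≤ δ := div_le_self hδ0.le hA1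
    calc δ / A * (Real.exp (A * s) - 1) ≤ δ * (Real.exp (A * s) - 1) := by
          exact mul_le_mul_of_nonneg_right h3 (by linarith)
      _ ≤ δ * E := by gcongr; linarith
  have gb : ∀ s ∈ Icc 0 T, K - 1 ≤ uu (dY (dX (iL (fun k => c k s)))) 0 (y s) := fun s hs => by
    have hφs := hφ.rds (hTJ s hs)
    rw [hcd]
    simp only
    rw [iL_add, dX_add, dY_add, uu_add hψ.rd.dX.dY hφs.iL.dX.dY]
    have h1 := uu_lip_y hψ.rd.dX.dY 0 (y s) 0
    rw [sub_zero] at h1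
    have h2 : B * |y s| ≤ B * (δ * E) := mul_le_mul_of_nonneg_left (yb s hs) hB0
    have h3 : |uu (dY (dX (iL (fun k => φ k s)))) 0 (y s)| ≤ δ := by
      refine (abs_uu_le hφs.iL.dX.dY.summable0 _ _).trans (le_trans ?_ (hδ s (hTJ s hs)))
      exact hφs.iL.dX.dY.summable0.tsum_le_tsum (fun k => dYdXiL_norm _ k) hφs.summable0
    have h4 := (abs_le.1 h1).1
    have h5 := (abs_le.1 h3).1
    linarith
  have := exp_growth (p := fun s => uu (dX (fun k => c k s)) 0 (y s)) hT.le
    (fun s hs => growth_core hJ hJ' hc hdc hrc hoc (hTJ s hs) (hyT s hs)) gb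
  simp only [y0] at this
  exact ⟨y T, this⟩

lemma is_euler {t : ℝ} (ht : 0 < t) {c : ℤ × ℤ → ℝ → ℂ} (hc : URD (Ioo (-1) (t + 1)) c)
    (hd : ∀ k, ∀ s ∈ Ioo (-1) (t + 1), HasDerivAt (c k) (BB (fun m => c m s) (fun m => c m s) k) s)
    (hre : ∀ k, ∀ s ∈ Ioo (-1) (t + 1), (starRingEnd ℂ) (c k s) = c (-k) s)
    (h0 : ∀ s ∈ Ioo (-1) (t + 1), c 0 s = 0) :
    IsEulerOnTorus t (fun x y s => uu (fun k => c k s) x y) (fun x y s => uu (iL (fun k => c k s)) x y) := by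
  have hJ : IsOpen (Ioo (-1) (t + 1)) := isOpen_Ioo
  have hJ' : IsPreconnected (Ioo (-1) (t + 1)) := isPreconnected_Ioo
  have hIJ : ∀ s ∈ Icc 0 t, s ∈ Ioo (-1) (t + 1) := fun s hs => ⟨by linarith [hs.1], by linarith [hs.2]⟩
  have hSM := SM_of_euler hJ hJ' hc hd
  have hsub : {p : ℝ × ℝ × ℝ | p.2.2 ∈ Icc 0 t} ⊆ slab (Ioo (-1) (t + 1)) :=
    fun p hp => ⟨mem_univ _, mem_univ _, hIJ _ hp⟩
  have hmul : ∀ k : ℤ × ℤ, ‖((-(1 / sq2 k) : ℝ) : ℂ)‖ ≤ 1 * wt k ^ 0 := fun k => by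
    rw [Complex.norm_real, Real.norm_eq_abs, abs_neg, abs_of_nonneg (by have := sq2_nonneg k; positivity)]
    simpa using inv_sq2_le k
  have hθ : ∀ x y, ∀ s ∈ Icc 0 t, pX (fun x y s => uu (fun k => c k s) x y) x y s = uu (dX (fun k => c k s)) x y :=
    fun x y s hs => (uu_dx (hc.rds (hIJ s hs)) x y).deriv
  have hθ2 : ∀ x y, ∀ s ∈ Icc 0 t, pY (fun x y s => uu (fun k => c k s) x y) x y s = uu (dY (fun k => c k s)) x y :=
    fun x y s hs => (uu_dy (hc.rds (hIJ s hs)) x y).deriv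
  have hψ : ∀ x y, ∀ s ∈ Icc 0 t,
      pX (fun x y s => uu (iL (fun k => c k s)) x y) x y s = uu (dX (iL (fun k => c k s))) x y :=
    fun x y s hs => (uu_dx (hc.rds (hIJ s hs)).iL x y).deriv
  have hψ2 : ∀ x y, ∀ s ∈ Icc 0 t,
      pY (fun x y s => uu (iL (fun k => c k s)) x y) x y s = uu (dY (iL (fun k => c k s))) x y :=
    fun x y s hs => (uu_dy (hc.rds (hIJ s hs)).iL x y).deriv
  refine ⟨?_, ?_, fun x y s => ⟨uu_per_x _ _ _, uu_per_y _ _ _⟩, fun x y s => ⟨uu_per_x _ _ _, uu_per_y _ _ _⟩,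
    fun s hs => ?_, fun x y s hs => ?_, fun x y s hs => ?_⟩
  · exact Complex.reCLM.contDiff.comp_contDiffOn ((Ph_smooth hJ hJ' hSM).mono hsub)
  · exact Complex.reCLM.contDiff.comp_contDiffOn ((Ph_smooth hJ hJ' (fun n => (hSM n).mult hmul)).mono hsub)
  · have h := integral_Fs (hc.rds (hIJ s hs)).summable0
    rw [h0 s (hIJ s hs), mul_zero] at h
    have e : ∀ x y, Fs (fun k => c k s) x y = ((uu (fun k => c k s) x y : ℝ) : ℂ) := fun x y =>
      (Fs_real (fun k => hre k s (hIJ s hs)) x y).symm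
    simp only [e, intervalIntegral.integral_ofReal] at h
    exact_mod_cast h
  · have e1 : pXX (fun x y s => uu (iL (fun k => c k s)) x y) x y s = uu (dX (dX (iL (fun k => c k s)))) x y := by
      unfold pXX
      rw [funext fun x' => hψ x' y s hs]
      exact (uu_dx (hc.rds (hIJ s hs)).iL.dX x y).deriv
    have e2 : pYY (fun x y s => uu (iL (fun k => c k s)) x y) x y s = uu (dY (dY (iL (fun k => c k s)))) x y := by
      unfold pYY
      rw [funext fun y' => hψ2 x y' s hs]
      exact (uu_dy (hc.rds (hIJ s hs)).iL.dY x y).deriv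
    rw [e1, e2]
    exact uu_laplace (hc.rds (hIJ s hs)) (h0 s (hIJ s hs)) x y
  · have hs' := hIJ s hs
    have h := Ph_time hJ hJ' hc (hc.BB hc) hd x y s hs'
    have h2 : HasDerivAt (fun s => uu (fun k => c k s) x y) _ s :=
      Complex.reCLM.hasFDerivAt.comp_hasDerivAt s h
    rw [h2.hasDerivWithinAt.derivWithin (uniqueDiffOn_Icc ht s hs), hθ x y s hs, hθ2 x y s hs, hψ x y s hs,
      hψ2 x y s hs]
    have hr : ∀ k, (starRingEnd ℂ) ((fun k => c k s) k) = (fun k => c k s) (-k) := fun k => hre k s hs'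
    have hrd := hc.rds hs'
    change (Fs (BB (fun k => c k s) (fun k => c k s)) x y).re = _
    rw [Fs_BB hrd hrd, ← Fs_real (dX_re hr), ← Fs_real (dY_re hr), ← Fs_real (dX_re (iL_re hr)),
      ← Fs_real (dY_re (iL_re hr))]
    unfold uu
    simp only [← Complex.ofReal_mul, ← Complex.ofReal_sub, Complex.ofReal_re]

lemma sqrt_le_add_abs (a b : ℝ) : √(a ^ 2 + b ^ 2) ≤ |a| + |b| := by
  rw [Real.sqrt_le_left (by positivity)]
  nlinarith [sq_abs a, sq_abs b, mul_nonneg (abs_nonneg a) (abs_nonneg b)]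

lemma abs_le_sqrt_add (a b : ℝ) : |a| ≤ √(a ^ 2 + b ^ 2) := by
  rw [← Real.sqrt_sq_eq_abs]
  exact Real.sqrt_le_sqrt (by nlinarith [sq_nonneg b])

lemma grad_le {c : ℤ × ℤ → ℝ → ℂ} {s : ℝ} (hc : RDs (fun k => c k s)) {B : ℝ}
    (h : ∀ x y, |uu (dX (fun k => c k s)) x y| + |uu (dY (fun k => c k s)) x y| ≤ B) :
    gradSupNorm (fun x y s => uu (fun k => c k s) x y) s ≤ B := by
  refine ciSup_le fun p => ?_
  have e1 : pX (fun x y s => uu (fun k => c k s) x y) p.1 p.2 s = uu (dX (fun k => c k s)) p.1 p.2 :=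
    (uu_dx hc _ _).deriv
  have e2 : pY (fun x y s => uu (fun k => c k s) x y) p.1 p.2 s = uu (dY (fun k => c k s)) p.1 p.2 :=
    (uu_dy hc _ _).deriv
  rw [e1, e2]
  exact (sqrt_le_add_abs _ _).trans (h _ _)

lemma le_grad {c : ℤ × ℤ → ℝ → ℂ} {s : ℝ} (hc : RDs (fun k => c k s)) (x y : ℝ) :
    |uu (dX (fun k => c k s)) x y| ≤ gradSupNorm (fun x y s => uu (fun k => c k s) x y) s := by
  have e1 : ∀ x y, pX (fun x y s => uu (fun k => c k s) x y) x y s = uu (dX (fun k => c k s)) x y :=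
    fun x y => (uu_dx hc _ _).deriv
  have e2 : ∀ x y, pY (fun x y s => uu (fun k => c k s) x y) x y s = uu (dY (fun k => c k s)) x y :=
    fun x y => (uu_dy hc _ _).deriv
  unfold gradSupNorm
  simp only [e1, e2]
  refine (abs_le_sqrt_add _ (uu (dY (fun k => c k s)) x y)).trans
    (le_ciSup (f := fun p : ℝ × ℝ => √((uu (dX (fun k => c k s)) p.1 p.2) ^ 2 + (uu (dY (fun k => c k s)) p.1 p.2) ^ 2))
      ⟨∑' k, ‖dX (fun k => c k s) k‖ + ∑' k, ‖dY (fun k => c k s) k‖, ?_⟩ (x, y))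
  rintro _ ⟨p, rfl⟩
  exact (sqrt_le_add_abs _ _).trans (add_le_add (abs_uu_le hc.dX.summable0 _ _) (abs_uu_le hc.dY.summable0 _ _))

/-- For every `t > 0` and every `M > 0` there is a smooth solution of the 2D Euler
equation on the torus (on the time interval `[0,t]`) with `0 < ‖θ(·,0)‖_∞ ≤ 1`,
`‖∇θ(·,0)‖_∞ > 0`, and `‖∇θ(·,t)‖_∞ > M ‖∇θ(·,0)‖_∞`: the Euler evolution operator
is linearly unbounded in the Lipschitz norm at every positive time. -/
theorem euler_evolution_linearly_unbounded (t M : ℝ) (ht : 0 < t) (hM : 0 < M) :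
    ∃ θ ψ : ℝ → ℝ → ℝ → ℝ, IsEulerOnTorus t θ ψ ∧
      0 < supNorm (fun x y => θ x y 0) ∧
      supNorm (fun x y => θ x y 0) ≤ 1 ∧
      0 < gradSupNorm θ 0 ∧
      gradSupNorm θ t > M * gradSupNorm θ 0 := by
  obtain ⟨θ0, hθ0, hBB, hhalf, hK⟩ := base_state (1 + 2 * M / t)
  obtain ⟨δ, hδ, hgrow⟩ := grow hθ0 ht hK
  obtain ⟨ε0, hε0, C, hC, hex⟩ := euler_exist hθ0.rd hθ0.re hθ0.ox hBB ht
  set d := min δ (1/2) with hd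
  have hd0 : 0 < d := lt_min hδ (by norm_num)
  set Ax := ∑' k, ‖dX θ0 k‖ with hAx
  set Ay := ∑' k, ‖dY θ0 k‖ with hAy
  have hAx0 : 0 ≤ Ax := tsum_nonneg fun k => norm_nonneg _
  have hAy0 : 0 ≤ Ay := tsum_nonneg fun k => norm_nonneg _
  obtain ⟨φ0, N0, hsupp, hre0, hodd0, hEn, hrd0, hG, hGe, hdY⟩ :=
    pert (e0 := min ε0 (d ^ 2 / (C + 1))) (lt_min hε0 (by positivity)) (4 * (Ax + Ay) + 1)
  obtain ⟨φ, hφ0, hU, hder, hre, hodd, hsmall⟩ := hex φ0 N0 hsupp hre0 hodd0 (hEn.trans (min_le_left _ _))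
  set G := ∑' k, ‖dX φ0 k‖ with hGdef
  have hsm : ∀ s ∈ Ioo (-1) (t + 1), ∑' k, ‖φ k s‖ ≤ d := fun s hs => by
    refine le_of_sq_le_sq ((hsmall s hs).trans ?_) hd0.le
    calc C * En (bx N0) (5/4) φ0 ≤ (C + 1) * (d ^ 2 / (C + 1)) :=
          mul_le_mul (by linarith) (hEn.trans (min_le_right _ _)) (En_nonneg _ _ _) (by linarith)
      _ = d ^ 2 := by field_simp
  obtain ⟨y, hy⟩ := hgrow φ hU hder hre hodd fun s hs => (hsm s hs).trans (min_le_left _ _)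
  have h0J : (0 : ℝ) ∈ Ioo (-1) (t + 1) := ⟨by norm_num, by linarith⟩
  have htJ : t ∈ Ioo (-1) (t + 1) := ⟨by linarith, by linarith⟩
  set c : ℤ × ℤ → ℝ → ℂ := fun k s => θ0 k + φ k s with hcdef
  have hcU : URD (Ioo (-1) (t + 1)) c := (SM_const 0 hθ0.rd).urd.add hU
  have hc0 := hcU.rds h0J
  have hct := hcU.rds htJ
  have hφ00 : (fun k => φ k 0) = φ0 := funext hφ0
  have hc00 : (fun k => c k 0) = fun k => θ0 k + φ0 k := by ext k; simp only [hcdef, hφ0]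
  have hp0 : G - Ax ≤ |uu (dX (fun k => c k 0)) 0 0| := by
    rw [hc00, dX_add, uu_add hθ0.rd.dX hrd0.dX, hGe]
    have := abs_uu_le hθ0.rd.dX.summable0 0 0
    have h1 := (abs_le.1 this).1
    refine le_trans ?_ (le_abs_self _)
    linarith
  have hpos : 0 < G - Ax := by linarith
  have hb : ∀ x y, |uu (fun k => c k 0) x y| ≤ 1 := fun x y => by
    rw [hc00, uu_add hθ0.rd hrd0]
    have h1 := hhalf x y
    have h2 := abs_uu_le hrd0.summable0 x y
    have h3 := (hsm 0 h0J).trans (min_le_right _ _)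
    simp only [hφ0] at h3
    exact (abs_add_le _ _).trans (by linarith)
  refine ⟨fun x y s => uu (fun k => c k s) x y, fun x y s => uu (iL (fun k => c k s)) x y, ?_, ?_, ?_, ?_, ?_⟩
  · refine is_euler ht hcU (fun k s hs => (hder k s hs).const_add (θ0 k)) (fun k s hs => ?_) (fun s hs => ?_)
    · simp only [hcdef, map_add]; rw [hθ0.re, hre k s hs]
    · have h1 := hodd 0 s hs
      have e : sx 0 = 0 := rfl
      rw [e] at h1
      simp only [hcdef]
      rw [hθ0.zero, self_eq_neg.1 h1, add_zero]
  · by_contra hcon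
    have hz : ∀ x y, uu (fun k => c k 0) x y = 0 := fun x y => by
      have h1 : |uu (fun k => c k 0) x y| ≤ supNorm (fun x y => uu (fun k => c k 0) x y) :=
        le_ciSup (f := fun p : ℝ × ℝ => |uu (fun k => c k 0) p.1 p.2|)
          ⟨1, by rintro _ ⟨p, rfl⟩; exact hb _ _⟩ (x, y)
      have h2 := not_lt.1 hcon
      exact abs_eq_zero.1 (le_antisymm (h1.trans h2) (abs_nonneg _))
    have h3 := (uu_dx hc0 0 0).deriv
    rw [funext fun x' => hz x' 0] at h3
    rw [← h3] at hp0
    simp at hp0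
    linarith
  · exact ciSup_le fun p => hb _ _
  · exact hpos.trans_le (hp0.trans (le_grad hc0 0 0))
  · have hup : gradSupNorm (fun x y s => uu (fun k => c k s) x y) 0 ≤ Ax + G + Ay := by
      refine grad_le hc0 fun x y => ?_
      have e : dY φ0 = fun _ => 0 := funext hdY
      rw [hc00, dX_add, dY_add, uu_add hθ0.rd.dX hrd0.dX, uu_add hθ0.rd.dY hrd0.dY]
      have h1 := abs_uu_le hθ0.rd.dX.summable0 x y
      have h2 := abs_uu_le hrd0.dX.summable0 x y
      have h3 := abs_uu_le hθ0.rd.dY.summable0 x y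
      have h4 : uu (dY φ0) x y = 0 := by rw [e]; simp [uu, Fs]
      rw [h4, add_zero]
      have h5 := abs_add_le (uu (dX θ0) x y) (uu (dX φ0) x y)
      linarith
    have hlow := hy.trans (le_grad hct 0 y)
    have he : 1 + 2 * M ≤ Real.exp ((1 + 2 * M / t - 1) * t) := by
      have : (1 + 2 * M / t - 1) * t = 2 * M := by field_simp; ring
      rw [this]; linarith [Real.add_one_le_exp (2 * M)]
    have h6 : (G - Ax) * (1 + 2 * M) ≤ gradSupNorm (fun x y s => uu (fun k => c k s) x y) t :=
      (mul_le_mul hp0 he (by linarith) (abs_nonneg _)).trans hlow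
    have h7 := mul_le_mul_of_nonneg_left hup hM.le
    have h8 : M * (Ax + G + Ay) < (G - Ax) * (1 + 2 * M) := by nlinarith
    exact lt_of_le_of_lt h7 (h8.trans_le h6)
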